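/- Assume a ∈ K̂ with a > 0 on the closure of A, and let p > 2. Then c_I > 0, the infimum c_I is attained by some element of N_K, and every minimizer u ∈ N_K of I restricted to N_K belongs to K, is nontrivial, satisfies u > 0 in A, and is a weak solution of −Δu + u = a(x)|u|^{p−2}u in A with u = 0 on ∂A. -/

import Mathlib

open MeasureTheory Real Set

noncomputable section

/-- The open annulus `{x : R₀ < |x| < R₁}` in `ℝ^N`. -/
def annulus (N : ℕ) (R₀ R₁ : ℝ) : Set (EuclideanSpace ℝ (Fin N)) :=
  {x | R₀ < ‖x‖ ∧ ‖x‖ < R₁}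

/-- The last coordinate `x_N` of a point of `ℝ^N`. -/
def lastCoord {N : ℕ} (x : EuclideanSpace ℝ (Fin N)) : ℝ :=
  if h : 0 < N then x ⟨N - 1, by omega⟩ else 0

/-- The polar angle `θ = arcsin (x_N / |x|)`. -/
def angleOf {N : ℕ} (x : EuclideanSpace ℝ (Fin N)) : ℝ :=
  Real.arcsin (lastCoord x / ‖x‖)

/-- `u` is axially symmetric on the closed annulus with representative `𝔲 = 𝔲(r,θ)`. -/
def IsAxiallySymmRep (N : ℕ) (R₀ R₁ : ℝ) (u : EuclideanSpace ℝ (Fin N) → ℝ)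
    (𝔲 : ℝ → ℝ → ℝ) : Prop :=
  ∀ x ∈ closure (annulus N R₀ R₁), u x = 𝔲 ‖x‖ (angleOf x)

/-- Membership in the cone `K̂`: `C¹` on the closed annulus, nonnegative, axially symmetric,
even in `θ` and nonincreasing in `θ` on `[0, π/2]`. -/
def memKhat (N : ℕ) (R₀ R₁ : ℝ) (u : EuclideanSpace ℝ (Fin N) → ℝ) : Prop :=
  ContDiffOn ℝ 1 u (closure (annulus N R₀ R₁)) ∧
  (∀ x ∈ closure (annulus N R₀ R₁), 0 ≤ u x) ∧
  ∃ 𝔲 : ℝ → ℝ → ℝ,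
    IsAxiallySymmRep N R₀ R₁ u 𝔲 ∧
    (∀ r ∈ Icc R₀ R₁, ∀ θ ∈ Icc (-(π / 2)) (π / 2), 𝔲 r (-θ) = 𝔲 r θ) ∧
    (∀ r ∈ Icc R₀ R₁, AntitoneOn (𝔲 r) (Icc 0 (π / 2)))

/-- `C¹₀(A)` : `C¹` on the closed annulus, vanishing on the boundary. -/
def memC10 (N : ℕ) (R₀ R₁ : ℝ) (u : EuclideanSpace ℝ (Fin N) → ℝ) : Prop :=
  ContDiffOn ℝ 1 u (closure (annulus N R₀ R₁)) ∧
  ∀ x : EuclideanSpace ℝ (Fin N), (‖x‖ = R₀ ∨ ‖x‖ = R₁) → u x = 0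

/-- The cone `K = K̂ ∩ C¹₀(A)`. -/
def memK (N : ℕ) (R₀ R₁ : ℝ) (u : EuclideanSpace ℝ (Fin N) → ℝ) : Prop :=
  memKhat N R₀ R₁ u ∧ ∀ x : EuclideanSpace ℝ (Fin N), (‖x‖ = R₀ ∨ ‖x‖ = R₁) → u x = 0

/-- The squared `H¹(A)`-norm `∫_A (|∇u|² + u²) dx`. -/
def H1sq (N : ℕ) (R₀ R₁ : ℝ) (u : EuclideanSpace ℝ (Fin N) → ℝ) : ℝ :=
  ∫ x in annulus N R₀ R₁,
    (‖fderivWithin ℝ u (closure (annulus N R₀ R₁)) x‖ ^ 2 + (u x) ^ 2)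

/-- The energy functional `I(u) = ½‖u‖²_{H¹} − (1/p) ∫_A a |u|^p`. -/
def funcI (N : ℕ) (R₀ R₁ : ℝ) (a : EuclideanSpace ℝ (Fin N) → ℝ) (p : ℝ)
    (u : EuclideanSpace ℝ (Fin N) → ℝ) : ℝ :=
  (1 / 2) * H1sq N R₀ R₁ u - (1 / p) * ∫ x in annulus N R₀ R₁, a x * |u x| ^ p

/-- The Nehari set `N_K`. -/
def memNehari (N : ℕ) (R₀ R₁ : ℝ) (a : EuclideanSpace ℝ (Fin N) → ℝ) (p : ℝ)
    (u : EuclideanSpace ℝ (Fin N) → ℝ) : Prop :=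
  memK N R₀ R₁ u ∧ (∃ x ∈ annulus N R₀ R₁, u x ≠ 0) ∧
  H1sq N R₀ R₁ u = ∫ x in annulus N R₀ R₁, a x * |u x| ^ p

/-- The Nehari level `c_I = inf_{N_K} I`. -/
def cI (N : ℕ) (R₀ R₁ : ℝ) (a : EuclideanSpace ℝ (Fin N) → ℝ) (p : ℝ) : ℝ :=
  sInf {c | ∃ u, memNehari N R₀ R₁ a p u ∧ c = funcI N R₀ R₁ a p u}

/-- Test functions `C_c^∞(A)`. -/
def IsTestFun (N : ℕ) (R₀ R₁ : ℝ) (φ : EuclideanSpace ℝ (Fin N) → ℝ) : Prop :=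
  ContDiff ℝ (⊤ : ℕ∞) φ ∧ HasCompactSupport φ ∧ tsupport φ ⊆ annulus N R₀ R₁

/-- Weak solution of `−Δu + u = a(x)|u|^{p−2}u` in `A`, `u = 0` on `∂A`. -/
def IsWeakSolution (N : ℕ) (R₀ R₁ : ℝ) (a : EuclideanSpace ℝ (Fin N) → ℝ) (p : ℝ)
    (u : EuclideanSpace ℝ (Fin N) → ℝ) : Prop :=
  memC10 N R₀ R₁ u ∧
  ∀ φ : EuclideanSpace ℝ (Fin N) → ℝ, IsTestFun N R₀ R₁ φ →
    (∫ x in annulus N R₀ R₁,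
      (fderivWithin ℝ u (closure (annulus N R₀ R₁)) x (gradient φ x) + u x * φ x))
    = ∫ x in annulus N R₀ R₁, a x * |u x| ^ (p - 2) * u x * φ x

/-- The (classical) Laplacian, as the sum of second partial derivatives. -/
def lapl {N : ℕ} (u : EuclideanSpace ℝ (Fin N) → ℝ) (x : EuclideanSpace ℝ (Fin N)) : ℝ :=
  ∑ i : Fin N,
    fderiv ℝ (fun y => fderiv ℝ u y (EuclideanSpace.single i 1)) x (EuclideanSpace.single i 1)

/-- The inclusion `ℝ^{N-1} → ℝ^N`, `x' ↦ (x',0)`. -/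
def embedHyper (N : ℕ) (x' : EuclideanSpace ℝ (Fin (N - 1))) : EuclideanSpace ℝ (Fin N) :=
  (WithLp.equiv 2 (Fin N → ℝ)).symm
    (fun j => if h : (j : ℕ) < N - 1 then x' ⟨j, h⟩ else 0)

/-- A `C¹` distance on the closed annulus. -/
def C1dist (N : ℕ) (R₀ R₁ : ℝ) (u v : EuclideanSpace ℝ (Fin N) → ℝ) : ℝ :=
  (⨆ x : closure (annulus N R₀ R₁), |u x - v x|) +
  (⨆ x : closure (annulus N R₀ R₁),
    ‖fderivWithin ℝ u (closure (annulus N R₀ R₁)) x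
      - fderivWithin ℝ v (closure (annulus N R₀ R₁)) x‖)

end



/-- Short name for Euclidean space. -/
abbrev EE (N : ℕ) := EuclideanSpace ℝ (Fin N)

section Polar
variable {N : ℕ}

lemma polar_lintegral (hN : 1 ≤ N) (g : EE N → ENNReal) (hg : Measurable g) :
    ∫⁻ x, g x = ∫⁻ ω, (∫⁻ r in Ioi (0:ℝ), ENNReal.ofReal (r ^ (N - 1)) * g (r • (ω : EE N)))
      ∂(volume : Measure (EE N)).toSphere := by
  have h1 : ∫⁻ x, g x = ∫⁻ x : ({(0)}ᶜ : Set (EE N)), g x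
      ∂((volume : Measure (EE N)).comap Subtype.val) := by
    have : Nonempty (Fin N) := ⟨⟨0, hN⟩⟩
    rw [lintegral_subtype_comap (measurableSet_singleton _).compl fun x ↦ g x,
        restrict_compl_singleton]
  have hmp := (volume : Measure (EE N)).measurePreserving_homeomorphUnitSphereProd
  have h2 := hmp.lintegral_comp_emb (Homeomorph.measurableEmbedding _)
    (fun z => g ((z.2 : ℝ) • (z.1 : EE N)))
  have h3 : ∀ x : ({(0)}ᶜ : Set (EE N)),
      ((homeomorphUnitSphereProd (EE N) x).2 : ℝ) • ((homeomorphUnitSphereProd (EE N) x).1 : EE N)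
        = x := by
    intro x
    have hx : ‖(x : EE N)‖ ≠ 0 := norm_ne_zero_iff.2 x.2
    simp [smul_smul, hx]
  simp only [h3] at h2
  have hm : Measurable fun z : Metric.sphere (0 : EE N) 1 × Ioi (0:ℝ) =>
      g ((z.2 : ℝ) • (z.1 : EE N)) := by
    apply hg.comp
    fun_prop
  rw [h1, h2, lintegral_prod _ hm.aemeasurable]
  congr 1; ext ω
  rw [finrank_euclideanSpace_fin]
  simp only [Measure.volumeIoiPow]
  rw [lintegral_withDensity_eq_lintegral_mul _ (by fun_prop) (by apply hg.comp; fun_prop)]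
  simp only [Pi.mul_apply]
  rw [lintegral_subtype_comap measurableSet_Ioi
    fun a : ℝ ↦ ENNReal.ofReal (a ^ (N - 1)) * g (a • (ω:EE N))]

lemma polar_integral (hN : 1 ≤ N) (g : EE N → ℝ) (hg : Integrable g) :
    ∫ x, g x = ∫ ω, (∫ r in Ioi (0:ℝ), r ^ (N - 1) * g (r • (ω : EE N)))
      ∂(volume : Measure (EE N)).toSphere := by
  have h1 : ∫ x, g x = ∫ x : ({(0)}ᶜ : Set (EE N)), g x ∂((volume : Measure (EE N)).comap Subtype.val) := by
    have : Nonempty (Fin N) := ⟨⟨0, hN⟩⟩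
    rw [integral_subtype_comap (measurableSet_singleton _).compl fun x ↦ g x,
        restrict_compl_singleton]
  have hmp := (volume : Measure (EE N)).measurePreserving_homeomorphUnitSphereProd
  have h2 := hmp.integral_comp (Homeomorph.measurableEmbedding _)
    (fun z => g ((z.2 : ℝ) • (z.1 : EE N)))
  have hi := hmp.integrable_comp_emb (Homeomorph.measurableEmbedding _)
    (g := fun z => g ((z.2 : ℝ) • (z.1 : EE N)))
  have h3 : ∀ x : ({(0)}ᶜ : Set (EE N)),
      ((homeomorphUnitSphereProd (EE N) x).2 : ℝ) • ((homeomorphUnitSphereProd (EE N) x).1 : EE N)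
        = x := by
    intro x
    have hx : ‖(x : EE N)‖ ≠ 0 := norm_ne_zero_iff.2 x.2
    simp [smul_smul, hx]
  simp only [h3] at h2
  simp only [Function.comp_def, h3] at hi
  rw [h1, h2, integral_prod]
  · congr 1; ext ω
    rw [finrank_euclideanSpace_fin]
    simp only [Measure.volumeIoiPow, ENNReal.ofReal]
    rw [integral_withDensity_eq_integral_smul,
        integral_subtype_comap measurableSet_Ioi fun a ↦ Real.toNNReal (a ^ (N - 1)) • g (a • (ω:EE N)),
        setIntegral_congr_fun measurableSet_Ioi fun x hx ↦ ?_]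
    · rw [NNReal.smul_def, Real.coe_toNNReal _ (pow_nonneg hx.out.le _), smul_eq_mul]
    · exact (measurable_subtype_coe.pow_const _).real_toNNReal
  · rw [← hi]
    have := (integrableOn_iff_comap_subtypeVal (μ := volume) (f := g)
      (measurableSet_singleton (0:EE N)).compl).1 hg.integrableOn
    exact this

end Polar


section Kernel
variable {N : ℕ}

/-- The majorant weight. -/
noncomputable def WW (N : ℕ) (y : EE N) : ℝ := ‖y‖ ^ (-(((N:ℝ) + 2) / 2))

lemma WW_nonneg (y : EE N) : 0 ≤ WW N y := rpow_nonneg (norm_nonneg _) _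

lemma WW_measurable : Measurable (WW N) := by
  unfold WW
  fun_prop

/-- truncated kernel -/
noncomputable def kt (N : ℕ) (r β : ℝ) : EE N → ℝ :=
  (Metric.ball (0 : EE N) r).indicator (fun z => ‖z‖ ^ (-β))

lemma kt_integrable (hN : 3 ≤ N) (r β : ℝ) (hβ : β < N) : Integrable (kt N r β) := by
  unfold kt
  rw [integrable_indicator_iff measurableSet_ball]
  refine integrableOn_ball_of_norm_le_rpow (C := 1) (α := β) ?_ ?_ ?_ ?_
  · simp; omega
  · simpa using hβ
  · refine Filter.Eventually.of_forall fun x => ?_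
    rw [one_mul, Real.norm_of_nonneg (rpow_nonneg (norm_nonneg _) _)]
  · exact (by fun_prop : Measurable fun z : EE N => ‖z‖ ^ (-β)).aestronglyMeasurable

lemma kt_nonneg (r β : ℝ) (z : EE N) : 0 ≤ kt N r β z :=
  indicator_nonneg (fun _ _ => rpow_nonneg (norm_nonneg _) _) _

/-- tail weight -/
noncomputable def W2 (N : ℕ) (y : EE N) : ℝ := (1 + ‖y‖) ^ (-((N:ℝ) - 2)) * WW N y

lemma W2_nonneg (y : EE N) : 0 ≤ W2 N y := mul_nonneg (by positivity) (WW_nonneg y)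

lemma W2_integrable (hN : 3 ≤ N) : Integrable (W2 N) := by
  have hN' : (3:ℝ) ≤ N := by exact_mod_cast hN
  have h1 : Integrable (kt N 1 (((N:ℝ) + 2) / 2)) := kt_integrable hN _ _ (by linarith)
  have h2 : Integrable (fun y : EE N => (1 + ‖y‖) ^ (-(3 * (N:ℝ) / 2 - 1))) := by
    apply integrable_one_add_norm
    simp; linarith
  refine (h1.add (h2.const_mul ((2:ℝ) ^ (((N:ℝ) + 2) / 2)))).mono'
    (by unfold W2; exact (Measurable.mul (by fun_prop) WW_measurable).aestronglyMeasurable)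
    (Filter.Eventually.of_forall fun y => ?_)
  rw [Real.norm_of_nonneg (W2_nonneg y)]
  have p1 : (1:ℝ) ≤ 1 + ‖y‖ := by linarith [norm_nonneg y]
  by_cases hy : ‖y‖ < 1
  · have e1 : kt N 1 (((N:ℝ) + 2) / 2) y = WW N y := by
      unfold kt WW
      rw [indicator_of_mem (by simpa using hy)]
    simp only [Pi.add_apply, e1]
    have : W2 N y ≤ WW N y := by
      unfold W2
      apply mul_le_of_le_one_left (WW_nonneg y)
      apply rpow_le_one_of_one_le_of_nonpos p1 (by linarith)
    have : 0 ≤ (2:ℝ) ^ (((N:ℝ) + 2) / 2) * (1 + ‖y‖) ^ (-(3 * (N:ℝ) / 2 - 1)) := by positivity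
    linarith
  · push Not at hy
    have : W2 N y ≤ (2:ℝ) ^ (((N:ℝ) + 2) / 2) * (1 + ‖y‖) ^ (-(3 * (N:ℝ) / 2 - 1)) := by
      unfold W2 WW
      have e : (-(3 * (N:ℝ) / 2 - 1)) = (-((N:ℝ) - 2)) + (-(((N:ℝ) + 2) / 2)) := by ring
      rw [e, rpow_add (by positivity), mul_left_comm]
      apply mul_le_mul_of_nonneg_left _ (by positivity)
      have e2 : ‖y‖ ^ (-(((N:ℝ) + 2) / 2)) ≤ ((1 + ‖y‖) / 2) ^ (-(((N:ℝ) + 2) / 2)) := by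
        apply rpow_le_rpow_of_nonpos (by positivity) (by linarith) (by linarith)
      refine e2.trans (le_of_eq ?_)
      rw [div_rpow (by positivity) (by positivity), rpow_neg (by norm_num : (0:ℝ) ≤ 2), div_inv_eq_mul,
        mul_comm]
    have h0 := kt_nonneg (N := N) 1 (((N:ℝ) + 2) / 2) y
    simp only [Pi.add_apply]
    linarith

lemma kernel_pointwise (hN : 3 ≤ N) {ρ0 ρ1 β : ℝ} (h0 : 0 < ρ0) (h01 : ρ0 ≤ ρ1)
    (hβ : (N:ℝ) - 2 ≤ β) : ∃ C : ℝ, 0 ≤ C ∧ ∀ x y : EE N, ρ0 ≤ ‖x‖ → ‖x‖ ≤ ρ1 →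
      ‖x - y‖ ^ (-β) * WW N y ≤ C * (kt N (ρ0 / 2) β (x - y) + W2 N y) := by
  have hN' : (3:ℝ) ≤ N := by exact_mod_cast hN
  set r := ρ0 / 2 with hr
  have hr0 : 0 < r := by positivity
  have hρ1 : 0 < ρ1 := h0.trans_le h01
  set c := (1 + ρ1) / r + 1 with hc
  have hc0 : 0 < c := by positivity
  refine ⟨max (r ^ (-(((N:ℝ) + 2) / 2))) (c ^ β), le_max_of_le_left (by positivity), ?_⟩
  intro x y hx hx'
  by_cases h : ‖x - y‖ < r
  · have hy : r ≤ ‖y‖ := by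
      have := norm_sub_norm_le x y
      rw [hr] at *; linarith
    have e1 : WW N y ≤ r ^ (-(((N:ℝ) + 2) / 2)) :=
      rpow_le_rpow_of_nonpos hr0 hy (by linarith)
    have e2 : kt N r β (x - y) = ‖x - y‖ ^ (-β) := by
      unfold kt; rw [indicator_of_mem (by simpa using h)]
    have n1 : 0 ≤ ‖x - y‖ ^ (-β) := by positivity
    have n2 := W2_nonneg y
    rw [e2]
    calc ‖x - y‖ ^ (-β) * WW N y ≤ ‖x - y‖ ^ (-β) * max (r ^ (-(((N:ℝ) + 2) / 2))) (c ^ β) := by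
          apply mul_le_mul_of_nonneg_left (e1.trans (le_max_left _ _)) n1
      _ = max (r ^ (-(((N:ℝ) + 2) / 2))) (c ^ β) * ‖x - y‖ ^ (-β) := mul_comm _ _
      _ ≤ _ := by
          apply mul_le_mul_of_nonneg_left (by linarith) (le_max_of_le_left (by positivity))
  · push Not at h
    have hxy : 0 < ‖x - y‖ := hr0.trans_le h
    have e1 : (1 + ‖y‖) / c ≤ ‖x - y‖ := by
      rw [div_le_iff₀ hc0]
      have : ‖y‖ ≤ ‖x‖ + ‖x - y‖ := by
        have := norm_sub_norm_le y x
        rw [norm_sub_rev] at this; linarith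
      have : (1 + ρ1) ≤ ‖x - y‖ * ((1 + ρ1) / r) := by
        have : (1 + ρ1) = r * ((1 + ρ1) / r) := by field_simp
        calc (1 + ρ1) = r * ((1 + ρ1) / r) := this
          _ ≤ _ := by gcongr
      rw [hc, mul_add]; linarith
    have p1 : (1:ℝ) ≤ 1 + ‖y‖ := by linarith [norm_nonneg y]
    have e2 : ‖x - y‖ ^ (-β) ≤ c ^ β * (1 + ‖y‖) ^ (-((N:ℝ) - 2)) := by
      calc ‖x - y‖ ^ (-β) ≤ ((1 + ‖y‖) / c) ^ (-β) :=
            rpow_le_rpow_of_nonpos (by positivity) e1 (by linarith)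
        _ = c ^ β * (1 + ‖y‖) ^ (-β) := by
            rw [div_rpow (by positivity) (by positivity), rpow_neg hc0.le, div_inv_eq_mul, mul_comm]
        _ ≤ _ := by
            apply mul_le_mul_of_nonneg_left _ (by positivity)
            apply rpow_le_rpow_of_exponent_le p1 (by linarith)
    calc ‖x - y‖ ^ (-β) * WW N y ≤ (c ^ β * (1 + ‖y‖) ^ (-((N:ℝ) - 2))) * WW N y :=
          mul_le_mul_of_nonneg_right e2 (WW_nonneg y)
      _ = c ^ β * W2 N y := by unfold W2; ring
      _ ≤ _ := by
          apply mul_le_mul (le_max_right _ _) _ (W2_nonneg y) (le_max_of_le_left (by positivity))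
          linarith [kt_nonneg (N := N) r β (x - y)]

lemma kernel_bound (hN : 3 ≤ N) {ρ0 ρ1 β : ℝ} (h0 : 0 < ρ0)
    (hβ : (N:ℝ) - 2 ≤ β) (hβ' : β < N) : ∃ C : ℝ, 0 ≤ C ∧ ∀ x : EE N, ρ0 ≤ ‖x‖ → ‖x‖ ≤ ρ1 →
      Integrable (fun y : EE N => ‖x - y‖ ^ (-β) * WW N y) ∧
      ∫ y : EE N, ‖x - y‖ ^ (-β) * WW N y ≤ C := by
  by_cases h01 : ρ0 ≤ ρ1
  swap
  · exact ⟨0, le_rfl, fun x h h' => absurd (h.trans h') h01⟩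
  obtain ⟨C, hC, h⟩ := kernel_pointwise hN h0 h01 hβ
  have hk := kt_integrable hN (ρ0 / 2) β hβ'
  have hW := W2_integrable hN
  refine ⟨C * ((∫ z, kt N (ρ0/2) β z) + ∫ y, W2 N y), mul_nonneg hC (add_nonneg
    (integral_nonneg (kt_nonneg _ _)) (integral_nonneg W2_nonneg)), fun x hx hx' => ?_⟩
  have hi : Integrable (fun y => C * (kt N (ρ0 / 2) β (x - y) + W2 N y)) :=
    ((hk.comp_sub_left x).add hW).const_mul C
  have hi2 : Integrable (fun y : EE N => ‖x - y‖ ^ (-β) * WW N y) := by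
    refine hi.mono' (Measurable.mul (by fun_prop) WW_measurable).aestronglyMeasurable
      (Filter.Eventually.of_forall fun y => ?_)
    rw [Real.norm_of_nonneg (mul_nonneg (by positivity) (WW_nonneg y))]
    exact h x y hx hx'
  refine ⟨hi2, ?_⟩
  calc ∫ y : EE N, ‖x - y‖ ^ (-β) * WW N y
      ≤ ∫ y, C * (kt N (ρ0 / 2) β (x - y) + W2 N y) :=
        integral_mono hi2 hi fun y => h x y hx hx'
    _ = _ := by
        rw [integral_const_mul, integral_add (hk.comp_sub_left x) hW]
        congr 2
        exact integral_sub_left_eq_self (kt N (ρ0/2) β) volume x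

/-- the gradient kernel -/
noncomputable def gk (N : ℕ) (z : EE N) : EE N := (‖z‖ ^ (-(N:ℝ))) • z

lemma gk_norm {z : EE N} (hz : z ≠ 0) : ‖gk N z‖ = ‖z‖ ^ (-((N:ℝ) - 1)) := by
  unfold gk
  have : 0 < ‖z‖ := norm_pos_iff.2 hz
  rw [norm_smul, Real.norm_of_nonneg (by positivity)]
  have e : -((N:ℝ) - 1) = -(N:ℝ) + 1 := by ring
  rw [e, rpow_add this, rpow_one]

lemma gk_norm_le (z : EE N) : ‖gk N z‖ ≤ ‖z‖ ^ (-((N:ℝ) - 1)) := by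
  by_cases hz : z = 0
  · subst hz; simp [gk]; positivity
  · exact (gk_norm hz).le

lemma gk_measurable : Measurable (gk N) := by
  unfold gk; fun_prop

lemma gk_holder_aux (hN : 3 ≤ N) {z z' : EE N} (hz' : z' ≠ 0)
    (h : ‖z'‖ ≤ ‖z‖) : ‖gk N z - gk N z'‖ ≤ 2 * N * √‖z - z'‖ *
      (‖z‖ ^ (-((N:ℝ) - 1/2)) + ‖z'‖ ^ (-((N:ℝ) - 1/2))) := by
  have hN' : (3:ℝ) ≤ N := by exact_mod_cast hN
  have ht : 0 < ‖z'‖ := norm_pos_iff.2 hz'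
  have hs : 0 < ‖z‖ := ht.trans_le h
  have e0 : gk N z - gk N z' = ‖z‖ ^ (-(N:ℝ)) • (z - z')
      - (‖z'‖ ^ (-(N:ℝ)) - ‖z‖ ^ (-(N:ℝ))) • z' := by
    unfold gk; module
  have hmono : ‖z‖ ^ (-(N:ℝ)) ≤ ‖z'‖ ^ (-(N:ℝ)) := rpow_le_rpow_of_nonpos ht h (by linarith)
  have e1 : ‖gk N z - gk N z'‖ ≤ ‖z‖ ^ (-(N:ℝ)) * ‖z - z'‖
      + (‖z'‖ ^ (-(N:ℝ)) - ‖z‖ ^ (-(N:ℝ))) * ‖z'‖ := by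
    rw [e0]
    refine (norm_sub_le _ _).trans ?_
    rw [norm_smul, norm_smul, Real.norm_of_nonneg (by positivity),
      Real.norm_of_nonneg (by linarith)]
  have hd : ‖z - z'‖ ≤ 2 * ‖z‖ := by
    have := norm_sub_le z z'; linarith
  have half : ∀ t : ℝ, 0 < t → t ^ (-((N:ℝ) - 1/2)) = t ^ (-(N:ℝ)) * √t := by
    intro t ht
    rw [sqrt_eq_rpow, ← rpow_add ht]; congr 1; ring
  have f1 : ‖z‖ ^ (-(N:ℝ)) * ‖z - z'‖ ≤ 2 * N * √‖z - z'‖ * ‖z‖ ^ (-((N:ℝ) - 1/2)) := by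
    rw [half _ hs]
    have a1 : ‖z - z'‖ = √‖z - z'‖ * √‖z - z'‖ := (mul_self_sqrt (norm_nonneg _)).symm
    have a2 : √‖z - z'‖ ≤ 2 * √‖z‖ := by
      calc √‖z - z'‖ ≤ √(2 * ‖z‖) := sqrt_le_sqrt hd
        _ = √2 * √‖z‖ := sqrt_mul (by norm_num) _
        _ ≤ 2 * √‖z‖ := by
          apply mul_le_mul_of_nonneg_right _ (sqrt_nonneg _)
          rw [sqrt_le_left (by norm_num)]; norm_num
    calc ‖z‖ ^ (-(N:ℝ)) * ‖z - z'‖ = ‖z‖ ^ (-(N:ℝ)) * √‖z - z'‖ * √‖z - z'‖ := by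
          rw [mul_assoc, ← a1]
      _ ≤ ‖z‖ ^ (-(N:ℝ)) * √‖z - z'‖ * (2 * √‖z‖) := by gcongr
      _ = 2 * 1 * √‖z - z'‖ * (‖z‖ ^ (-(N:ℝ)) * √‖z‖) := by ring
      _ ≤ _ := by gcongr; linarith
  have f2 : (‖z'‖ ^ (-(N:ℝ)) - ‖z‖ ^ (-(N:ℝ))) * ‖z'‖
      ≤ 2 * N * √‖z - z'‖ * ‖z'‖ ^ (-((N:ℝ) - 1/2)) := by
    rw [half _ ht]
    set q := ‖z'‖ / ‖z‖ with hq
    have hq0 : 0 ≤ q := by positivity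
    have hq1 : q ≤ 1 := (div_le_one hs).2 h
    have a1 : ‖z‖ ^ (-(N:ℝ)) = ‖z'‖ ^ (-(N:ℝ)) * q ^ N := by
      rw [hq, div_pow, rpow_neg hs.le, rpow_neg ht.le, rpow_natCast, rpow_natCast]
      field_simp
    have a2 : 1 - q ^ N ≤ N * (1 - q) := by
      have := one_add_mul_le_pow (a := q - 1) (by linarith) N
      simp only [add_sub_cancel] at this
      linarith
    have a3 : 0 ≤ 1 - q ^ N := by linarith [pow_le_one₀ hq0 hq1 (n := N)]
    have a4 : 1 - q ^ N ≤ 1 := by linarith [pow_nonneg hq0 N]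
    have a5 : 1 - q ^ N ≤ √(N * (1 - q)) := by
      apply le_sqrt_of_sq_le
      nlinarith
    have a6 : (1 - q) ≤ ‖z - z'‖ / ‖z'‖ := by
      rw [le_div_iff₀ ht]
      have : ‖z‖ - ‖z'‖ ≤ ‖z - z'‖ := norm_sub_norm_le _ _
      have : (1 - q) * ‖z'‖ ≤ (1 - q) * ‖z‖ := by
        apply mul_le_mul_of_nonneg_left h (by linarith)
      have : (1 - q) * ‖z‖ = ‖z‖ - ‖z'‖ := by rw [hq]; field_simp
      linarith
    have a7 : 1 - q ^ N ≤ N * (√‖z - z'‖ / √‖z'‖) := by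
      refine a5.trans ?_
      rw [← sqrt_div (norm_nonneg _), sqrt_mul (by positivity)]
      gcongr
      rw [sqrt_le_left (by positivity)]
      nlinarith
    have hst : 0 < √‖z'‖ := sqrt_pos.2 ht
    calc (‖z'‖ ^ (-(N:ℝ)) - ‖z‖ ^ (-(N:ℝ))) * ‖z'‖
        = ‖z'‖ ^ (-(N:ℝ)) * ‖z'‖ * (1 - q ^ N) := by rw [a1]; ring
      _ ≤ ‖z'‖ ^ (-(N:ℝ)) * ‖z'‖ * (N * (√‖z - z'‖ / √‖z'‖)) := by gcongr
      _ = N * √‖z - z'‖ * (‖z'‖ ^ (-(N:ℝ)) * (‖z'‖ / √‖z'‖)) := by ring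
      _ = N * √‖z - z'‖ * (‖z'‖ ^ (-(N:ℝ)) * √‖z'‖) := by rw [div_sqrt]
      _ ≤ _ := by
        have : 0 ≤ N * √‖z - z'‖ * (‖z'‖ ^ (-(N:ℝ)) * √‖z'‖) := by positivity
        linarith
  calc _ ≤ _ := e1
    _ ≤ _ := add_le_add f1 f2
    _ = _ := by ring

lemma gk_holder (hN : 3 ≤ N) {z z' : EE N} (hz : z ≠ 0) (hz' : z' ≠ 0) :
    ‖gk N z - gk N z'‖ ≤ 2 * N * √‖z - z'‖ *
      (‖z‖ ^ (-((N:ℝ) - 1/2)) + ‖z'‖ ^ (-((N:ℝ) - 1/2))) := by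
  rcases le_total ‖z'‖ ‖z‖ with h | h
  · exact gk_holder_aux hN hz' h
  · have := gk_holder_aux hN hz h
    rw [norm_sub_rev, norm_sub_rev z z', add_comm]
    exact this

end Kernel


section Pot
variable {N : ℕ}

/-- surface measure of the unit sphere -/
noncomputable def sig (N : ℕ) : ℝ := ((volume : Measure (EE N)).toSphere).real univ

lemma sig_pos (hN : 3 ≤ N) : 0 < sig N := by
  unfold sig
  have : Nonempty (Fin N) := ⟨⟨0, by omega⟩⟩
  have h : (volume : Measure (EE N)).toSphere ≠ 0 := Measure.toSphere_ne_zero _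
  rw [Measure.real, ENNReal.toReal_pos_iff]
  refine ⟨?_, measure_lt_top _ _⟩
  rw [pos_iff_ne_zero]
  exact fun h' => h (Measure.measure_univ_eq_zero.1 h')

/-- Newtonian potential -/
noncomputable def Pot (N : ℕ) (F : EE N → ℝ) (x : EE N) : ℝ :=
  (1 / (((N:ℝ) - 2) * sig N)) * ∫ y, ‖x - y‖ ^ (-((N:ℝ) - 2)) * F y

/-- gradient of the Newtonian potential -/
noncomputable def VV (N : ℕ) (F : EE N → ℝ) (x : EE N) : EE N :=
  (-(1 / sig N)) • ∫ y, F y • gk N (x - y)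

lemma ker_integrable (hN : 3 ≤ N) {F : EE N → ℝ} {B : ℝ} (hF : Measurable F)
    (hB : ∀ y, |F y| ≤ B * WW N y) {x : EE N} (hx : x ≠ 0) {β : ℝ}
    (hβ : (N:ℝ) - 2 ≤ β) (hβ' : β < N) :
    Integrable (fun y => ‖x - y‖ ^ (-β) * F y) ∧
    ∫ y, ‖x - y‖ ^ (-β) * |F y| ≤ B * ∫ y, ‖x - y‖ ^ (-β) * WW N y := by
  obtain ⟨C, hC, h⟩ := kernel_bound hN (ρ0 := ‖x‖) (ρ1 := ‖x‖) (norm_pos_iff.2 hx) hβ hβ'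
  obtain ⟨h1, -⟩ := h x le_rfl le_rfl
  have hb : ∀ y, ‖x - y‖ ^ (-β) * |F y| ≤ B * (‖x - y‖ ^ (-β) * WW N y) := by
    intro y
    calc _ ≤ ‖x - y‖ ^ (-β) * (B * WW N y) := by gcongr; exact hB y
      _ = _ := by ring
  have hi : Integrable (fun y => ‖x - y‖ ^ (-β) * F y) := by
    refine (h1.const_mul B).mono' (Measurable.mul (by fun_prop) hF).aestronglyMeasurable
      (Filter.Eventually.of_forall fun y => ?_)
    rw [norm_mul, Real.norm_of_nonneg (by positivity)]
    exact hb y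
  refine ⟨hi, ?_⟩
  rw [← integral_const_mul]
  refine integral_mono ?_ (h1.const_mul B) hb
  have := hi.norm
  refine this.congr (Filter.Eventually.of_forall fun y => ?_)
  simp only [norm_mul]
  rw [Real.norm_of_nonneg (by positivity), Real.norm_eq_abs]

lemma gker_integrable (hN : 3 ≤ N) {F : EE N → ℝ} {B : ℝ} (hF : Measurable F)
    (hB : ∀ y, |F y| ≤ B * WW N y) {x : EE N} (hx : x ≠ 0) :
    Integrable (fun y => F y • gk N (x - y)) := by
  have h := (ker_integrable hN hF hB hx (β := (N:ℝ) - 1) (by linarith) (by linarith)).1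
  refine h.mono (Measurable.smul hF (gk_measurable.comp (by fun_prop))).aestronglyMeasurable
    (Filter.Eventually.of_forall fun y => ?_)
  rw [norm_smul, norm_mul, mul_comm, Real.norm_of_nonneg (r := ‖x - y‖ ^ (-((N:ℝ) - 1))) (by positivity)]
  gcongr
  exact gk_norm_le _

/-- uniform estimates on shells -/
lemma pot_bounds (hN : 3 ≤ N) {ρ0 ρ1 : ℝ} (h0 : 0 < ρ0) :
    ∃ C : ℝ, 0 ≤ C ∧ ∀ (B : ℝ) (F : EE N → ℝ), 0 ≤ B → Measurable F →
      (∀ y, |F y| ≤ B * WW N y) → ∀ x : EE N, ρ0 ≤ ‖x‖ → ‖x‖ ≤ ρ1 →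
      |Pot N F x| ≤ C * B ∧ ‖VV N F x‖ ≤ C * B ∧
      (∫ y, ‖x - y‖ ^ (-((N:ℝ) - 1)) * |F y| ≤ C * B) ∧
      ∀ x' : EE N, ρ0 ≤ ‖x'‖ → ‖x'‖ ≤ ρ1 → ‖VV N F x - VV N F x'‖ ≤ C * B * √‖x - x'‖ := by
  have hN' : (3:ℝ) ≤ N := by exact_mod_cast hN
  have hσ := sig_pos hN
  obtain ⟨C1, hC1, H1⟩ := kernel_bound hN (ρ1 := ρ1) h0 (β := (N:ℝ) - 2) le_rfl (by linarith)
  obtain ⟨C2, hC2, H2⟩ := kernel_bound hN (ρ1 := ρ1) h0 (β := (N:ℝ) - 1) (by linarith) (by linarith)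
  obtain ⟨C3, hC3, H3⟩ := kernel_bound hN (ρ1 := ρ1) h0 (β := (N:ℝ) - 1/2) (by linarith) (by linarith)
  set D1 := (1 / (((N:ℝ) - 2) * sig N)) * C1
  set D2 := (1 / sig N) * C2
  set D3 := (1 / sig N) * (2 * N * (2 * C3))
  have pN : 0 < (N:ℝ) - 2 := by linarith
  have hD1 : 0 ≤ D1 := by positivity
  have hD2 : 0 ≤ D2 := by positivity
  have hD3 : 0 ≤ D3 := by positivity
  refine ⟨D1 + D2 + D3 + C2, by positivity, fun B F hB0 hF hB x hx hx' => ?_⟩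
  have ne : ∀ z : EE N, ρ0 ≤ ‖z‖ → z ≠ 0 := fun z hz => norm_pos_iff.1 (h0.trans_le hz)
  have k1 : ∀ β : ℝ, (N:ℝ) - 2 ≤ β → β < N → ∀ C, 0 ≤ C → ∀ x : EE N, ρ0 ≤ ‖x‖ →
      ∫ y, ‖x - y‖ ^ (-β) * WW N y ≤ C → ∫ y, ‖x - y‖ ^ (-β) * |F y| ≤ C * B := by
    intro β b1 b2 C hC x hx h
    refine (ker_integrable hN hF hB (ne x hx) b1 b2).2.trans ?_
    rw [mul_comm C]; gcongr
  have e2 := k1 _ (by linarith) (by linarith) C2 hC2 x hx (H2 x hx hx').2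
  refine ⟨?_, ?_, ?_, ?_⟩
  · have := k1 _ (by linarith) (by linarith) C1 hC1 x hx (H1 x hx hx').2
    unfold Pot
    rw [abs_mul, abs_of_nonneg (by positivity)]
    calc _ ≤ (1 / (((N:ℝ) - 2) * sig N)) * (C1 * B) := by
          gcongr
          rw [← Real.norm_eq_abs]
          refine le_trans (norm_integral_le_integral_norm _) ?_
          refine le_trans (le_of_eq ?_) this
          congr 1; ext y
          rw [norm_mul, Real.norm_of_nonneg (by positivity), Real.norm_eq_abs]
      _ = D1 * B := by ring
      _ ≤ _ := by gcongr; linarith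
  · unfold VV
    rw [norm_smul, norm_neg, Real.norm_of_nonneg (by positivity)]
    calc _ ≤ (1 / sig N) * (C2 * B) := by
          gcongr
          refine le_trans (norm_integral_le_integral_norm _) ?_
          refine le_trans ?_ e2
          have hi := (ker_integrable hN hF hB (ne x hx) (β := (N:ℝ) - 1) (by linarith) (by linarith)).1
          have hi' : Integrable fun y => ‖x - y‖ ^ (-((N:ℝ) - 1)) * |F y| := by
            refine hi.norm.congr (Filter.Eventually.of_forall fun y => ?_)
            simp only [norm_mul]
            rw [Real.norm_of_nonneg (by positivity), Real.norm_eq_abs]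
          refine integral_mono (gker_integrable hN hF hB (ne x hx)).norm hi' fun y => ?_
          simp only [norm_smul, Real.norm_eq_abs]
          rw [mul_comm]
          gcongr
          exact gk_norm_le _
      _ = D2 * B := by ring
      _ ≤ _ := by gcongr; linarith
  · refine e2.trans ?_
    gcongr; linarith
  · intro x' hx1 hx1'
    have i1 := gker_integrable hN hF hB (ne x hx)
    have i2 := gker_integrable hN hF hB (ne x' hx1)
    have habs : ∀ x : EE N, ρ0 ≤ ‖x‖ →
        Integrable fun y => ‖x - y‖ ^ (-((N:ℝ) - 1/2)) * |F y| := by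
      intro x hx
      have hi := (ker_integrable hN hF hB (ne x hx) (β := (N:ℝ) - 1/2) (by linarith) (by linarith)).1
      refine hi.norm.congr (Filter.Eventually.of_forall fun y => ?_)
      simp only [norm_mul]
      rw [Real.norm_of_nonneg (by positivity), Real.norm_eq_abs]
    have j1 := habs x hx
    have j2 := habs x' hx1
    have g1 := k1 _ (by linarith) (by linarith) C3 hC3 x hx (H3 x hx hx').2
    have g2 := k1 _ (by linarith) (by linarith) C3 hC3 x' hx1 (H3 x' hx1 hx1').2
    unfold VV
    rw [← smul_sub, norm_smul, norm_neg, Real.norm_of_nonneg (by positivity), ← integral_sub i1 i2]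
    calc _ ≤ (1 / sig N) * (2 * N * √‖x - x'‖ * (C3 * B + C3 * B)) := by
          gcongr
          refine le_trans (norm_integral_le_integral_norm _) ?_
          calc _ ≤ ∫ y, 2 * N * √‖x - x'‖ * (‖x - y‖ ^ (-((N:ℝ) - 1/2)) * |F y|
                + ‖x' - y‖ ^ (-((N:ℝ) - 1/2)) * |F y|) := by
                refine integral_mono_ae (i1.sub i2).norm ((j1.add j2).const_mul _) ?_
                have : Nonempty (Fin N) := ⟨⟨0, by omega⟩⟩
                have n1 : ∀ᵐ y : EE N, y ≠ x := by simp [ae_iff]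
                have n2 : ∀ᵐ y : EE N, y ≠ x' := by simp [ae_iff]
                filter_upwards [n1, n2] with y y1 y2
                have := gk_holder hN (z := x - y) (z' := x' - y) (sub_ne_zero.2 y1.symm)
                  (sub_ne_zero.2 y2.symm)
                rw [← smul_sub, norm_smul, Real.norm_eq_abs]
                rw [sub_sub_sub_cancel_right] at this
                calc _ ≤ _ := mul_le_mul_of_nonneg_left this (abs_nonneg _)
                  _ = _ := by ring
            _ = 2 * N * √‖x - x'‖ * ((∫ y, ‖x - y‖ ^ (-((N:ℝ) - 1/2)) * |F y|)
                + ∫ y, ‖x' - y‖ ^ (-((N:ℝ) - 1/2)) * |F y|) := by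
                rw [integral_const_mul, integral_add j1 j2]
            _ ≤ _ := by gcongr
      _ = D3 * B * √‖x - x'‖ := by ring
      _ ≤ _ := by gcongr; linarith

/-- FTC for the kernel -/
lemma ker_hasDeriv {z h : EE N} {t : ℝ} (hz : z + t • h ≠ 0) :
    HasDerivAt (fun t : ℝ => ‖z + t • h‖ ^ (-((N:ℝ) - 2)))
      (-((N:ℝ) - 2) * inner ℝ (gk N (z + t • h)) h) t := by
  have h1 : HasDerivAt (fun t : ℝ => z + t • h) h t := by
    simpa using ((hasDerivAt_id t).smul_const h).const_add z
  have hp : 0 < ‖z + t • h‖ := norm_pos_iff.2 hz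
  have h2 : HasDerivAt (fun t : ℝ => ‖z + t • h‖ ^ 2) (2 * inner ℝ (z + t • h) h) t := h1.norm_sq
  have h3 := h2.rpow_const (p := -((N:ℝ) - 2) / 2) (Or.inl (by positivity))
  have e : (fun t : ℝ => ‖z + t • h‖ ^ (-((N:ℝ) - 2))) =
      fun t => (‖z + t • h‖ ^ 2) ^ (-((N:ℝ) - 2) / 2) := by
    ext t
    rw [← rpow_natCast, ← rpow_mul (norm_nonneg _)]
    congr 1; push_cast; ring
  rw [e]
  convert h3 using 1
  unfold gk
  rw [← rpow_natCast, ← rpow_mul (norm_nonneg _), inner_smul_left]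
  have : (↑(2:ℕ) : ℝ) * (-((N:ℝ) - 2) / 2 - 1) = -(N:ℝ) := by push_cast; ring
  rw [this]
  simp only [conj_trivial]
  ring

lemma ker_ftc {z h : EE N} (hz : ∀ t ∈ Icc (0:ℝ) 1, z + t • h ≠ 0) :
    ‖z + h‖ ^ (-((N:ℝ) - 2)) - ‖z‖ ^ (-((N:ℝ) - 2))
      = ∫ t in (0:ℝ)..1, (-((N:ℝ) - 2) * inner ℝ (gk N (z + t • h)) h) := by
  rw [intervalIntegral.integral_eq_sub_of_hasDerivAt (f := fun t : ℝ => ‖z + t • h‖ ^ (-((N:ℝ) - 2)))]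
  · simp
  · intro t ht
    rw [uIcc_of_le zero_le_one] at ht
    exact ker_hasDeriv (hz t ht)
  · apply ContinuousOn.intervalIntegrable
    rw [uIcc_of_le zero_le_one]
    unfold gk
    apply ContinuousOn.mul continuousOn_const
    apply ContinuousOn.inner _ continuousOn_const
    refine ContinuousOn.fun_smul ?_ (by fun_prop)
    refine ContinuousOn.rpow_const (by fun_prop) ?_
    intro t ht
    exact Or.inl (norm_ne_zero_iff.2 (hz t ht))

lemma segment_null (hN : 3 ≤ N) (x h : EE N) : ∀ᵐ y : EE N, ∀ t ∈ Icc (0:ℝ) 1, x - y + t • h ≠ 0 := by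
  have h1 : (volume : Measure (EE N)) (AffineSubspace.mk' x (Submodule.span ℝ {h}) : Set (EE N)) = 0 := by
    apply Measure.addHaar_affineSubspace
    intro htop
    have := congrArg AffineSubspace.direction htop
    rw [AffineSubspace.direction_mk', AffineSubspace.direction_top] at this
    have h2 := finrank_span_le_card (R := ℝ) ({h} : Set (EE N))
    rw [this] at h2
    simp at h2
    omega
  have h2 : ∀ᵐ y : EE N, y ∉ (AffineSubspace.mk' x (Submodule.span ℝ {h}) : Set (EE N)) := by
    rw [ae_iff]; simp only [not_not]; exact h1
  filter_upwards [h2] with y hy t ht he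
  apply hy
  simp only [SetLike.mem_coe, AffineSubspace.mem_mk', vsub_eq_sub]
  rw [Submodule.mem_span_singleton]
  refine ⟨t, ?_⟩
  have : t • h = (x - y + t • h) + (y - x) := by abel
  rw [this, he, zero_add]

lemma pot_ftc (hN : 3 ≤ N) {F : EE N → ℝ} {B : ℝ} (hB0 : 0 ≤ B) (hF : Measurable F)
    (hB : ∀ y, |F y| ≤ B * WW N y) {x h : EE N} {ρ0 ρ1 : ℝ} (h0 : 0 < ρ0)
    (hx : ∀ t ∈ Icc (0:ℝ) 1, ρ0 ≤ ‖x + t • h‖ ∧ ‖x + t • h‖ ≤ ρ1) :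
    Pot N F (x + h) - Pot N F x = ∫ t in (0:ℝ)..1, inner ℝ (VV N F (x + t • h)) h := by
  have hN' : (3:ℝ) ≤ N := by exact_mod_cast hN
  have hσ := sig_pos hN
  obtain ⟨C, hC, H⟩ := pot_bounds hN (ρ1 := ρ1) h0
  have ne : ∀ t ∈ Icc (0:ℝ) 1, x + t • h ≠ 0 := fun z hz => norm_pos_iff.1 (h0.trans_le (hx z hz).1)
  have ne0 : x ≠ 0 := by simpa using ne 0 (by simp)
  have ne1 : x + h ≠ 0 := by simpa using ne 1 (by simp)
  have i0 := (ker_integrable hN hF hB ne0 (β := (N:ℝ) - 2) (by linarith) (by linarith)).1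
  have i1 := (ker_integrable hN hF hB ne1 (β := (N:ℝ) - 2) (by linarith) (by linarith)).1
  have hm : Measurable (fun q : ℝ × EE N => F q.2 * inner ℝ (gk N (x + q.1 • h - q.2)) h) := by
    apply (hF.comp measurable_snd).mul
    apply Measurable.inner _ measurable_const
    exact gk_measurable.comp (by fun_prop)
  have hint : Integrable (fun q : ℝ × EE N => F q.2 * inner ℝ (gk N (x + q.1 • h - q.2)) h)
      ((volume.restrict (Ioc (0:ℝ) 1)).prod volume) := by
    rw [integrable_prod_iff hm.aestronglyMeasurable]
    have hI : ∀ t ∈ Ioc (0:ℝ) 1, Integrable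
        (fun y : EE N => F y * inner ℝ (gk N (x + t • h - y)) h) := by
      intro t ht
      have := (gker_integrable hN hF hB (ne t (Ioc_subset_Icc_self ht))).inner_const (𝕜 := ℝ) h
      refine this.congr (Filter.Eventually.of_forall fun y => ?_)
      simp [inner_smul_left]
    constructor
    · exact (ae_restrict_iff' measurableSet_Ioc).2 (Filter.Eventually.of_forall fun t ht => hI t ht)
    · refine Integrable.mono' (g := fun _ => C * B * ‖h‖) (integrable_const _) ?_ ?_
      · exact (hm.norm.aestronglyMeasurable).integral_prod_right'
      · refine (ae_restrict_iff' measurableSet_Ioc).2 (Filter.Eventually.of_forall fun t ht => ?_)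
        have ht' := Ioc_subset_Icc_self ht
        have hb := (H B F hB0 hF hB _ (hx t ht').1 (hx t ht').2).2.2.1
        have hi := (ker_integrable hN hF hB (ne t ht') (β := (N:ℝ) - 1) (by linarith) (by linarith)).1
        have hi' : Integrable fun y => ‖x + t • h - y‖ ^ (-((N:ℝ) - 1)) * |F y| := by
          refine hi.norm.congr (Filter.Eventually.of_forall fun y => ?_)
          simp only [norm_mul]
          rw [Real.norm_of_nonneg (by positivity), Real.norm_eq_abs]
        rw [Real.norm_of_nonneg (integral_nonneg fun _ => norm_nonneg _)]
        calc _ ≤ ∫ y, ‖x + t • h - y‖ ^ (-((N:ℝ) - 1)) * |F y| * ‖h‖ := by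
              refine integral_mono (hI t ht).norm (hi'.mul_const _) fun y => ?_
              simp only [norm_mul, Real.norm_eq_abs (F y)]
              calc _ ≤ |F y| * (‖gk N (x + t • h - y)‖ * ‖h‖) := by
                    gcongr; exact norm_inner_le_norm _ _
                _ ≤ |F y| * (‖x + t • h - y‖ ^ (-((N:ℝ) - 1)) * ‖h‖) := by
                    gcongr; exact gk_norm_le _
                _ = _ := by ring
          _ = (∫ y, ‖x + t • h - y‖ ^ (-((N:ℝ) - 1)) * |F y|) * ‖h‖ := integral_mul_const _ _
          _ ≤ _ := by gcongr
  unfold Pot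
  rw [← mul_sub, ← integral_sub i1 i0]
  have e1 : ∫ y, (‖x + h - y‖ ^ (-((N:ℝ) - 2)) * F y - ‖x - y‖ ^ (-((N:ℝ) - 2)) * F y)
      = ∫ y, ∫ t in Ioc (0:ℝ) 1, -((N:ℝ) - 2) * (F y * inner ℝ (gk N (x + t • h - y)) h) := by
    apply integral_congr_ae
    filter_upwards [segment_null hN x h] with y hy
    rw [← sub_mul]
    have := ker_ftc hy
    rw [show x + h - y = x - y + h by abel, this, intervalIntegral.integral_of_le zero_le_one,
      ← integral_mul_const]
    congr 1; ext t
    rw [show x + t • h - y = x - y + t • h by abel]; ring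
  rw [e1, intervalIntegral.integral_of_le zero_le_one]
  simp_rw [integral_const_mul (-((N:ℝ) - 2))]
  rw [← integral_integral_swap (f := fun (t : ℝ) (y : EE N) => F y * inner ℝ (gk N (x + t • h - y)) h) hint,
    ← integral_const_mul, ← integral_const_mul]
  refine setIntegral_congr_fun measurableSet_Ioc fun t ht => ?_
  have ht' := Ioc_subset_Icc_self ht
  simp only [VV]
  have hg := gker_integrable hN hF hB (ne t ht')
  rw [inner_smul_left, real_inner_comm, ← integral_inner hg]
  simp only [inner_smul_right, conj_trivial]
  simp_rw [real_inner_comm h]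
  have : (N:ℝ) - 2 ≠ 0 := by linarith
  field_simp

lemma pot_hasFDerivAt (hN : 3 ≤ N) {F : EE N → ℝ} {B : ℝ} (hB0 : 0 ≤ B) (hF : Measurable F)
    (hB : ∀ y, |F y| ≤ B * WW N y) {x : EE N} (hx : x ≠ 0) :
    HasFDerivAt (Pot N F) (innerSL ℝ (VV N F x)) x := by
  have hx0 : 0 < ‖x‖ := norm_pos_iff.2 hx
  obtain ⟨C, hC, H⟩ := pot_bounds hN (ρ0 := ‖x‖ / 2) (ρ1 := 2 * ‖x‖) (by positivity)
  rw [hasFDerivAt_iff_isLittleO_nhds_zero, Asymptotics.isLittleO_iff]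
  intro c hc
  have hlim : Filter.Tendsto (fun h : EE N => C * B * √‖h‖) (nhds 0) (nhds 0) := by
    have : Continuous fun h : EE N => C * B * √‖h‖ := by fun_prop
    simpa using this.tendsto 0
  filter_upwards [Metric.ball_mem_nhds (0 : EE N) (half_pos hx0), hlim.eventually_lt_const hc] with h h1 h2
  rw [mem_ball_zero_iff] at h1
  have hsh : ∀ t ∈ Icc (0:ℝ) 1, ‖x‖ / 2 ≤ ‖x + t • h‖ ∧ ‖x + t • h‖ ≤ 2 * ‖x‖ := by
    intro t ht
    have e : ‖t • h‖ ≤ ‖h‖ := by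
      rw [norm_smul, Real.norm_of_nonneg ht.1]
      exact mul_le_of_le_one_left (norm_nonneg _) ht.2
    have := norm_add_le x (t • h)
    have h3 := norm_sub_le (x + t • h) (t • h)
    rw [add_sub_cancel_right] at h3
    constructor <;> linarith
  rw [pot_ftc hN hB0 hF hB (by positivity) hsh]
  have e1 : innerSL ℝ (VV N F x) h = ∫ t in (0:ℝ)..1, inner ℝ (VV N F x) h := by simp
  have hxs := hsh 0 (by simp)
  simp only [zero_smul, add_zero] at hxs
  have hcont : ContinuousOn (VV N F) {z | ‖x‖ / 2 ≤ ‖z‖ ∧ ‖z‖ ≤ 2 * ‖x‖} := by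
    intro z hz
    rw [ContinuousWithinAt, tendsto_iff_norm_sub_tendsto_zero]
    refine squeeze_zero' (g := fun y => C * B * √‖y - z‖) (Filter.Eventually.of_forall fun _ => norm_nonneg _) ?_ ?_
    · filter_upwards [self_mem_nhdsWithin] with y hy
      exact (H B F hB0 hF hB y hy.1 hy.2).2.2.2 z hz.1 hz.2
    · have : Continuous fun y : EE N => C * B * √‖y - z‖ := by fun_prop
      have := this.tendsto z
      simp only [sub_self, norm_zero, sqrt_zero, mul_zero] at this
      exact this.mono_left nhdsWithin_le_nhds
  rw [e1, ← intervalIntegral.integral_sub]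
  · calc ‖∫ t in (0:ℝ)..1, (inner ℝ (VV N F (x + t • h)) h - inner ℝ (VV N F x) h)‖
        ≤ (C * B * √‖h‖ * ‖h‖) * |1 - 0| := by
          apply intervalIntegral.norm_integral_le_of_norm_le_const
          intro t ht
          rw [uIoc_of_le zero_le_one] at ht
          have ht' := Ioc_subset_Icc_self ht
          rw [← inner_sub_left]
          refine (norm_inner_le_norm _ _).trans ?_
          gcongr
          refine ((H B F hB0 hF hB _ (hsh t ht').1 (hsh t ht').2).2.2.2 x hxs.1 hxs.2).trans ?_
          gcongr
          rw [add_sub_cancel_left, norm_smul, Real.norm_of_nonneg ht'.1]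
          exact mul_le_of_le_one_left (norm_nonneg _) ht'.2
      _ = (C * B * √‖h‖) * ‖h‖ := by simp
      _ ≤ c * ‖h‖ := by gcongr
  · apply ContinuousOn.intervalIntegrable
    rw [uIcc_of_le zero_le_one]
    apply ContinuousOn.inner _ continuousOn_const
    exact hcont.comp (by fun_prop) fun t ht => hsh t ht
  · simp

lemma VV_continuousOn (hN : 3 ≤ N) {F : EE N → ℝ} {B : ℝ} (hB0 : 0 ≤ B) (hF : Measurable F)
    (hB : ∀ y, |F y| ≤ B * WW N y) : ContinuousOn (VV N F) {x | x ≠ 0} := by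
  intro x hx
  have hx0 : 0 < ‖x‖ := norm_pos_iff.2 hx
  obtain ⟨C, hC, H⟩ := pot_bounds hN (ρ0 := ‖x‖ / 2) (ρ1 := 2 * ‖x‖) (by positivity)
  apply ContinuousAt.continuousWithinAt
  rw [ContinuousAt, tendsto_iff_norm_sub_tendsto_zero]
  refine squeeze_zero' (g := fun y => C * B * √‖y - x‖) (Filter.Eventually.of_forall fun _ => norm_nonneg _) ?_ ?_
  · filter_upwards [Metric.ball_mem_nhds x (half_pos hx0)] with y hy
    rw [mem_ball_iff_norm] at hy
    have a1 := norm_sub_norm_le y x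
    have a2 := norm_sub_norm_le x y
    rw [norm_sub_rev] at a2
    exact (H B F hB0 hF hB y (by linarith) (by linarith)).2.2.2 x (by linarith) (by linarith)
  · have : Continuous fun y : EE N => C * B * √‖y - x‖ := by fun_prop
    have := this.tendsto x
    simpa only [sub_self, norm_zero, sqrt_zero, mul_zero] using this

lemma pot_contDiffOn (hN : 3 ≤ N) {F : EE N → ℝ} {B : ℝ} (hB0 : 0 ≤ B) (hF : Measurable F)
    (hB : ∀ y, |F y| ≤ B * WW N y) : ContDiffOn ℝ 1 (Pot N F) {x | x ≠ 0} := by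
  have ho : IsOpen {x : EE N | x ≠ 0} := isOpen_ne
  rw [show (1 : WithTop ℕ∞) = 0 + 1 by simp, contDiffOn_succ_iff_fderiv_of_isOpen ho]
  refine ⟨?_, by simp, ?_⟩
  · intro x hx
    exact (pot_hasFDerivAt hN hB0 hF hB hx).differentiableAt.differentiableWithinAt
  · have : ContinuousOn (fun x => innerSL ℝ (VV N F x)) {x | x ≠ 0} :=
      (innerSL ℝ).continuous.comp_continuousOn (VV_continuousOn hN hB0 hF hB)
    rw [contDiffOn_zero]
    refine this.congr fun x hx => ?_
    exact (pot_hasFDerivAt hN hB0 hF hB hx).fderiv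

end Pot


section FS
variable {N : ℕ}

lemma inner_grad (u : EE N → ℝ) (x h : EE N) : inner ℝ (gradient u x) h = fderiv ℝ u x h := by
  simp [gradient]

lemma norm_grad (u : EE N → ℝ) (x : EE N) : ‖gradient u x‖ = ‖fderiv ℝ u x‖ := by
  simp [gradient]

lemma grad_continuous {φ : EE N → ℝ} (h : ContDiff ℝ 1 φ) : Continuous (gradient φ) := by
  unfold gradient
  exact (LinearIsometryEquiv.continuous _).comp (h.continuous_fderiv (by simp))

lemma grad_zero_of_notMem {φ : EE N → ℝ} {x : EE N} (h : x ∉ tsupport φ) : gradient φ x = 0 := by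
  have : fderiv ℝ φ x = 0 := by
    by_contra hc
    exact h (support_fderiv_subset ℝ (f := φ) hc)
  simp [gradient, this]

lemma grad_hasCompactSupport {φ : EE N → ℝ} (h : HasCompactSupport φ) :
    HasCompactSupport (gradient φ) :=
  h.of_isClosed_subset (isClosed_tsupport _)
    (closure_minimal (fun x hx => by
      by_contra hc; exact hx (grad_zero_of_notMem hc)) (isClosed_tsupport _))

lemma grad_bdd {φ : EE N → ℝ} (h : ContDiff ℝ 1 φ) (hc : HasCompactSupport φ) :
    ∃ C, 0 ≤ C ∧ ∀ x, ‖gradient φ x‖ ≤ C := by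
  obtain ⟨C, hC⟩ := (grad_hasCompactSupport hc).exists_bound_of_continuous (grad_continuous h)
  exact ⟨C, (norm_nonneg _).trans (hC 0), hC⟩

lemma fs_integrable (hN : 3 ≤ N) {φ : EE N → ℝ} (h : ContDiff ℝ 1 φ) (hc : HasCompactSupport φ)
    (y : EE N) : Integrable (fun x => inner ℝ (gk N (x - y)) (gradient φ x)) := by
  obtain ⟨C, hC0, hC⟩ := grad_bdd h hc
  obtain ⟨R, hR⟩ := hc.isCompact.isBounded.subset_ball y
  have hk := ((kt_integrable hN R ((N:ℝ) - 1) (by linarith)).comp_sub_right y).const_mul C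
  refine hk.mono' ?_ (Filter.Eventually.of_forall fun x => ?_)
  · exact (Measurable.inner (gk_measurable.comp (by fun_prop)) (grad_continuous h).measurable).aestronglyMeasurable
  · by_cases hx : x ∈ tsupport φ
    · have hx' := hR hx
      have : kt N R ((N:ℝ) - 1) (x - y) = ‖x - y‖ ^ (-((N:ℝ) - 1)) := by
        unfold kt
        rw [indicator_of_mem (by simpa [dist_eq_norm] using hx')]
      rw [this, mul_comm]
      refine (norm_inner_le_norm _ _).trans ?_
      exact mul_le_mul (gk_norm_le _) (hC x) (norm_nonneg _) (by positivity)
    · rw [grad_zero_of_notMem hx]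
      simp only [inner_zero_right, norm_zero]
      exact mul_nonneg hC0 (kt_nonneg _ _ _)

lemma fs_lemma (hN : 3 ≤ N) {φ : EE N → ℝ} (h : ContDiff ℝ 1 φ) (hc : HasCompactSupport φ)
    (y : EE N) : ∫ x, inner ℝ (gk N (x - y)) (gradient φ x) = - (sig N * φ y) := by
  have h1 : ∫ x, inner ℝ (gk N (x - y)) (gradient φ x)
      = ∫ z, inner ℝ (gk N z) (gradient φ (z + y)) := by
    rw [← integral_add_right_eq_self _ y]
    simp
  have hi : Integrable (fun z => inner ℝ (gk N z) (gradient φ (z + y))) := by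
    have := (fs_integrable hN h hc y).comp_add_right y
    simpa using this
  rw [h1, polar_integral (by omega) _ hi]
  have h2 : ∀ ω : Metric.sphere (0 : EE N) 1,
      ∫ r in Ioi (0:ℝ), r ^ (N - 1) * inner ℝ (gk N (r • (ω : EE N))) (gradient φ (r • (ω : EE N) + y))
        = - φ y := by
    intro ω
    have hω : ‖(ω : EE N)‖ = 1 := by simp
    have hω0 : (ω : EE N) ≠ 0 := by
      intro h; rw [h] at hω; simp at hω
    have e1 : ∀ r ∈ Ioi (0:ℝ), r ^ (N - 1) * inner ℝ (gk N (r • (ω : EE N))) (gradient φ (r • (ω : EE N) + y))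
        = fderiv ℝ φ (r • (ω : EE N) + y) ω := by
      intro r hr
      have hr : 0 < r := hr
      rw [real_inner_comm, inner_grad]
      simp only [gk, norm_smul, hω, mul_one, Real.norm_of_nonneg hr.le, map_smul, smul_eq_mul]
      rw [rpow_neg hr.le, rpow_natCast]
      obtain ⟨m, rfl⟩ : ∃ m, N = m + 1 := ⟨N - 1, by omega⟩
      simp only [Nat.add_sub_cancel]
      field_simp
      ring
    rw [setIntegral_congr_fun measurableSet_Ioi e1]
    have hd : ∀ r : ℝ, HasDerivAt (fun r : ℝ => φ (r • (ω : EE N) + y)) (fderiv ℝ φ (r • (ω : EE N) + y) ω) r := by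
      intro r
      have a1 : HasDerivAt (fun r : ℝ => r • (ω : EE N) + y) (ω : EE N) r := by
        simpa using ((hasDerivAt_id r).smul_const (ω : EE N)).add_const y
      exact ((h.differentiable (by simp)) _).hasFDerivAt.comp_hasDerivAt r a1
    have hcl : Topology.IsClosedEmbedding (fun r : ℝ => r • (ω : EE N) + y) := by
      have b1 : Topology.IsClosedEmbedding (fun r : ℝ => r • (ω : EE N)) :=
        isClosedEmbedding_smul_left hω0
      exact (Homeomorph.addRight y).isClosedEmbedding.comp b1
    have hcs : HasCompactSupport (fun r : ℝ => φ (r • (ω : EE N) + y)) := hc.comp_isClosedEmbedding hcl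
    have hcs' : HasCompactSupport (fun r : ℝ => fderiv ℝ φ (r • (ω : EE N) + y) ω) :=
      ((hc.fderiv_apply ℝ (ω : EE N))).comp_isClosedEmbedding hcl
    have hcont : Continuous (fun r : ℝ => fderiv ℝ φ (r • (ω : EE N) + y) ω) := by
      have := h.continuous_fderiv (by simp)
      exact (this.comp (by fun_prop)).clm_apply continuous_const
    rw [integral_Ioi_of_hasDerivAt_of_tendsto (m := 0) (f := fun r : ℝ => φ (r • (ω : EE N) + y))]
    · simp
    · exact (hd 0).continuousAt.continuousWithinAt
    · intro x _; exact hd x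
    · exact (hcont.integrable_of_hasCompactSupport hcs').integrableOn
    · have := hcs.is_zero_at_infty
      exact this.mono_left atTop_le_cocompact
  simp_rw [h2]
  simp [sig]

/-- weak equation for the potential -/
lemma pot_weak (hN : 3 ≤ N) {F : EE N → ℝ} {B : ℝ} (hB0 : 0 ≤ B) (hF : Measurable F)
    (hB : ∀ y, |F y| ≤ B * WW N y) {φ : EE N → ℝ} (h : ContDiff ℝ 1 φ) (hc : HasCompactSupport φ)
    (h0 : (0 : EE N) ∉ tsupport φ) :
    ∫ x, inner ℝ (VV N F x) (gradient φ x) = ∫ x, F x * φ x := by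
  have hN' : (3:ℝ) ≤ N := by exact_mod_cast hN
  have hσ := sig_pos hN
  obtain ⟨Cg, hCg0, hCg⟩ := grad_bdd h hc
  obtain ⟨ρ1, hρ1⟩ := hc.isCompact.isBounded.subset_closedBall 0
  obtain ⟨ρ0, hρ0, hρ0'⟩ : ∃ ρ0 > 0, ∀ x ∈ tsupport φ, ρ0 ≤ ‖x‖ := by
    have : (tsupport φ)ᶜ ∈ nhds (0 : EE N) := (isClosed_tsupport φ).isOpen_compl.mem_nhds h0
    obtain ⟨r, hr, hr'⟩ := Metric.mem_nhds_iff.1 this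
    refine ⟨r, hr, fun x hx => ?_⟩
    by_contra hlt
    exact hr' (by simpa using hlt) hx
  have hρ1' : ∀ x ∈ tsupport φ, ‖x‖ ≤ ρ1 := fun x hx => by simpa using hρ1 hx
  obtain ⟨C, hC, H⟩ := pot_bounds hN (ρ1 := ρ1) hρ0
  have ne : ∀ x ∈ tsupport φ, x ≠ 0 := fun z hz => norm_pos_iff.1 (hρ0.trans_le (hρ0' z hz))
  have hm : Measurable (fun q : EE N × EE N => F q.2 * inner ℝ (gk N (q.1 - q.2)) (gradient φ q.1)) := by
    apply (hF.comp measurable_snd).mul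
    apply Measurable.inner _ ((grad_continuous h).measurable.comp measurable_fst)
    exact gk_measurable.comp (by fun_prop)
  have hI : ∀ x, Integrable (fun y : EE N => F y * inner ℝ (gk N (x - y)) (gradient φ x)) := by
    intro x
    by_cases hx : x ∈ tsupport φ
    · have := (gker_integrable hN hF hB (ne x hx)).inner_const (𝕜 := ℝ) (gradient φ x)
      refine this.congr (Filter.Eventually.of_forall fun y => ?_)
      simp
    · simp [grad_zero_of_notMem hx]
  have hint : Integrable (fun q : EE N × EE N => F q.2 * inner ℝ (gk N (q.1 - q.2)) (gradient φ q.1))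
      (volume.prod volume) := by
    rw [integrable_prod_iff hm.aestronglyMeasurable]
    refine ⟨Filter.Eventually.of_forall hI, ?_⟩
    have hgi : Integrable fun x => C * B * ‖gradient φ x‖ :=
      ((grad_continuous h).integrable_of_hasCompactSupport (grad_hasCompactSupport hc)).norm.const_mul _
    refine hgi.mono' ?_ (Filter.Eventually.of_forall fun x => ?_)
    · exact (hm.norm.aestronglyMeasurable).integral_prod_right'
    · by_cases hx : x ∈ tsupport φ
      · have hb := (H B F hB0 hF hB _ (hρ0' x hx) (hρ1' x hx)).2.2.1
        have hi := (ker_integrable hN hF hB (ne x hx) (β := (N:ℝ) - 1) (by linarith) (by linarith)).1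
        have hi' : Integrable fun y => ‖x - y‖ ^ (-((N:ℝ) - 1)) * |F y| := by
          refine hi.norm.congr (Filter.Eventually.of_forall fun y => ?_)
          simp only [norm_mul]
          rw [Real.norm_of_nonneg (by positivity), Real.norm_eq_abs]
        rw [Real.norm_of_nonneg (integral_nonneg fun _ => norm_nonneg _)]
        calc _ ≤ ∫ y, ‖x - y‖ ^ (-((N:ℝ) - 1)) * |F y| * ‖gradient φ x‖ := by
              refine integral_mono (hI x).norm (hi'.mul_const _) fun y => ?_
              simp only [norm_mul, Real.norm_eq_abs (F y)]
              calc _ ≤ |F y| * (‖gk N (x - y)‖ * ‖gradient φ x‖) := by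
                    gcongr; exact norm_inner_le_norm _ _
                _ ≤ |F y| * (‖x - y‖ ^ (-((N:ℝ) - 1)) * ‖gradient φ x‖) := by
                    gcongr; exact gk_norm_le _
                _ = _ := by ring
          _ = (∫ y, ‖x - y‖ ^ (-((N:ℝ) - 1)) * |F y|) * ‖gradient φ x‖ := integral_mul_const _ _
          _ ≤ _ := by gcongr
      · simp [grad_zero_of_notMem hx]
  have e1 : ∀ x, inner ℝ (VV N F x) (gradient φ x)
      = -(1 / sig N) * ∫ y, F y * inner ℝ (gk N (x - y)) (gradient φ x) := by
    intro x
    by_cases hx : x ∈ tsupport φ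
    · have hg := gker_integrable hN hF hB (ne x hx)
      unfold VV
      rw [inner_smul_left, real_inner_comm, ← integral_inner hg]
      simp only [inner_smul_right, conj_trivial]
      simp_rw [real_inner_comm (gradient φ x)]
    · simp [grad_zero_of_notMem hx]
  simp_rw [e1]
  rw [integral_const_mul, integral_integral_swap (f := fun (x : EE N) (y : EE N) => F y * inner ℝ (gk N (x - y)) (gradient φ x)) hint]
  simp_rw [integral_const_mul, fs_lemma hN h hc]
  rw [← integral_const_mul]
  congr 1; ext y
  field_simp

end FS


section Weak
variable {N : ℕ}

/-- weak solutions of `-Δv + v = f` in `D` -/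
structure IsWS (D : Set (EE N)) (f v : EE N → ℝ) : Prop where
  cf : ContinuousOn f D
  cv : ContDiffOn ℝ 1 v D
  eq : ∀ φ : EE N → ℝ, ContDiff ℝ 1 φ → HasCompactSupport φ → tsupport φ ⊆ D →
    ∫ x, (inner ℝ (gradient v x) (gradient φ x) + v x * φ x) = ∫ x, f x * φ x

lemma gradCont {D : Set (EE N)} (hD : IsOpen D) {v : EE N → ℝ} (hv : ContDiffOn ℝ 1 v D) :
    ContinuousOn (gradient v) D := by
  unfold gradient
  exact (LinearIsometryEquiv.continuous _).comp_continuousOn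
    (hv.continuousOn_fderiv_of_isOpen hD (by simp))

lemma cont_of_supp {D : Set (EE N)} (hD : IsOpen D) {g φ : EE N → ℝ} (hg : ContinuousOn g D)
    (hφ : tsupport φ ⊆ D) (h : ∀ x, x ∉ tsupport φ → g x = 0) : Continuous g := by
  refine hg.continuous_of_tsupport_subset hD ?_
  refine (closure_minimal ?_ (isClosed_tsupport φ)).trans hφ
  intro x hx
  by_contra hc
  exact hx (h x hc)

lemma compact_of_supp {g φ : EE N → ℝ} (hφ : HasCompactSupport φ)
    (h : ∀ x, x ∉ tsupport φ → g x = 0) : HasCompactSupport g := by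
  refine hφ.isCompact.of_isClosed_subset (isClosed_tsupport _) (closure_minimal ?_ (isClosed_tsupport φ))
  intro x hx
  by_contra hc
  exact hx (h x hc)

section
variable {D : Set (EE N)} {φ : EE N → ℝ}

lemma int_grad (hD : IsOpen D) (h1 : ContDiff ℝ 1 φ) (h2 : HasCompactSupport φ)
    (h3 : tsupport φ ⊆ D) {v : EE N → ℝ} (hv : ContDiffOn ℝ 1 v D) :
    Continuous (fun x => inner ℝ (gradient v x) (gradient φ x)) ∧
    Integrable (fun x => inner ℝ (gradient v x) (gradient φ x)) := by
  have hz : ∀ x, x ∉ tsupport φ → inner ℝ (gradient v x) (gradient φ x) = 0 := by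
    intro x hx; rw [grad_zero_of_notMem hx, inner_zero_right]
  have hc : Continuous (fun x => inner ℝ (gradient v x) (gradient φ x)) :=
    cont_of_supp hD ((gradCont hD hv).inner (grad_continuous h1).continuousOn) h3 hz
  exact ⟨hc, hc.integrable_of_hasCompactSupport (compact_of_supp h2 hz)⟩

lemma int_mul (hD : IsOpen D) (h1 : Continuous φ) (h2 : HasCompactSupport φ)
    (h3 : tsupport φ ⊆ D) {f : EE N → ℝ} (hf : ContinuousOn f D) :
    Continuous (fun x => f x * φ x) ∧ Integrable (fun x => f x * φ x) := by
  have hz : ∀ x, x ∉ tsupport φ → f x * φ x = 0 := by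
    intro x hx; rw [image_eq_zero_of_notMem_tsupport hx, mul_zero]
  have hc : Continuous (fun x => f x * φ x) :=
    cont_of_supp hD (hf.mul h1.continuousOn) h3 hz
  exact ⟨hc, hc.integrable_of_hasCompactSupport (compact_of_supp h2 hz)⟩

end

lemma grad_sub_smul {D : Set (EE N)} (hD : IsOpen D) {u v : EE N → ℝ} (hu : ContDiffOn ℝ 1 u D)
    (hv : ContDiffOn ℝ 1 v D) (c : ℝ) {x : EE N} (hx : x ∈ D) :
    gradient (fun x => u x - c * v x) x = gradient u x - c • gradient v x := by
  have d1 : DifferentiableAt ℝ u x := (hu.contDiffAt (hD.mem_nhds hx)).differentiableAt (by simp)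
  have d2 : DifferentiableAt ℝ v x := (hv.contDiffAt (hD.mem_nhds hx)).differentiableAt (by simp)
  unfold gradient
  rw [fderiv_fun_sub d1 (d2.const_mul c), fderiv_const_mul d2, map_sub, map_smul]

lemma IsWS.sub_mul {D : Set (EE N)} (hD : IsOpen D) {f g u v : EE N → ℝ} (hu : IsWS D f u)
    (hv : IsWS D g v) (c : ℝ) : IsWS D (fun x => f x - c * g x) (fun x => u x - c * v x) := by
  refine ⟨hu.cf.sub (hv.cf.const_mul c), hu.cv.sub (contDiffOn_const.mul hv.cv), ?_⟩
  intro φ h1 h2 h3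
  have a1 := (int_grad hD h1 h2 h3 hu.cv).2
  have a2 := (int_grad hD h1 h2 h3 hv.cv).2
  have b1 := (int_mul hD h1.continuous h2 h3 hu.cv.continuousOn).2
  have b2 := (int_mul hD h1.continuous h2 h3 hv.cv.continuousOn).2
  have c1 := (int_mul hD h1.continuous h2 h3 hu.cf).2
  have c2 := (int_mul hD h1.continuous h2 h3 hv.cf).2
  have e : ∀ x, inner ℝ (gradient (fun x => u x - c * v x) x) (gradient φ x)
      + (u x - c * v x) * φ x = (inner ℝ (gradient u x) (gradient φ x) + u x * φ x)
      - c * (inner ℝ (gradient v x) (gradient φ x) + v x * φ x) := by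
    intro x
    by_cases hx : x ∈ D
    · rw [grad_sub_smul hD hu.cv hv.cv c hx, inner_sub_left, inner_smul_left]
      simp only [conj_trivial]; ring
    · have : x ∉ tsupport φ := fun h => hx (h3 h)
      rw [grad_zero_of_notMem this, image_eq_zero_of_notMem_tsupport this]
      simp
  simp_rw [e]
  have e2 : ∀ x, (f x - c * g x) * φ x = f x * φ x - c * (g x * φ x) := by intro x; ring
  simp_rw [e2]
  have d1 : Integrable (fun x => inner ℝ (gradient u x) (gradient φ x) + u x * φ x) := a1.add b1
  have d2 : Integrable (fun x => inner ℝ (gradient v x) (gradient φ x) + v x * φ x) := a2.add b2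
  rw [integral_sub d1 (d2.const_mul c), integral_sub c1 (c2.const_mul c),
    integral_const_mul, integral_const_mul, hu.eq φ h1 h2 h3, hv.eq φ h1 h2 h3]

lemma IsWS.mono {D D' : Set (EE N)} {f v : EE N → ℝ} (h : IsWS D f v) (hD : D' ⊆ D) : IsWS D' f v :=
  ⟨h.cf.mono hD, h.cv.mono hD, fun φ h1 h2 h3 => h.eq φ h1 h2 (h3.trans hD)⟩

lemma IsWS.congr {D : Set (EE N)} (hD : IsOpen D) {f g u v : EE N → ℝ} (h : IsWS D f u)
    (hf : ∀ x ∈ D, g x = f x) (hv : ∀ x ∈ D, v x = u x) : IsWS D g v := by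
  refine ⟨h.cf.congr hf, h.cv.congr hv, fun φ h1 h2 h3 => ?_⟩
  have := h.eq φ h1 h2 h3
  have e1 : ∀ x, inner ℝ (gradient v x) (gradient φ x) + v x * φ x =
      inner ℝ (gradient u x) (gradient φ x) + u x * φ x := by
    intro x
    by_cases hx : x ∈ D
    · have : gradient v x = gradient u x := by
        unfold gradient
        rw [Filter.EventuallyEq.fderiv_eq]
        filter_upwards [hD.mem_nhds hx] with y hy using hv y hy
      rw [this, hv x hx]
    · have : x ∉ tsupport φ := fun h => hx (h3 h)
      rw [grad_zero_of_notMem this, image_eq_zero_of_notMem_tsupport this]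
      simp
  have e2 : ∀ x, g x * φ x = f x * φ x := by
    intro x
    by_cases hx : x ∈ D
    · rw [hf x hx]
    · have : x ∉ tsupport φ := fun h => hx (h3 h)
      rw [image_eq_zero_of_notMem_tsupport this]
      simp
  simp_rw [e1, e2]
  exact this

lemma grad_comp_isom (σ : EE N ≃ₗᵢ[ℝ] EE N) (v : EE N → ℝ) (x : EE N) :
    gradient (fun x => v (σ x)) x = σ.symm (gradient v (σ x)) := by
  apply ext_inner_right ℝ
  intro h
  rw [inner_grad]
  have : fderiv ℝ (fun x => v (σ x)) x = (fderiv ℝ v (σ x)).comp (σ.toContinuousLinearEquiv : EE N →L[ℝ] EE N) :=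
    ContinuousLinearEquiv.comp_right_fderiv σ.toContinuousLinearEquiv
  rw [this]
  have h2 : inner ℝ (σ.symm (gradient v (σ x))) h = inner ℝ (gradient v (σ x)) (σ h) := by
    rw [← σ.inner_map_map]; simp
  rw [h2, inner_grad]
  rfl

lemma IsWS.comp_isom {D : Set (EE N)} {f v : EE N → ℝ} (h : IsWS D f v) (σ : EE N ≃ₗᵢ[ℝ] EE N) :
    IsWS (σ ⁻¹' D) (fun x => f (σ x)) (fun x => v (σ x)) := by
  refine ⟨h.cf.comp σ.continuous.continuousOn (mapsTo_preimage _ _),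
    h.cv.comp (σ.toContinuousLinearEquiv.contDiff.contDiffOn) (mapsTo_preimage _ _), fun φ h1 h2 h3 => ?_⟩
  have hs : HasCompactSupport (fun x => φ (σ.symm x)) :=
    h2.comp_homeomorph σ.symm.toHomeomorph
  have ht : tsupport (fun x => φ (σ.symm x)) ⊆ D := by
    have : tsupport (fun x => φ (σ.symm x)) = σ.symm.toHomeomorph ⁻¹' tsupport φ :=
      tsupport_comp_eq_preimage φ σ.symm.toHomeomorph
    rw [this]
    intro x hx
    have := h3 hx
    simpa using this
  have := h.eq (fun x => φ (σ.symm x)) (h1.comp σ.symm.toContinuousLinearEquiv.contDiff) hs ht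
  have hmp := σ.measurePreserving
  have hme : MeasurableEmbedding σ := σ.toHomeomorph.measurableEmbedding
  rw [← hmp.integral_comp hme, ← hmp.integral_comp hme (fun x => f x * φ (σ.symm x))] at this
  simp only [LinearIsometryEquiv.symm_apply_apply] at this
  rw [← this]
  congr 1; ext x
  rw [grad_comp_isom]
  have e : gradient (fun x => φ (σ.symm x)) (σ x) = σ (gradient φ x) := by
    have := grad_comp_isom σ.symm φ (σ x)
    simpa using this
  rw [e, ← σ.inner_map_map]
  simp

/-! truncation -/

lemma hasDerivAt_sqmax (s : ℝ) : HasDerivAt (fun s : ℝ => (max s 0) ^ 2) (2 * max s 0) s := by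
  rcases lt_trichotomy s 0 with h | h | h
  · have : (fun s : ℝ => (max s 0) ^ 2) =ᶠ[nhds s] fun _ => 0 := by
      filter_upwards [gt_mem_nhds h] with t ht
      rw [max_eq_right ht.le]; simp
    rw [max_eq_right h.le, mul_zero]
    exact (hasDerivAt_const s (0:ℝ)).congr_of_eventuallyEq this
  · subst h
    rw [hasDerivAt_iff_isLittleO]
    simp only [max_self, mul_zero, smul_zero, sub_zero]
    rw [Asymptotics.isLittleO_iff]
    intro c hc
    filter_upwards [Metric.ball_mem_nhds (0:ℝ) hc] with t ht
    rw [mem_ball_zero_iff, Real.norm_eq_abs] at ht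
    have : max t 0 ≤ |t| := max_le (le_abs_self _) (abs_nonneg _)
    have h0 : 0 ≤ max t 0 := le_max_right _ _
    simp only [Real.norm_eq_abs, ne_eq, OfNat.ofNat_ne_zero, not_false_eq_true, zero_pow, sub_zero]
    rw [abs_of_nonneg (by positivity)]
    nlinarith [abs_nonneg t]
  · have h1 : (fun s : ℝ => (max s 0) ^ 2) =ᶠ[nhds s] fun s => s ^ 2 := by
      filter_upwards [lt_mem_nhds h] with t ht
      rw [max_eq_left ht.le]
    rw [max_eq_left h.le]
    have := (hasDerivAt_pow 2 s)
    simp only [Nat.cast_ofNat, Nat.add_one_sub_one, pow_one] at this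
    exact this.congr_of_eventuallyEq h1

lemma contDiff_sqmax : ContDiff ℝ 1 (fun s : ℝ => (max s 0) ^ 2) := by
  rw [contDiff_one_iff_deriv]
  refine ⟨fun s => (hasDerivAt_sqmax s).differentiableAt, ?_⟩
  have : deriv (fun s : ℝ => (max s 0) ^ 2) = fun s => 2 * max s 0 := by
    ext s; exact (hasDerivAt_sqmax s).deriv
  rw [this]; fun_prop

lemma trunc {D : Set (EE N)} (hD : IsOpen D) (hb : Bornology.IsBounded D) {w : EE N → ℝ}
    (hc : ContinuousOn w (closure D)) (h1 : ContDiffOn ℝ 1 w D) (hf : ∀ x ∈ frontier D, w x ≤ 0)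
    {g : ℝ → ℝ} (hg : ContDiff ℝ 1 g) {ε : ℝ} (hε : 0 < ε) (hg0 : ∀ t ≤ ε, g t = 0) :
    ContDiff ℝ 1 (D.indicator fun x => g (w x)) ∧
    HasCompactSupport (D.indicator fun x => g (w x)) ∧
    tsupport (D.indicator fun x => g (w x)) ⊆ D ∧
    ∀ x ∈ D, gradient (D.indicator fun x => g (w x)) x = deriv g (w x) • gradient w x := by
  set φ := D.indicator fun x => g (w x) with hφ
  set K := closure D ∩ w ⁻¹' Ici ε with hK
  have hKc : IsClosed K := hc.preimage_isClosed_of_isClosed isClosed_closure isClosed_Ici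
  have hKD : K ⊆ D := by
    intro x hx
    by_contra hn
    have : x ∈ frontier D := by rw [hD.frontier_eq]; exact ⟨hx.1, hn⟩
    have h2 := hf x this
    have h3 : ε ≤ w x := hx.2
    linarith
  have hs : Function.support φ ⊆ K := by
    intro x hx
    have hxD : x ∈ D := by
      by_contra hn; exact hx (indicator_of_notMem hn _)
    refine ⟨subset_closure hxD, ?_⟩
    by_contra hn
    simp only [mem_preimage, mem_Ici, not_le] at hn
    apply hx
    rw [hφ, indicator_of_mem hxD]
    exact hg0 _ hn.le
  have ht : tsupport φ ⊆ K := closure_minimal hs hKc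
  have hev : ∀ x ∈ D, φ =ᶠ[nhds x] fun x => g (w x) := by
    intro x hx
    filter_upwards [hD.mem_nhds hx] with y hy
    rw [hφ, indicator_of_mem hy]
  have hcomp : IsCompact K :=
    Metric.isCompact_of_isClosed_isBounded hKc (hb.subset hKD)
  refine ⟨?_, hcomp.of_isClosed_subset (isClosed_tsupport _) ht, ht.trans hKD, ?_⟩
  · rw [contDiff_iff_contDiffAt]
    intro x
    by_cases hx : x ∈ D
    · have : ContDiffAt ℝ 1 (fun x => g (w x)) x :=
        hg.contDiffAt.comp x (h1.contDiffAt (hD.mem_nhds hx))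
      exact this.congr_of_eventuallyEq (hev x hx)
    · have hx' : x ∉ tsupport φ := fun h => hx (hKD (ht h))
      have : φ =ᶠ[nhds x] fun _ => 0 := notMem_tsupport_iff_eventuallyEq.1 hx'
      exact contDiffAt_const.congr_of_eventuallyEq this
  · intro x hx
    unfold gradient
    rw [(hev x hx).fderiv_eq]
    have d1 : DifferentiableAt ℝ w x := (h1.contDiffAt (hD.mem_nhds hx)).differentiableAt (by simp)
    have d2 : HasDerivAt g (deriv g (w x)) (w x) := (hg.differentiable (by simp) _).hasDerivAt
    have := (d2.comp_hasFDerivAt x d1.hasFDerivAt).fderiv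
    simp only [Function.comp_def] at this
    rw [this, map_smul]

/-- weak maximum principle -/
lemma max_principle {D : Set (EE N)} (hD : IsOpen D) (hb : Bornology.IsBounded D) {w f : EE N → ℝ}
    (hc : ContinuousOn w (closure D)) (hw : IsWS D f w) (hf : ∀ x ∈ D, 0 ≤ f x)
    (hfr : ∀ x ∈ frontier D, 0 ≤ w x) : ∀ x ∈ D, 0 ≤ w x := by
  intro x0 hx0
  by_contra hneg
  push Not at hneg
  set ε := - w x0 / 2 with hε
  have hε0 : 0 < ε := by rw [hε]; linarith
  obtain ⟨p1, p2, p3, p4⟩ := trunc hD hb (w := fun x => - w x) hc.neg hw.cv.neg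
    (fun x hx => by linarith [hfr x hx]) (g := fun t => (max (t - ε) 0) ^ 2)
    (contDiff_sqmax.comp (contDiff_id.sub contDiff_const)) hε0
    (fun t ht => by rw [max_eq_right (by linarith)]; simp)
  set φ := D.indicator fun x => (max (- w x - ε) 0) ^ 2 with hφ
  have hder : ∀ t, deriv (fun t => (max (t - ε) 0) ^ 2) t = 2 * max (t - ε) 0 := by
    intro t
    have := (hasDerivAt_sqmax (t - ε)).comp t ((hasDerivAt_id t).sub_const ε)
    simpa [Function.comp_def] using this.deriv
  have hgn : ∀ x, gradient (fun x => - w x) x = - gradient w x := by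
    intro x; unfold gradient; rw [fderiv_fun_neg, map_neg]
  have hφ0 : ∀ x, 0 ≤ φ x := fun x => indicator_nonneg (fun _ _ => by positivity) _
  have key := hw.eq φ p1 p2 p3
  have hr : 0 ≤ ∫ x, f x * φ x := by
    apply integral_nonneg
    intro x
    by_cases hx : x ∈ D
    · exact mul_nonneg (hf x hx) (hφ0 x)
    · simp [hφ, hx]
  obtain ⟨c1, i1⟩ := int_grad hD p1 p2 p3 hw.cv
  obtain ⟨c2, i2⟩ := int_mul hD p1.continuous p2 p3 hw.cv.continuousOn
  have hle1 : ∀ x, inner ℝ (gradient w x) (gradient φ x) ≤ 0 := by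
    intro x
    by_cases hx : x ∈ D
    · rw [p4 x hx, hder, hgn, inner_smul_right, inner_neg_right, real_inner_self_eq_norm_sq]
      have : 0 ≤ max (- w x - ε) 0 := le_max_right _ _
      nlinarith [sq_nonneg ‖gradient w x‖, mul_nonneg this (sq_nonneg ‖gradient w x‖)]
    · rw [grad_zero_of_notMem fun h => hx (p3 h), inner_zero_right]
  have hle2 : ∀ x, w x * φ x ≤ 0 := by
    intro x
    by_cases hx : x ∈ D
    · by_cases hwx : w x ≤ 0
      · exact mul_nonpos_of_nonpos_of_nonneg hwx (hφ0 x)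
      · rw [hφ, indicator_of_mem hx, max_eq_right (by linarith)]; simp
    · simp [hφ, hx]
  rw [integral_add i1 i2] at key
  have h1 : ∫ x, inner ℝ (gradient w x) (gradient φ x) ≤ 0 := integral_nonpos hle1
  have h3 : 0 ≤ ∫ x, - (w x * φ x) := integral_nonneg fun x => by
    simp only [Pi.zero_apply]; linarith [hle2 x]
  have h4 : ∫ x, - (w x * φ x) = 0 := by
    rw [integral_neg] at h3 ⊢; linarith
  have h5 := (integral_eq_zero_iff_of_nonneg (fun x => by
    simp only [Pi.zero_apply, Pi.neg_apply]; linarith [hle2 x]) i2.neg).1 h4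
  have h6 : (fun x => - (w x * φ x)) = 0 := by
    exact Continuous.ae_eq_iff_eq volume c2.neg continuous_zero |>.1 h5
  have h7 := congrFun h6 x0
  simp only [Pi.zero_apply, neg_eq_zero] at h7
  rw [hφ, indicator_of_mem hx0, max_eq_left (by linarith)] at h7
  have : - w x0 - ε > 0 := by linarith
  have h8 : w x0 * (- w x0 - ε) ^ 2 < 0 := mul_neg_of_neg_of_pos hneg (by positivity)
  linarith

/-- truncation function -/
noncomputable def gtr (ε t : ℝ) : ℝ := (max (t - ε) 0) ^ 2 * (t / (t ^ 2 + ε ^ 2))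

lemma gtr_hasDerivAt {ε : ℝ} (hε : 0 < ε) (t : ℝ) : HasDerivAt (gtr ε)
    (2 * max (t - ε) 0 * (t / (t ^ 2 + ε ^ 2))
      + (max (t - ε) 0) ^ 2 * ((ε ^ 2 - t ^ 2) / (t ^ 2 + ε ^ 2) ^ 2)) t := by
  have h1 : HasDerivAt (fun t => (max (t - ε) 0) ^ 2) (2 * max (t - ε) 0) t := by
    have := (hasDerivAt_sqmax (t - ε)).comp t ((hasDerivAt_id t).sub_const ε)
    simpa [Function.comp_def] using this
  have h2 : HasDerivAt (fun t : ℝ => t ^ 2 + ε ^ 2) (2 * t) t := by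
    simpa using (hasDerivAt_pow 2 t).add_const (ε ^ 2)
  have h3 := (hasDerivAt_id t).div h2 (by positivity)
  have h4 := h1.mul h3
  refine (h4.congr_deriv ?_)
  simp only [id, Pi.div_apply]
  congr 2
  ring

lemma gtr_deriv_bound {ε : ℝ} (hε : 0 < ε) (t : ℝ) : |deriv (gtr ε) t| ≤ 3 := by
  rw [(gtr_hasDerivAt hε t).deriv]
  by_cases ht : t ≤ ε
  · rw [max_eq_right (by linarith)]; norm_num
  · push Not at ht
    rw [max_eq_left (by linarith)]
    have hp : 0 < t ^ 2 + ε ^ 2 := by positivity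
    have e1 : 2 * (t - ε) * (t / (t ^ 2 + ε ^ 2)) ≤ 2 := by
      rw [← mul_div_assoc, div_le_iff₀ hp]; nlinarith
    have e1' : 0 ≤ 2 * (t - ε) * (t / (t ^ 2 + ε ^ 2)) := by
      have : 0 ≤ t - ε := by linarith
      have : 0 ≤ t := by linarith
      positivity
    have e2 : |(t - ε) ^ 2 * ((ε ^ 2 - t ^ 2) / (t ^ 2 + ε ^ 2) ^ 2)| ≤ 1 := by
      rw [← mul_div_assoc, abs_div, abs_of_pos (a := (t ^ 2 + ε ^ 2) ^ 2) (by positivity),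
        div_le_one (by positivity), abs_mul, sq (t ^ 2 + ε ^ 2)]
      apply mul_le_mul _ _ (abs_nonneg _) hp.le
      · rw [abs_of_nonneg (by positivity)]; nlinarith
      · rw [abs_le]; constructor <;> nlinarith
    refine (abs_add_le _ _).trans ?_
    rw [abs_of_nonneg e1']
    linarith

lemma gtr_bound {ε : ℝ} (hε : 0 < ε) {t : ℝ} (ht0 : 0 ≤ t) : |gtr ε t| ≤ t := by
  unfold gtr
  by_cases ht : t ≤ ε
  · rw [max_eq_right (by linarith)]; simpa using ht0
  · push Not at ht
    rw [max_eq_left (by linarith)]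
    have hp : 0 < t ^ 2 + ε ^ 2 := by positivity
    rw [abs_of_nonneg (by positivity), ← mul_div_assoc, div_le_iff₀ hp]
    nlinarith

lemma gtr_contDiff {ε : ℝ} (hε : 0 < ε) : ContDiff ℝ 1 (gtr ε) := by
  unfold gtr
  refine ContDiff.mul (contDiff_sqmax.comp (contDiff_id.sub contDiff_const)) ?_
  exact contDiff_id.div ((contDiff_id.pow 2).add contDiff_const) fun t => by
    positivity

lemma gtr_tendsto {t : ℝ} (ht : 0 < t) :
    Filter.Tendsto (fun n : ℕ => gtr (1 / ((n:ℝ) + 1)) t) Filter.atTop (nhds t) ∧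
    Filter.Tendsto (fun n : ℕ => deriv (gtr (1 / ((n:ℝ) + 1))) t) Filter.atTop (nhds 1) := by
  have h0 := tendsto_one_div_add_atTop_nhds_zero_nat (𝕜 := ℝ)
  have hne : ∀ ε : ℝ, t ^ 2 + ε ^ 2 ≠ 0 := fun ε => by positivity
  constructor
  · have hc : Continuous fun ε => gtr ε t := by
      unfold gtr
      refine Continuous.mul (by fun_prop) (Continuous.div (by fun_prop) (by fun_prop) hne)
    have h := (hc.tendsto 0).comp h0
    have e : gtr 0 t = t := by
      unfold gtr; rw [sub_zero, max_eq_left ht.le]; field_simp; simp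
    rw [e] at h
    exact h
  · have e : ∀ n : ℕ, deriv (gtr (1 / ((n:ℝ) + 1))) t =
        (fun ε : ℝ => 2 * max (t - ε) 0 * (t / (t ^ 2 + ε ^ 2))
      + (max (t - ε) 0) ^ 2 * ((ε ^ 2 - t ^ 2) / (t ^ 2 + ε ^ 2) ^ 2)) (1 / ((n:ℝ) + 1)) := by
      intro n
      exact (gtr_hasDerivAt (by positivity) t).deriv
    simp_rw [e]
    have hc : Continuous (fun ε : ℝ => 2 * max (t - ε) 0 * (t / (t ^ 2 + ε ^ 2))
      + (max (t - ε) 0) ^ 2 * ((ε ^ 2 - t ^ 2) / (t ^ 2 + ε ^ 2) ^ 2)) := by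
      refine Continuous.add (Continuous.mul (by fun_prop) (Continuous.div (by fun_prop) (by fun_prop) hne))
        (Continuous.mul (by fun_prop) (Continuous.div (by fun_prop) (by fun_prop) fun ε => pow_ne_zero 2 (hne ε)))
    have h := (hc.tendsto 0).comp h0
    have e : (2 * max (t - 0) 0 * (t / (t ^ 2 + 0 ^ 2))
      + (max (t - 0) 0) ^ 2 * (((0:ℝ) ^ 2 - t ^ 2) / (t ^ 2 + 0 ^ 2) ^ 2)) = 1 := by
      rw [sub_zero, max_eq_left ht.le]; field_simp; ring
    rw [e] at h
    exact h

/-- testing with nonnegative functions vanishing on the boundary -/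
lemma IsWS.test {D : Set (EE N)} (hD : IsOpen D) (hb : Bornology.IsBounded D) {f v φ : EE N → ℝ}
    (hv : IsWS D f v) (hc : ContinuousOn φ (closure D)) (h1 : ContDiffOn ℝ 1 φ D)
    (hpos : ∀ x ∈ D, 0 ≤ φ x) (hfr : ∀ x ∈ frontier D, φ x = 0) {C : ℝ}
    (b1 : ∀ x ∈ D, ‖gradient φ x‖ ≤ C) (b2 : ∀ x ∈ D, ‖gradient v x‖ ≤ C)
    (b3 : ∀ x ∈ D, |v x| ≤ C) (b4 : ∀ x ∈ D, |f x| ≤ C) (b5 : ∀ x ∈ D, |φ x| ≤ C) :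
    ∫ x in D, (inner ℝ (gradient v x) (gradient φ x) + v x * φ x) = ∫ x in D, f x * φ x := by
  rcases D.eq_empty_or_nonempty with h | ⟨xx, hxx⟩
  · subst h; simp
  have hC : 0 ≤ C := (norm_nonneg _).trans (b1 xx hxx)
  have hDm : MeasurableSet D := hD.measurableSet
  have hfin : volume D < ⊤ := hb.measure_lt_top
  have hint : ∀ c : ℝ, IntegrableOn (fun _ : EE N => c) D := fun c => integrableOn_const hfin.ne
  set ε : ℕ → ℝ := fun n => 1 / ((n:ℝ) + 1) with hε
  have hεp : ∀ n, 0 < ε n := fun n => by simp only [hε]; positivity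
  set ψ : ℕ → EE N → ℝ := fun n => D.indicator fun x => gtr (ε n) (φ x) with hψ
  have hT := fun n => trunc hD hb (w := φ) hc h1 (fun x hx => (hfr x hx).le) (gtr_contDiff (hεp n)) (hεp n)
    (fun t ht => by unfold gtr; rw [max_eq_right (by linarith)]; simp)
  have heq : ∀ n, ∫ x in D, (inner ℝ (gradient v x) (deriv (gtr (ε n)) (φ x) • gradient φ x)
      + v x * gtr (ε n) (φ x)) = ∫ x in D, f x * gtr (ε n) (φ x) := by
    intro n
    obtain ⟨p1, p2, p3, p4⟩ := hT n
    have := hv.eq (ψ n) p1 p2 p3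
    have z : ∀ x, x ∉ D → x ∉ tsupport (ψ n) := fun x hx h => hx (p3 h)
    rw [← setIntegral_eq_integral_of_forall_compl_eq_zero (s := D),
      ← setIntegral_eq_integral_of_forall_compl_eq_zero (s := D) (f := fun x => f x * ψ n x)] at this
    · have e1 : ∫ x in D, (inner ℝ (gradient v x) (deriv (gtr (ε n)) (φ x) • gradient φ x)
          + v x * gtr (ε n) (φ x)) = ∫ x in D, (inner ℝ (gradient v x) (gradient (ψ n) x) + v x * ψ n x) := by
        refine setIntegral_congr_fun hDm fun x hx => ?_
        simp only [hψ]
        rw [p4 x hx, indicator_of_mem hx]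
      have e2 : ∫ x in D, f x * gtr (ε n) (φ x) = ∫ x in D, f x * ψ n x := by
        refine setIntegral_congr_fun hDm fun x hx => ?_
        simp only [hψ]
        rw [indicator_of_mem hx]
      rw [e1, e2, this]
    · intro x hx
      rw [image_eq_zero_of_notMem_tsupport (z x hx), mul_zero]
    · intro x hx
      rw [image_eq_zero_of_notMem_tsupport (z x hx), mul_zero, grad_zero_of_notMem (z x hx), inner_zero_right,
        add_zero]
  have hgz : ∀ x ∈ D, φ x = 0 → gradient φ x = 0 := by
    intro x hx h0
    have : IsLocalMin φ x := by
      filter_upwards [hD.mem_nhds hx] with y hy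
      rw [h0]; exact hpos y hy
    unfold gradient
    rw [this.fderiv_eq_zero, map_zero]
  have g0 : ∀ n, gtr (ε n) 0 = 0 := by intro n; simp [gtr]
  have cg := gradCont hD hv.cv
  have cφ := gradCont hD h1
  have lim1 : Filter.Tendsto (fun n => ∫ x in D, (inner ℝ (gradient v x) (deriv (gtr (ε n)) (φ x) • gradient φ x)
      + v x * gtr (ε n) (φ x))) Filter.atTop (nhds (∫ x in D, (inner ℝ (gradient v x) (gradient φ x) + v x * φ x))) := by
    refine tendsto_integral_of_dominated_convergence (fun _ => C * (3 * C) + C * C) ?_ (hint _) ?_ ?_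
    · intro n
      refine ContinuousOn.aestronglyMeasurable ?_ hDm
      have d1 : Continuous (deriv (gtr (ε n))) := (gtr_contDiff (hεp n)).continuous_deriv (by simp)
      refine ContinuousOn.add (cg.inner (ContinuousOn.smul (d1.comp_continuousOn h1.continuousOn) cφ)) ?_
      exact hv.cv.continuousOn.mul ((gtr_contDiff (hεp n)).continuous.comp_continuousOn h1.continuousOn)
    · intro n
      refine (ae_restrict_iff' hDm).2 (Filter.Eventually.of_forall fun x hx => ?_)
      refine (norm_add_le _ _).trans (add_le_add ?_ ?_)
      · refine (norm_inner_le_norm _ _).trans ?_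
        rw [norm_smul]
        have := gtr_deriv_bound (hεp n) (φ x)
        gcongr
        · exact b2 x hx
        · exact this
        · exact b1 x hx
      · rw [norm_mul]
        have := gtr_bound (hεp n) (hpos x hx)
        have h5 := le_abs_self (φ x)
        gcongr
        · exact b3 x hx
        · exact this.trans (h5.trans (b5 x hx))
    · refine (ae_restrict_iff' hDm).2 (Filter.Eventually.of_forall fun x hx => ?_)
      rcases (hpos x hx).eq_or_lt with h0 | h0
      · rw [hgz x hx h0.symm, ← h0]
        simp [g0]
      · obtain ⟨t1, t2⟩ := gtr_tendsto h0
        have := (t2.mul_const (inner ℝ (gradient v x) (gradient φ x))).add (t1.const_mul (v x))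
        simp only [inner_smul_right]
        rw [one_mul] at this
        exact this
  have lim2 : Filter.Tendsto (fun n => ∫ x in D, f x * gtr (ε n) (φ x)) Filter.atTop
      (nhds (∫ x in D, f x * φ x)) := by
    refine tendsto_integral_of_dominated_convergence (fun _ => C * C) ?_ (hint _) ?_ ?_
    · intro n
      refine ContinuousOn.aestronglyMeasurable ?_ hDm
      exact hv.cf.mul ((gtr_contDiff (hεp n)).continuous.comp_continuousOn h1.continuousOn)
    · intro n
      refine (ae_restrict_iff' hDm).2 (Filter.Eventually.of_forall fun x hx => ?_)
      rw [norm_mul]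
      have := gtr_bound (hεp n) (hpos x hx)
      have h5 := le_abs_self (φ x)
      gcongr
      · exact b4 x hx
      · exact this.trans (h5.trans (b5 x hx))
    · refine (ae_restrict_iff' hDm).2 (Filter.Eventually.of_forall fun x hx => ?_)
      rcases (hpos x hx).eq_or_lt with h0 | h0
      · rw [← h0]
        simp [g0]
      · exact (gtr_tendsto h0).1.const_mul (f x)
  simp_rw [heq] at lim1
  exact tendsto_nhds_unique lim1 lim2

end Weak


section Ann
variable {N : ℕ} {R₀ R₁ : ℝ}

lemma isOpen_annulus : IsOpen (annulus N R₀ R₁) :=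
  (isOpen_lt continuous_const continuous_norm).inter (isOpen_lt continuous_norm continuous_const)

lemma closure_annulus (hR₀ : 0 < R₀) (hR : R₀ < R₁) :
    closure (annulus N R₀ R₁) = {x | R₀ ≤ ‖x‖ ∧ ‖x‖ ≤ R₁} := by
  apply Subset.antisymm
  · apply closure_minimal
    · intro x hx; exact ⟨hx.1.le, hx.2.le⟩
    · exact (isClosed_le continuous_const continuous_norm).inter (isClosed_le continuous_norm continuous_const)
  · intro x hx
    have hx0 : 0 < ‖x‖ := hR₀.trans_le hx.1
    set m := (R₀ + R₁) / 2 with hm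
    set s : ℕ → ℝ := fun n => 1 / ((n:ℝ) + 1) with hs
    have h0 : Filter.Tendsto s Filter.atTop (nhds 0) := tendsto_one_div_add_atTop_nhds_zero_nat
    refine mem_closure_of_tendsto (f := fun n => ((1 - s n) + s n * (m / ‖x‖)) • x) (b := Filter.atTop) ?_ ?_
    · have hc : Continuous fun t : ℝ => ((1 - t) + t * (m / ‖x‖)) • x := by fun_prop
      have := (hc.tendsto 0).comp h0
      simp only [sub_zero, zero_mul, add_zero, one_smul] at this
      exact this
    · refine Filter.Eventually.of_forall fun n => ?_
      have hp : 0 < s n := by simp only [hs]; positivity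
      have hp1 : s n ≤ 1 := by
        simp only [hs]
        rw [div_le_one (by positivity)]
        have : (0:ℝ) ≤ n := by positivity
        linarith
      have hmp : 0 < m := by rw [hm]; linarith
      have e : ‖((1 - s n) + s n * (m / ‖x‖)) • x‖ = (1 - s n) * ‖x‖ + s n * m := by
        rw [norm_smul, Real.norm_of_nonneg (by
          have : 0 ≤ s n * (m / ‖x‖) := by positivity
          linarith)]
        field_simp
      show R₀ < ‖_‖ ∧ ‖_‖ < R₁
      rw [e]
      obtain ⟨h1, h2⟩ := hx
      have h3 : R₀ < m := by rw [hm]; linarith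
      have h4 : m < R₁ := by rw [hm]; linarith
      constructor
      · nlinarith [mul_nonneg (by linarith : 0 ≤ 1 - s n) (by linarith : 0 ≤ ‖x‖ - R₀), mul_pos hp (by linarith : 0 < m - R₀)]
      · nlinarith [mul_nonneg (by linarith : 0 ≤ 1 - s n) (by linarith : 0 ≤ R₁ - ‖x‖), mul_pos hp (by linarith : 0 < R₁ - m)]

lemma bounded_annulus : Bornology.IsBounded (annulus N R₀ R₁) :=
  (Metric.isBounded_ball (x := (0 : EE N)) (r := R₁)).subset fun x hx => by simpa using hx.2

lemma compact_closure_annulus : IsCompact (closure (annulus N R₀ R₁)) :=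
  bounded_annulus.isCompact_closure

lemma frontier_annulus (hR₀ : 0 < R₀) (hR : R₀ < R₁) {x : EE N} (hx : x ∈ frontier (annulus N R₀ R₁)) :
    ‖x‖ = R₀ ∨ ‖x‖ = R₁ := by
  rw [isOpen_annulus.frontier_eq, closure_annulus hR₀ hR] at hx
  obtain ⟨⟨h1, h2⟩, h3⟩ := hx
  by_contra hc
  push Not at hc
  exact h3 ⟨lt_of_le_of_ne h1 (Ne.symm hc.1), lt_of_le_of_ne h2 hc.2⟩

lemma ne_zero_of_closure (hR₀ : 0 < R₀) (hR : R₀ < R₁) {x : EE N} (hx : x ∈ closure (annulus N R₀ R₁)) :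
    x ≠ 0 := by
  rw [closure_annulus hR₀ hR] at hx
  exact norm_pos_iff.1 (hR₀.trans_le hx.1)

lemma uniqueDiff_annulus (hR₀ : 0 < R₀) (hR : R₀ < R₁) :
    UniqueDiffOn ℝ (closure (annulus N R₀ R₁)) := by
  intro x hx
  have hx0 := ne_zero_of_closure hR₀ hR hx
  have hxp : 0 < ‖x‖ := norm_pos_iff.2 hx0
  rw [closure_annulus hR₀ hR] at hx
  obtain ⟨h1, h2⟩ := hx
  rcases h2.eq_or_lt with h3 | h3
  · set S := Metric.ball (0 : EE N) R₁ ∩ Metric.ball x (R₁ - R₀) with hS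
    have hSo : IsOpen S := Metric.isOpen_ball.inter Metric.isOpen_ball
    have hsub : S ⊆ annulus N R₀ R₁ := by
      intro y hy
      have a1 : ‖y‖ < R₁ := by simpa using hy.1
      have a2 : ‖y - x‖ < R₁ - R₀ := by simpa [dist_eq_norm] using hy.2
      have a3 := norm_sub_norm_le x y
      rw [norm_sub_rev] at a3
      exact ⟨by linarith, a1⟩
    have hmem : ∀ t : ℝ, 0 < t → t < min 1 ((R₁ - R₀) / ‖x‖) → (1 - t) • x ∈ S := by
      intro t ht ht'
      have b1 := lt_of_lt_of_le ht' (min_le_left _ _)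
      have b2 := lt_of_lt_of_le ht' (min_le_right _ _)
      rw [lt_div_iff₀ hxp] at b2
      constructor
      · rw [mem_ball_zero_iff, norm_smul, Real.norm_of_nonneg (by linarith)]
        nlinarith
      · rw [mem_ball_iff_norm]
        have : (1 - t) • x - x = (-t) • x := by module
        rw [this, norm_smul, norm_neg, Real.norm_of_nonneg ht.le]; exact b2
    have hpos : 0 < min 1 ((R₁ - R₀) / ‖x‖) := lt_min one_pos (div_pos (by linarith) hxp)
    have hcl : x ∈ closure S := by
      have hc : Filter.Tendsto (fun t : ℝ => (1 - t) • x) (nhdsWithin 0 (Ioi 0)) (nhds x) := by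
        have : Continuous fun t : ℝ => (1 - t) • x := by fun_prop
        have := this.tendsto 0
        simp only [sub_zero, one_smul] at this
        exact this.mono_left nhdsWithin_le_nhds
      refine mem_closure_of_tendsto hc ?_
      filter_upwards [Ioo_mem_nhdsGT hpos] with t ht using hmem t ht.1 ht.2
    have := uniqueDiffWithinAt_convex ((convex_ball _ _).inter (convex_ball _ _))
      (s := S) (by rw [hSo.interior_eq]; exact ⟨_, hmem _ (half_pos hpos) (half_lt_self hpos)⟩) hcl
    exact this.mono (hsub.trans subset_closure)
  · set S := {y : EE N | ‖x‖ ^ 2 < inner ℝ x y} ∩ Metric.ball x (R₁ - ‖x‖) with hS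
    have hSo : IsOpen S := (isOpen_lt continuous_const (by fun_prop)).inter Metric.isOpen_ball
    have hcv : Convex ℝ {y : EE N | ‖x‖ ^ 2 < inner ℝ x y} :=
      convex_halfSpace_gt (f := fun y => inner ℝ x y) (innerSL ℝ x).isLinear _
    have hsub : S ⊆ annulus N R₀ R₁ := by
      intro y hy
      have a1 : ‖x‖ ^ 2 < inner ℝ x y := hy.1
      have a2 : ‖y - x‖ < R₁ - ‖x‖ := by simpa [dist_eq_norm] using hy.2
      have a3 := norm_sub_norm_le y x
      have a4 := real_inner_le_norm x y
      have a5 : ‖x‖ < ‖y‖ := by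
        by_contra hcon
        push Not at hcon
        nlinarith
      exact ⟨by linarith, by linarith⟩
    have hmem : ∀ t : ℝ, 0 < t → t < (R₁ - ‖x‖) / ‖x‖ → (1 + t) • x ∈ S := by
      intro t ht b2
      rw [lt_div_iff₀ hxp] at b2
      constructor
      · show ‖x‖ ^ 2 < inner ℝ x ((1 + t) • x)
        rw [inner_smul_right, real_inner_self_eq_norm_sq]
        nlinarith [mul_pos ht (pow_pos hxp 2)]
      · rw [mem_ball_iff_norm]
        have : (1 + t) • x - x = t • x := by module
        rw [this, norm_smul, Real.norm_of_nonneg ht.le]; exact b2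
    have hpos : 0 < (R₁ - ‖x‖) / ‖x‖ := div_pos (by linarith) hxp
    have hcl : x ∈ closure S := by
      have hc : Filter.Tendsto (fun t : ℝ => (1 + t) • x) (nhdsWithin 0 (Ioi 0)) (nhds x) := by
        have : Continuous fun t : ℝ => (1 + t) • x := by fun_prop
        have := this.tendsto 0
        simp only [add_zero, one_smul] at this
        exact this.mono_left nhdsWithin_le_nhds
      refine mem_closure_of_tendsto hc ?_
      filter_upwards [Ioo_mem_nhdsGT hpos] with t ht using hmem t ht.1 ht.2
    have := uniqueDiffWithinAt_convex (hcv.inter (convex_ball _ _))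
      (s := S) (by rw [hSo.interior_eq]; exact ⟨_, hmem _ (half_pos hpos) (half_lt_self hpos)⟩) hcl
    exact this.mono (hsub.trans subset_closure)

lemma fderivWithin_annulus (u : EE N → ℝ) {x : EE N} (hx : x ∈ annulus N R₀ R₁) :
    fderivWithin ℝ u (closure (annulus N R₀ R₁)) x = fderiv ℝ u x :=
  fderivWithin_of_mem_nhds (Filter.mem_of_superset (isOpen_annulus.mem_nhds hx) subset_closure)

lemma H1sq_eq (u : EE N → ℝ) : H1sq N R₀ R₁ u =
    ∫ x in annulus N R₀ R₁, (‖gradient u x‖ ^ 2 + (u x) ^ 2) := by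
  unfold H1sq
  refine setIntegral_congr_fun isOpen_annulus.measurableSet fun x hx => ?_
  beta_reduce
  rw [fderivWithin_annulus u hx, norm_grad]

lemma c1_bdd (hR₀ : 0 < R₀) (hR : R₀ < R₁) {u : EE N → ℝ}
    (hu : ContDiffOn ℝ 1 u (closure (annulus N R₀ R₁))) :
    ∃ C, 0 ≤ C ∧ (∀ x ∈ closure (annulus N R₀ R₁), |u x| ≤ C) ∧
      ∀ x ∈ annulus N R₀ R₁, ‖gradient u x‖ ≤ C := by
  obtain ⟨C1, h1⟩ := (compact_closure_annulus (N := N) (R₀ := R₀) (R₁ := R₁)).exists_bound_of_continuousOn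
    hu.continuousOn
  obtain ⟨C2, h2⟩ := (compact_closure_annulus (N := N) (R₀ := R₀) (R₁ := R₁)).exists_bound_of_continuousOn
    (hu.continuousOn_fderivWithin (uniqueDiff_annulus hR₀ hR) (by simp))
  refine ⟨max 0 (max C1 C2), le_max_left _ _, fun x hx => ?_, fun x hx => ?_⟩
  · exact (h1 x hx).trans ((le_max_left _ _).trans (le_max_right _ _))
  · have := h2 x (subset_closure hx)
    rw [fderivWithin_annulus u hx] at this
    rw [norm_grad]
    exact this.trans ((le_max_right _ _).trans (le_max_right _ _))

lemma preconn_annulus (hN : 3 ≤ N) (hR₀ : 0 < R₀) : IsPreconnected (annulus N R₀ R₁) := by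
  have h1 : IsPreconnected (Metric.sphere (0 : EE N) 1) := by
    apply isPreconnected_sphere
    rw [← Module.finrank_eq_rank, finrank_euclideanSpace_fin]
    exact_mod_cast (by omega : 1 < N)
  have h2 : IsPreconnected ((Ioo R₀ R₁) ×ˢ (Metric.sphere (0 : EE N) 1)) :=
    isPreconnected_Ioo.prod h1
  have h3 := h2.image (fun z : ℝ × EE N => z.1 • z.2) (by fun_prop)
  convert h3 using 1
  ext x
  constructor
  · intro hx
    have hxp : 0 < ‖x‖ := hR₀.trans hx.1
    refine ⟨(‖x‖, ‖x‖⁻¹ • x), ⟨hx, ?_⟩, ?_⟩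
    · simp [norm_smul, hxp.ne']
    · simp [smul_smul, hxp.ne']
  · rintro ⟨⟨r, ω⟩, ⟨h1, h2⟩, rfl⟩
    have h2 : ‖ω‖ = 1 := by simpa using h2
    have h1 : r ∈ Ioo R₀ R₁ := h1
    have : ‖r • ω‖ = r := by rw [norm_smul, h2, mul_one, Real.norm_of_nonneg (hR₀.trans h1.1).le]
    show R₀ < ‖r • ω‖ ∧ ‖r • ω‖ < R₁
    rw [this]; exact h1

lemma annulus_vol_lt_top : volume (annulus N R₀ R₁) < ⊤ := bounded_annulus.measure_lt_top

/-- bounded continuous functions are integrable on the annulus -/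
lemma intOn_annulus {f : EE N → ℝ} (hf : ContinuousOn f (annulus N R₀ R₁)) {C : ℝ}
    (hC : ∀ x ∈ annulus N R₀ R₁, |f x| ≤ C) : IntegrableOn f (annulus N R₀ R₁) := by
  refine Integrable.mono' (g := fun _ => C) (integrableOn_const annulus_vol_lt_top.ne)
    (hf.aestronglyMeasurable isOpen_annulus.measurableSet) ?_
  exact (ae_restrict_iff' isOpen_annulus.measurableSet).2 (Filter.Eventually.of_forall hC)

lemma intOn_annulus' {f : EE N → ℝ} (hf : ContinuousOn f (closure (annulus N R₀ R₁))) :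
    IntegrableOn f (annulus N R₀ R₁) :=
  (hf.integrableOn_compact compact_closure_annulus).mono_set subset_closure

end Ann


section Fold
variable {N : ℕ} {R₀ R₁ : ℝ}

/-- folding angle -/
noncomputable def tauF (R₀ R₁ t : ℝ) : ℝ := π * Real.log (t / R₀) / Real.log (R₁ / R₀)

/-- folded radius -/
noncomputable def rhoF (R₀ R₁ t : ℝ) : ℝ :=
  R₀ * Real.exp (Real.log (R₁ / R₀) / π * Real.arccos (Real.cos (tauF R₀ R₁ t)))

/-- sign of the folding -/
noncomputable def sgnF (R₀ R₁ t : ℝ) : ℝ :=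
  Real.sin (tauF R₀ R₁ t) / |Real.sin (tauF R₀ R₁ t)|

/-- odd Kelvin extension of a function on the annulus -/
noncomputable def fold (N : ℕ) (R₀ R₁ : ℝ) (f : EE N → ℝ) (y : EE N) : ℝ :=
  sgnF R₀ R₁ ‖y‖ * (rhoF R₀ R₁ ‖y‖ / ‖y‖) ^ (((N:ℝ) + 2) / 2) *
    f ((rhoF R₀ R₁ ‖y‖ / ‖y‖) • y)

lemma logpos (hR₀ : 0 < R₀) (hR : R₀ < R₁) : 0 < Real.log (R₁ / R₀) :=
  Real.log_pos ((one_lt_div hR₀).2 hR)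

lemma rhoF_mem (hR₀ : 0 < R₀) (hR : R₀ < R₁) (t : ℝ) : R₀ ≤ rhoF R₀ R₁ t ∧ rhoF R₀ R₁ t ≤ R₁ := by
  have hL := logpos hR₀ hR
  unfold rhoF
  have h1 := Real.arccos_nonneg (Real.cos (tauF R₀ R₁ t))
  have h2 := Real.arccos_le_pi (Real.cos (tauF R₀ R₁ t))
  set c := Real.arccos (Real.cos (tauF R₀ R₁ t))
  have hp := Real.pi_pos
  constructor
  · have : 1 ≤ Real.exp (Real.log (R₁ / R₀) / π * c) := Real.one_le_exp (by positivity)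
    nlinarith
  · have : Real.exp (Real.log (R₁ / R₀) / π * c) ≤ R₁ / R₀ := by
      rw [← Real.le_log_iff_exp_le (div_pos (hR₀.trans hR) hR₀), div_mul_eq_mul_div, div_le_iff₀ hp]
      exact mul_le_mul_of_nonneg_left h2 hL.le
    rw [le_div_iff₀ hR₀] at this
    linarith

lemma sgnF_abs (t : ℝ) : |sgnF R₀ R₁ t| ≤ 1 := by
  unfold sgnF
  rw [abs_div, abs_abs]
  exact div_self_le_one _

lemma fold_measurable {f : EE N → ℝ} (hf : Measurable f) : Measurable (fold N R₀ R₁ f) := by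
  have h1 : Measurable (tauF R₀ R₁) := by unfold tauF; fun_prop
  have h2 : Measurable (rhoF R₀ R₁) := by
    unfold rhoF
    have := Real.continuous_arccos.measurable
    fun_prop
  have h3 : Measurable (sgnF R₀ R₁) := by unfold sgnF; fun_prop
  unfold fold
  refine Measurable.mul (Measurable.mul (h3.comp measurable_norm) ?_) (hf.comp ?_)
  · exact ((h2.comp measurable_norm).div measurable_norm).pow_const _
  · exact ((h2.comp measurable_norm).div measurable_norm).smul measurable_id

lemma fold_bound (hR₀ : 0 < R₀) (hR : R₀ < R₁) {f : EE N → ℝ} {B : ℝ} (hB0 : 0 ≤ B)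
    (hf : ∀ y ∈ closure (annulus N R₀ R₁), |f y| ≤ B) (y : EE N) :
    |fold N R₀ R₁ f y| ≤ (R₁ ^ (((N:ℝ) + 2) / 2) * B) * WW N y := by
  have hq : 0 < ((N:ℝ) + 2) / 2 := by positivity
  obtain ⟨hr0, hr1⟩ := rhoF_mem hR₀ hR ‖y‖
  have hR1 : 0 < R₁ := hR₀.trans hR
  rcases eq_or_ne y 0 with rfl | hy
  · have : fold N R₀ R₁ f 0 = 0 := by unfold fold; simp [Real.zero_rpow hq.ne']
    rw [this, abs_zero]
    exact mul_nonneg (mul_nonneg (rpow_nonneg hR1.le _) hB0) (WW_nonneg _)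
  have hyp : 0 < ‖y‖ := norm_pos_iff.2 hy
  have hρ : 0 < rhoF R₀ R₁ ‖y‖ := hR₀.trans_le hr0
  have hmem : (rhoF R₀ R₁ ‖y‖ / ‖y‖) • y ∈ closure (annulus N R₀ R₁) := by
    rw [closure_annulus hR₀ hR]
    have : ‖(rhoF R₀ R₁ ‖y‖ / ‖y‖) • y‖ = rhoF R₀ R₁ ‖y‖ := by
      rw [norm_smul, Real.norm_of_nonneg (by positivity)]; field_simp
    show _ ≤ ‖_‖ ∧ ‖_‖ ≤ _
    rw [this]; exact ⟨hr0, hr1⟩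
  unfold fold WW
  rw [abs_mul, abs_mul, abs_of_nonneg (rpow_nonneg (by positivity) _), div_rpow hρ.le hyp.le,
    rpow_neg hyp.le]
  have a1 : rhoF R₀ R₁ ‖y‖ ^ (((N:ℝ) + 2) / 2) ≤ R₁ ^ (((N:ℝ) + 2) / 2) := rpow_le_rpow hρ.le hr1 hq.le
  have a2 := sgnF_abs (R₀ := R₀) (R₁ := R₁) ‖y‖
  have a3 := hf _ hmem
  have a4 : 0 ≤ rhoF R₀ R₁ ‖y‖ ^ (((N:ℝ) + 2) / 2) / ‖y‖ ^ (((N:ℝ) + 2) / 2) := by positivity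
  have a5 : rhoF R₀ R₁ ‖y‖ ^ (((N:ℝ) + 2) / 2) / ‖y‖ ^ (((N:ℝ) + 2) / 2) ≤
      R₁ ^ (((N:ℝ) + 2) / 2) / ‖y‖ ^ (((N:ℝ) + 2) / 2) := by gcongr
  calc _ ≤ 1 * (R₁ ^ (((N:ℝ) + 2) / 2) / ‖y‖ ^ (((N:ℝ) + 2) / 2)) * B := by gcongr
    _ = _ := by rw [div_eq_mul_inv]; ring

lemma fold_eq (hR₀ : 0 < R₀) (hR : R₀ < R₁) {f : EE N → ℝ} {y : EE N} (hy : y ∈ annulus N R₀ R₁) :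
    fold N R₀ R₁ f y = f y := by
  obtain ⟨h1, h2⟩ := hy
  have hyp := hR₀.trans h1
  have hL := logpos hR₀ hR
  have hp := Real.pi_pos
  have hl0 : 0 < Real.log (‖y‖ / R₀) := Real.log_pos ((one_lt_div hR₀).2 h1)
  have hl1 : Real.log (‖y‖ / R₀) < Real.log (R₁ / R₀) :=
    Real.log_lt_log (by positivity) (by gcongr)
  have ht0 : 0 < tauF R₀ R₁ ‖y‖ := by unfold tauF; positivity
  have ht1 : tauF R₀ R₁ ‖y‖ < π := by
    unfold tauF
    rw [div_lt_iff₀ hL]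
    gcongr
  have hr : rhoF R₀ R₁ ‖y‖ = ‖y‖ := by
    unfold rhoF
    rw [Real.arccos_cos ht0.le ht1.le]
    have : Real.log (R₁ / R₀) / π * tauF R₀ R₁ ‖y‖ = Real.log (‖y‖ / R₀) := by
      unfold tauF; field_simp
    rw [this, Real.exp_log (by positivity)]
    field_simp
  have hs : sgnF R₀ R₁ ‖y‖ = 1 := by
    unfold sgnF
    have := Real.sin_pos_of_pos_of_lt_pi ht0 ht1
    rw [abs_of_pos this, div_self this.ne']
  unfold fold
  rw [hr, hs, div_self hyp.ne']
  simp

lemma tauF_inv0 (hR₀ : 0 < R₀) {t : ℝ} (ht : 0 < t) :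
    tauF R₀ R₁ (R₀ ^ 2 / t) = - tauF R₀ R₁ t := by
  unfold tauF
  have : R₀ ^ 2 / t / R₀ = (t / R₀)⁻¹ := by field_simp
  rw [this, Real.log_inv]; ring

lemma tauF_inv1 (hR₀ : 0 < R₀) (hR : R₀ < R₁) {t : ℝ} (ht : 0 < t) :
    tauF R₀ R₁ (R₁ ^ 2 / t) = 2 * π - tauF R₀ R₁ t := by
  unfold tauF
  have hL := logpos hR₀ hR
  have hR1 : 0 < R₁ := hR₀.trans hR
  have : R₁ ^ 2 / t / R₀ = (R₁ / R₀) ^ 2 * (t / R₀)⁻¹ := by field_simp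
  rw [this, Real.log_mul (by positivity) (by positivity), Real.log_inv, Real.log_pow]
  field_simp
  push_cast
  ring

/-- Kelvin antisymmetry -/
lemma fold_kelvin (hR₀ : 0 < R₀) (hR : R₀ < R₁) {f : EE N → ℝ} {R : ℝ} (hRR : R = R₀ ∨ R = R₁)
    {y : EE N} (hy : y ≠ 0) :
    fold N R₀ R₁ f ((R / ‖y‖) ^ 2 • y) = - (‖y‖ / R) ^ ((N:ℝ) + 2) * fold N R₀ R₁ f y := by
  have hyp : 0 < ‖y‖ := norm_pos_iff.2 hy
  have hRp : 0 < R := by rcases hRR with h | h <;> subst h <;> linarith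
  have hn : ‖(R / ‖y‖) ^ 2 • y‖ = R ^ 2 / ‖y‖ := by
    rw [norm_smul, Real.norm_of_nonneg (by positivity)]; field_simp
  have hrho : rhoF R₀ R₁ (R ^ 2 / ‖y‖) = rhoF R₀ R₁ ‖y‖ := by
    unfold rhoF
    rcases hRR with h | h <;> subst h
    · rw [tauF_inv0 hR₀ hyp, Real.cos_neg]
    · rw [tauF_inv1 hR₀ hR hyp, Real.cos_two_pi_sub]
  have hsg : sgnF R₀ R₁ (R ^ 2 / ‖y‖) = - sgnF R₀ R₁ ‖y‖ := by
    unfold sgnF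
    rcases hRR with h | h <;> subst h
    · rw [tauF_inv0 hR₀ hyp, Real.sin_neg, abs_neg, neg_div]
    · rw [tauF_inv1 hR₀ hR hyp, Real.sin_two_pi_sub, abs_neg, neg_div]
  have hρ : 0 < rhoF R₀ R₁ ‖y‖ := hR₀.trans_le (rhoF_mem hR₀ hR ‖y‖).1
  unfold fold
  rw [hn, hrho, hsg, smul_smul]
  have e1 : rhoF R₀ R₁ ‖y‖ / (R ^ 2 / ‖y‖) * (R / ‖y‖) ^ 2 = rhoF R₀ R₁ ‖y‖ / ‖y‖ := by
    field_simp
  have e2 : rhoF R₀ R₁ ‖y‖ / (R ^ 2 / ‖y‖) = (‖y‖ / R) ^ (2:ℕ) * (rhoF R₀ R₁ ‖y‖ / ‖y‖) := by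
    field_simp
  have e3 : ((‖y‖ / R) ^ (2:ℕ)) ^ (((N:ℝ) + 2) / 2) = (‖y‖ / R) ^ ((N:ℝ) + 2) := by
    rw [← rpow_natCast, ← rpow_mul (by positivity)]
    congr 1; push_cast; ring
  rw [e1, e2, mul_rpow (by positivity) (by positivity), e3]
  ring

lemma inv_det (R : ℝ) {y : EE N} :
    |((R / dist y 0) ^ 2 • (((ℝ ∙ (y - 0))ᗮ.reflection : EE N ≃ₗᵢ[ℝ] EE N) : EE N →L[ℝ] EE N)).det| =
      (R / ‖y‖) ^ (2 * N) := by
  rw [dist_zero_right, ContinuousLinearMap.det, ContinuousLinearMap.toLinearMap_smul, LinearMap.det_smul,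
    finrank_euclideanSpace_fin]
  have : LinearMap.det ((((ℝ ∙ (y - 0))ᗮ.reflection : EE N ≃ₗᵢ[ℝ] EE N) : EE N →L[ℝ] EE N) : EE N →ₗ[ℝ] EE N)
    = (-1) ^ Module.finrank ℝ ((ℝ ∙ (y - 0))ᗮᗮ : Submodule ℝ (EE N)) := (ℝ ∙ (y - 0))ᗮ.det_reflection
  rw [this, abs_mul, abs_pow, abs_pow, abs_pow, abs_neg, abs_one, one_pow, mul_one, ← pow_mul, ← abs_pow]
  exact abs_of_nonneg (by rw [pow_mul]; positivity)

lemma pot_fold_zero (hN : 3 ≤ N) (hR₀ : 0 < R₀) (hR : R₀ < R₁) {f : EE N → ℝ} {x : EE N}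
    (hx : ‖x‖ = R₀ ∨ ‖x‖ = R₁) : Pot N (fold N R₀ R₁ f) x = 0 := by
  set F := fold N R₀ R₁ f with hF
  set R := ‖x‖ with hRdef
  have hRp : 0 < R := by rcases hx with h | h <;> rw [h] <;> linarith
  have hx0 : x ≠ 0 := norm_pos_iff.1 hRp
  have : Nonempty (Fin N) := ⟨⟨0, by omega⟩⟩
  have hae : (({0} : Set (EE N))ᶜ : Set (EE N)) =ᵐ[volume] univ := by
    rw [ae_eq_univ]; simp
  set s : Set (EE N) := {0}ᶜ with hs
  have himg : EuclideanGeometry.inversion (0 : EE N) R '' s = s := by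
    ext y
    constructor
    · rintro ⟨z, hz, rfl⟩
      simp only [hs, mem_compl_iff, mem_singleton_iff] at hz ⊢
      rwa [EuclideanGeometry.inversion_eq_center hRp.ne']
    · intro hy
      refine ⟨EuclideanGeometry.inversion 0 R y, ?_, EuclideanGeometry.inversion_inversion _ hRp.ne' _⟩
      simp only [hs, mem_compl_iff, mem_singleton_iff] at hy ⊢
      rwa [EuclideanGeometry.inversion_eq_center hRp.ne']
  have key := integral_image_eq_integral_abs_det_fderiv_smul (μ := (volume : Measure (EE N)))
    (s := s) (f := EuclideanGeometry.inversion 0 R)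
    (measurableSet_singleton _).compl
    (fun y hy => (EuclideanGeometry.hasFDerivAt_inversion (R := R) hy).hasFDerivWithinAt)
    (EuclideanGeometry.inversion_injective _ hRp.ne').injOn
    (fun y => ‖x - y‖ ^ (-((N:ℝ) - 2)) * F y)
  rw [himg] at key
  have h2 : ∫ y in s, |((R / dist y 0) ^ 2 • (((ℝ ∙ (y - 0))ᗮ.reflection : EE N ≃ₗᵢ[ℝ] EE N) :
      EE N →L[ℝ] EE N)).det| • (‖x - EuclideanGeometry.inversion 0 R y‖ ^ (-((N:ℝ) - 2)) *
        F (EuclideanGeometry.inversion 0 R y)) = ∫ y in s, - (‖x - y‖ ^ (-((N:ℝ) - 2)) * F y) := by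
    refine setIntegral_congr_fun (measurableSet_singleton _).compl fun y hy => ?_
    have hy0 : y ≠ 0 := hy
    have hyp : 0 < ‖y‖ := norm_pos_iff.2 hy0
    beta_reduce
    have hi : EuclideanGeometry.inversion (0 : EE N) R y = (R / ‖y‖) ^ 2 • y := by
      simp [EuclideanGeometry.inversion]
    have hd : ‖x - EuclideanGeometry.inversion (0 : EE N) R y‖ = R / ‖y‖ * ‖x - y‖ := by
      have h := EuclideanGeometry.dist_inversion_inversion hx0 hy0 R
      rw [EuclideanGeometry.inversion_of_mem_sphere (by simp [hRdef])] at h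
      rw [dist_zero_right, dist_zero_right, dist_eq_norm, dist_eq_norm, ← hRdef] at h
      rw [h]; field_simp
    rw [inv_det, hd, hi, hF, fold_kelvin hR₀ hR hx hy0, smul_eq_mul, mul_rpow (by positivity) (norm_nonneg _)]
    have e1 : (‖y‖ / R) ^ ((N:ℝ) + 2) = (R / ‖y‖) ^ (-((N:ℝ) + 2)) := by
      rw [rpow_neg (by positivity), ← inv_rpow (by positivity), inv_div]
    have e2 : (R / ‖y‖) ^ (2 * N) * (R / ‖y‖) ^ (-((N:ℝ) - 2)) * (R / ‖y‖) ^ (-((N:ℝ) + 2)) = 1 := by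
      rw [← rpow_natCast, ← rpow_add (by positivity), ← rpow_add (by positivity)]
      convert rpow_zero _ using 2
      push_cast; ring
    rw [e1]
    linear_combination (- (‖x - y‖ ^ (-((N:ℝ) - 2)) * fold N R₀ R₁ f y)) * e2
  rw [h2, integral_neg] at key
  have h3 : ∫ y in s, ‖x - y‖ ^ (-((N:ℝ) - 2)) * F y = ∫ y, ‖x - y‖ ^ (-((N:ℝ) - 2)) * F y := by
    rw [setIntegral_congr_set hae, setIntegral_univ]
  unfold Pot
  rw [← h3]
  have : ∫ y in s, ‖x - y‖ ^ (-((N:ℝ) - 2)) * F y = 0 := by linarith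
  rw [this, mul_zero]

end Fold


section Green
variable {N : ℕ} {R₀ R₁ : ℝ}

/-- Green operator of the (negative) Dirichlet Laplacian on the annulus. -/
noncomputable def GG (N : ℕ) (R₀ R₁ : ℝ) (f : EE N → ℝ) : EE N → ℝ :=
  Pot N (fold N R₀ R₁ ((closure (annulus N R₀ R₁)).indicator f))

lemma src_meas {f : EE N → ℝ} (hf : ContinuousOn f (closure (annulus N R₀ R₁))) :
    Measurable (fold N R₀ R₁ ((closure (annulus N R₀ R₁)).indicator f)) := by
  apply fold_measurable
  classical
  rw [← piecewise_eq_indicator]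
  exact hf.measurable_piecewise continuousOn_const isClosed_closure.measurableSet

lemma src_bound (hR₀ : 0 < R₀) (hR : R₀ < R₁) {f : EE N → ℝ} {B : ℝ} (hB0 : 0 ≤ B)
    (hB : ∀ y ∈ closure (annulus N R₀ R₁), |f y| ≤ B) (y : EE N) :
    |fold N R₀ R₁ ((closure (annulus N R₀ R₁)).indicator f) y| ≤
      (R₁ ^ (((N:ℝ) + 2) / 2) * B) * WW N y := by
  refine fold_bound hR₀ hR hB0 (fun y hy => ?_) y
  rw [indicator_of_mem hy]; exact hB y hy

lemma ex_bound {f : EE N → ℝ} (hf : ContinuousOn f (closure (annulus N R₀ R₁))) :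
    ∃ B, 0 ≤ B ∧ ∀ y ∈ closure (annulus N R₀ R₁), |f y| ≤ B := by
  obtain ⟨B, hB⟩ := compact_closure_annulus.exists_bound_of_continuousOn hf
  exact ⟨max B 0, le_max_right _ _, fun y hy => (hB y hy).trans (le_max_left _ _)⟩

lemma R1pow_nonneg (hR₀ : 0 < R₀) (hR : R₀ < R₁) : 0 ≤ R₁ ^ (((N:ℝ) + 2) / 2) :=
  rpow_nonneg (hR₀.trans hR).le _

lemma GG_contDiffOn (hN : 3 ≤ N) (hR₀ : 0 < R₀) (hR : R₀ < R₁) {f : EE N → ℝ}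
    (hf : ContinuousOn f (closure (annulus N R₀ R₁))) :
    ContDiffOn ℝ 1 (GG N R₀ R₁ f) {x | x ≠ 0} := by
  obtain ⟨B, hB0, hB⟩ := ex_bound hf
  exact pot_contDiffOn hN (mul_nonneg (R1pow_nonneg hR₀ hR) hB0) (src_meas hf) (src_bound hR₀ hR hB0 hB)

lemma GG_grad (hN : 3 ≤ N) (hR₀ : 0 < R₀) (hR : R₀ < R₁) {f : EE N → ℝ}
    (hf : ContinuousOn f (closure (annulus N R₀ R₁))) {x : EE N} (hx : x ≠ 0) :
    HasFDerivAt (GG N R₀ R₁ f)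
      (innerSL ℝ (VV N (fold N R₀ R₁ ((closure (annulus N R₀ R₁)).indicator f)) x)) x ∧
    gradient (GG N R₀ R₁ f) x =
      VV N (fold N R₀ R₁ ((closure (annulus N R₀ R₁)).indicator f)) x := by
  obtain ⟨B, hB0, hB⟩ := ex_bound hf
  have h := pot_hasFDerivAt hN (mul_nonneg (R1pow_nonneg hR₀ hR) hB0) (src_meas hf) (src_bound hR₀ hR hB0 hB) hx
  refine ⟨h, ?_⟩
  refine ext_inner_right ℝ fun v => ?_
  rw [inner_grad]
  have : fderiv ℝ (GG N R₀ R₁ f) x = _ := h.fderiv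
  rw [this]; rfl

lemma GG_weak (hN : 3 ≤ N) (hR₀ : 0 < R₀) (hR : R₀ < R₁) {f : EE N → ℝ}
    (hf : ContinuousOn f (closure (annulus N R₀ R₁))) {φ : EE N → ℝ} (h : ContDiff ℝ 1 φ)
    (hc : HasCompactSupport φ) (hs : tsupport φ ⊆ annulus N R₀ R₁) :
    ∫ x, inner ℝ (gradient (GG N R₀ R₁ f) x) (gradient φ x) = ∫ x, f x * φ x := by
  obtain ⟨B, hB0, hB⟩ := ex_bound hf
  have h0 : (0 : EE N) ∉ tsupport φ := fun h0 => by
    have := (hs h0).1; rw [norm_zero] at this; linarith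
  have hw := pot_weak hN (mul_nonneg (R1pow_nonneg hR₀ hR) hB0) (src_meas hf) (src_bound hR₀ hR hB0 hB) h hc h0
  have : Nonempty (Fin N) := ⟨⟨0, by omega⟩⟩
  rw [show (∫ x, f x * φ x) = ∫ x, fold N R₀ R₁ ((closure (annulus N R₀ R₁)).indicator f) x * φ x from ?_, ← hw]
  · refine integral_congr_ae ?_
    have : ∀ᵐ x : EE N, x ≠ 0 := by
      rw [ae_iff]; simp
    filter_upwards [this] with x hx
    rw [(GG_grad hN hR₀ hR hf hx).2]
  · congr 1; ext x
    by_cases hx : x ∈ annulus N R₀ R₁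
    · rw [fold_eq hR₀ hR hx, indicator_of_mem (subset_closure hx)]
    · have : φ x = 0 := image_eq_zero_of_notMem_tsupport fun h => hx (hs h)
      rw [this, mul_zero, mul_zero]

lemma GG_zero (hN : 3 ≤ N) (hR₀ : 0 < R₀) (hR : R₀ < R₁) {f : EE N → ℝ} {x : EE N}
    (hx : ‖x‖ = R₀ ∨ ‖x‖ = R₁) : GG N R₀ R₁ f x = 0 := pot_fold_zero hN hR₀ hR hx

lemma GG_bounds (hN : 3 ≤ N) (hR₀ : 0 < R₀) (hR : R₀ < R₁) :
    ∃ C : ℝ, 0 ≤ C ∧ ∀ (B : ℝ) (f : EE N → ℝ), 0 ≤ B → ContinuousOn f (closure (annulus N R₀ R₁)) →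
      (∀ y ∈ closure (annulus N R₀ R₁), |f y| ≤ B) → ∀ x ∈ closure (annulus N R₀ R₁),
      |GG N R₀ R₁ f x| ≤ C * B ∧ ‖gradient (GG N R₀ R₁ f) x‖ ≤ C * B ∧
      ∀ x' ∈ closure (annulus N R₀ R₁), ‖x - x'‖ < R₀ / 2 →
        |GG N R₀ R₁ f x - GG N R₀ R₁ f x'| ≤ C * B * ‖x - x'‖ ∧
        ‖gradient (GG N R₀ R₁ f) x - gradient (GG N R₀ R₁ f) x'‖ ≤ C * B * √‖x - x'‖ := by
  obtain ⟨C, hC, H⟩ := pot_bounds hN (ρ0 := R₀ / 2) (ρ1 := 2 * R₁) (by positivity)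
  have hP := R1pow_nonneg (N := N) hR₀ hR
  have hR1 := hR₀.trans hR
  refine ⟨C * R₁ ^ (((N:ℝ) + 2) / 2), by positivity, fun B f hB0 hf hB x hx => ?_⟩
  have hx0 := ne_zero_of_closure hR₀ hR hx
  have hcl : ∀ y ∈ closure (annulus N R₀ R₁), R₀ ≤ ‖y‖ ∧ ‖y‖ ≤ R₁ := fun y hy => by
    rwa [closure_annulus hR₀ hR] at hy
  have H' := H _ _ (mul_nonneg hP hB0) (src_meas hf) (src_bound hR₀ hR hB0 hB)
  have e : C * R₁ ^ (((N:ℝ) + 2) / 2) * B = C * (R₁ ^ (((N:ℝ) + 2) / 2) * B) := by ring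
  rw [e]
  obtain ⟨x1, x2⟩ := hcl x hx
  obtain ⟨h1, h2, -, h4⟩ := H' x (by linarith) (by linarith)
  refine ⟨h1, by rw [(GG_grad hN hR₀ hR hf hx0).2]; exact h2, fun x' hx' hd => ?_⟩
  have hx'0 := ne_zero_of_closure hR₀ hR hx'
  obtain ⟨y1, y2⟩ := hcl x' hx'
  constructor
  · have hmv := Convex.norm_image_sub_le_of_norm_hasFDerivWithin_le (𝕜 := ℝ) (f := GG N R₀ R₁ f)
      (f' := fun z => innerSL ℝ (VV N (fold N R₀ R₁ ((closure (annulus N R₀ R₁)).indicator f)) z))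
      (s := Metric.ball x (R₀ / 2)) (C := C * (R₁ ^ (((N:ℝ) + 2) / 2) * B)) (x := x') (y := x) ?_ ?_
      (convex_ball _ _) ?_ ?_
    · rwa [Real.norm_eq_abs] at hmv
    · intro z hz
      rw [mem_ball_iff_norm] at hz
      have a1 := norm_sub_norm_le x z
      rw [norm_sub_rev] at a1
      have : z ≠ 0 := norm_pos_iff.1 (by linarith)
      exact (GG_grad hN hR₀ hR hf this).1.hasFDerivWithinAt
    · intro z hz
      rw [mem_ball_iff_norm] at hz
      have a1 := norm_sub_norm_le x z
      have a2 := norm_sub_norm_le z x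
      rw [norm_sub_rev] at a1
      rw [innerSL_apply_norm]
      exact (H' z (by linarith) (by linarith)).2.1
    · rw [mem_ball_iff_norm, norm_sub_rev]; exact hd
    · exact Metric.mem_ball_self (by positivity)
  · rw [(GG_grad hN hR₀ hR hf hx0).2, (GG_grad hN hR₀ hR hf hx'0).2]
    exact h4 x' (by linarith) (by linarith)

lemma GG_lin (hN : 3 ≤ N) (hR₀ : 0 < R₀) (hR : R₀ < R₁) {f g : EE N → ℝ}
    (hf : ContinuousOn f (closure (annulus N R₀ R₁))) (hg : ContinuousOn g (closure (annulus N R₀ R₁)))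
    (c : ℝ) {x : EE N} (hx : x ≠ 0) :
    GG N R₀ R₁ (fun y => f y + c * g y) x = GG N R₀ R₁ f x + c * GG N R₀ R₁ g x := by
  have hN' : (3:ℝ) ≤ N := by exact_mod_cast hN
  obtain ⟨B, hB0, hB⟩ := ex_bound hf
  obtain ⟨B', hB0', hB'⟩ := ex_bound hg
  have i1 := ker_integrable hN (β := (N:ℝ) - 2) (src_meas hf) (src_bound hR₀ hR hB0 hB) hx le_rfl (by linarith) |>.1
  have i2 := ker_integrable hN (β := (N:ℝ) - 2) (src_meas hg) (src_bound hR₀ hR hB0' hB') hx le_rfl (by linarith) |>.1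
  unfold GG Pot
  have : (fun y => ‖x - y‖ ^ (-((N:ℝ) - 2)) * fold N R₀ R₁ ((closure (annulus N R₀ R₁)).indicator
      (fun y => f y + c * g y)) y) = fun y =>
      ‖x - y‖ ^ (-((N:ℝ) - 2)) * fold N R₀ R₁ ((closure (annulus N R₀ R₁)).indicator f) y +
      c * (‖x - y‖ ^ (-((N:ℝ) - 2)) * fold N R₀ R₁ ((closure (annulus N R₀ R₁)).indicator g) y) := by
    ext y
    unfold fold
    by_cases h : (rhoF R₀ R₁ ‖y‖ / ‖y‖) • y ∈ closure (annulus N R₀ R₁)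
    · simp only [indicator_of_mem h]; ring
    · simp only [indicator_of_notMem h]; ring
  rw [this, integral_add i1 (i2.const_mul c), integral_const_mul]
  ring

lemma ws_unique {D : Set (EE N)} (hD : IsOpen D) (hb : Bornology.IsBounded D) {f u v : EE N → ℝ}
    (hu : IsWS D f u) (hv : IsWS D f v) (cu : ContinuousOn u (closure D)) (cv : ContinuousOn v (closure D))
    (hfr : ∀ x ∈ frontier D, u x = v x) : ∀ x ∈ D, u x = v x := by
  intro x hx
  have h1 := max_principle hD hb (w := fun x => u x - 1 * v x) (cu.sub (continuousOn_const.mul cv)) (hu.sub_mul hD hv 1)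
    (fun x _ => by simp) (fun x hx => by rw [hfr x hx]; simp) x hx
  have h2 := max_principle hD hb (w := fun x => v x - 1 * u x) (cv.sub (continuousOn_const.mul cu)) (hv.sub_mul hD hu 1)
    (fun x _ => by simp) (fun x hx => by rw [hfr x hx]; simp) x hx
  simp only [one_mul] at h1 h2
  linarith

lemma GG_ws (hN : 3 ≤ N) (hR₀ : 0 < R₀) (hR : R₀ < R₁) {f v : EE N → ℝ}
    (hf : ContinuousOn f (closure (annulus N R₀ R₁))) (hv : ContinuousOn v (closure (annulus N R₀ R₁)))
    (heq : ∀ x ∈ closure (annulus N R₀ R₁), v x = GG N R₀ R₁ (fun y => f y - v y) x) :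
    IsWS (annulus N R₀ R₁) f (GG N R₀ R₁ (fun y => f y - v y)) := by
  have hA := isOpen_annulus (N := N) (R₀ := R₀) (R₁ := R₁)
  have hc : ContDiffOn ℝ 1 (GG N R₀ R₁ (fun y => f y - v y)) (annulus N R₀ R₁) :=
    (GG_contDiffOn hN hR₀ hR (hf.sub hv)).mono fun x hx => ne_zero_of_closure hR₀ hR (subset_closure hx)
  refine ⟨hf.mono subset_closure, hc, fun φ h1 h2 h3 => ?_⟩
  have i1 := (int_grad hA h1 h2 h3 hc).2
  have i2 := (int_mul hA h1.continuous h2 h3 hc.continuousOn).2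
  have i3 := (int_mul hA h1.continuous h2 h3 (hf.mono subset_closure)).2
  have i4 := (int_mul hA h1.continuous h2 h3 (hv.mono subset_closure)).2
  rw [integral_add i1 i2, GG_weak (f := fun y => f y - v y) hN hR₀ hR (hf.sub hv) h1 h2 h3]
  have : (∫ x, (f x - v x) * φ x) = (∫ x, f x * φ x) - ∫ x, v x * φ x := by
    rw [← integral_sub i3 i4]; congr 1; ext x; ring
  rw [this]
  have : ∫ x, GG N R₀ R₁ (fun y => f y - v y) x * φ x = ∫ x, v x * φ x := by
    congr 1; ext x
    by_cases hx : x ∈ annulus N R₀ R₁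
    · rw [← heq x (subset_closure hx)]
    · rw [image_eq_zero_of_notMem_tsupport fun h => hx (h3 h), mul_zero, mul_zero]
  rw [this]; ring

/-- zero extension of a function on the closed annulus -/
noncomputable def exX (g : BoundedContinuousFunction (closure (annulus N R₀ R₁)) ℝ) (y : EE N) : ℝ :=
  open Classical in if h : y ∈ closure (annulus N R₀ R₁) then g ⟨y, h⟩ else 0

lemma exX_of_mem (g : BoundedContinuousFunction (closure (annulus N R₀ R₁)) ℝ) {y : EE N}
    (h : y ∈ closure (annulus N R₀ R₁)) : exX g y = g ⟨y, h⟩ := by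
  simp [exX, h]

lemma exX_cont (g : BoundedContinuousFunction (closure (annulus N R₀ R₁)) ℝ) :
    ContinuousOn (exX g) (closure (annulus N R₀ R₁)) := by
  rw [continuousOn_iff_continuous_domRestrict]
  convert g.continuous using 1
  ext x
  exact exX_of_mem g x.2

lemma exX_bd (g : BoundedContinuousFunction (closure (annulus N R₀ R₁)) ℝ) :
    ∀ y ∈ closure (annulus N R₀ R₁), |exX g y| ≤ ‖g‖ := by
  intro y hy
  rw [exX_of_mem g hy]
  exact g.norm_coe_le_norm _

/-- restriction to the closed annulus -/
noncomputable def reX {f : EE N → ℝ} (hf : ContinuousOn f (closure (annulus N R₀ R₁))) :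
    BoundedContinuousFunction (closure (annulus N R₀ R₁)) ℝ :=
  haveI : CompactSpace (closure (annulus N R₀ R₁)) := isCompact_iff_compactSpace.1 compact_closure_annulus
  BoundedContinuousFunction.mkOfCompact ⟨_, continuousOn_iff_continuous_domRestrict.1 hf⟩

lemma reX_apply {f : EE N → ℝ} (hf : ContinuousOn f (closure (annulus N R₀ R₁)))
    (x : closure (annulus N R₀ R₁)) : reX hf x = f x := rfl

lemma GG_cont (hN : 3 ≤ N) (hR₀ : 0 < R₀) (hR : R₀ < R₁) {f : EE N → ℝ}
    (hf : ContinuousOn f (closure (annulus N R₀ R₁))) :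
    ContinuousOn (GG N R₀ R₁ f) (closure (annulus N R₀ R₁)) :=
  (GG_contDiffOn hN hR₀ hR hf).continuousOn.mono fun _ hx => ne_zero_of_closure hR₀ hR hx

/-- Solvability of `-Δ v + v = f` with zero boundary values. -/
lemma exists_sol (hN : 3 ≤ N) (hR₀ : 0 < R₀) (hR : R₀ < R₁) {f : EE N → ℝ}
    (hf : ContinuousOn f (closure (annulus N R₀ R₁))) :
    ∃ v : EE N → ℝ, ContinuousOn v (closure (annulus N R₀ R₁)) ∧
      ∀ x ∈ closure (annulus N R₀ R₁), v x = GG N R₀ R₁ (fun y => f y - v y) x := by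
  have : CompactSpace (closure (annulus N R₀ R₁)) := isCompact_iff_compactSpace.1 compact_closure_annulus
  obtain ⟨C, hC, H⟩ := GG_bounds (N := N) hN hR₀ hR
  have hne : ∀ x : closure (annulus N R₀ R₁), (x : EE N) ≠ 0 := fun x => ne_zero_of_closure hR₀ hR x.2
  have hcg : ∀ {f g : EE N → ℝ}, (∀ y ∈ closure (annulus N R₀ R₁), f y = g y) →
      GG N R₀ R₁ f = GG N R₀ R₁ g := by
    intro f g h
    unfold GG
    rw [indicator_congr h]
  let T0 : BoundedContinuousFunction (closure (annulus N R₀ R₁)) ℝ →ₗ[ℝ]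
      BoundedContinuousFunction (closure (annulus N R₀ R₁)) ℝ :=
    { toFun := fun g => reX (GG_cont hN hR₀ hR (exX_cont g))
      map_add' := by
        intro g h
        ext x
        simp only [BoundedContinuousFunction.coe_add, Pi.add_apply, reX_apply]
        have := GG_lin hN hR₀ hR (exX_cont g) (exX_cont h) 1 (hne x)
        rw [one_mul] at this
        rw [← this]
        refine congrFun (hcg fun y hy => ?_) _
        rw [exX_of_mem _ hy, exX_of_mem _ hy, exX_of_mem _ hy]; simp
      map_smul' := by
        intro c g
        ext x
        simp only [BoundedContinuousFunction.coe_smul, reX_apply, RingHom.id_apply, smul_eq_mul]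
        have := GG_lin hN hR₀ hR (exX_cont 0) (exX_cont g) c (hne x)
        have h2 := GG_lin hN hR₀ hR (exX_cont 0) (exX_cont 0) 1 (hne x)
        have h3 : GG N R₀ R₁ (fun y => exX (R₀ := R₀) (R₁ := R₁) (N := N) 0 y + 1 * exX (R₀ := R₀) (R₁ := R₁) (N := N) 0 y)
            = GG N R₀ R₁ (exX (R₀ := R₀) (R₁ := R₁) (N := N) 0) := by
          refine hcg fun y hy => ?_
          rw [exX_of_mem _ hy]; simp
        rw [h3] at h2
        have h4 : GG N R₀ R₁ (exX (R₀ := R₀) (R₁ := R₁) (N := N) 0) x = 0 := by linarith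
        rw [h4, zero_add] at this
        rw [← this]
        refine congrFun (hcg fun y hy => ?_) _
        rw [exX_of_mem _ hy, exX_of_mem _ hy, exX_of_mem _ hy]; simp }
  let T := T0.mkContinuous C (by
    intro g
    rw [BoundedContinuousFunction.norm_le (by positivity)]
    intro x
    exact (H ‖g‖ (exX g) (norm_nonneg _) (exX_cont g) (exX_bd g) x x.2).1)
  have hTa : ∀ g x, T g x = GG N R₀ R₁ (exX g) x := fun g x => rfl
  have hT : IsCompactOperator T := by
    have := (isCompactOperator_iff_isCompact_closure_image_closedBall T0 one_pos).2
    refine this ?_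
    refine BoundedContinuousFunction.arzela_ascoli (Icc (-C) C) isCompact_Icc _ ?_ ?_
    · rintro _ x ⟨g, hg, rfl⟩
      have hg1 : ‖g‖ ≤ 1 := by simpa using hg
      have := (H 1 (exX g) (by norm_num) (exX_cont g) (fun y hy => (exX_bd g y hy).trans hg1) x x.2).1
      rw [mul_one] at this
      exact abs_le.1 this
    · intro x₀
      refine Metric.equicontinuousAt_of_continuity_modulus (α := ℝ) (fun x : closure (annulus N R₀ R₁) => C * 1 * ‖(x₀ : EE N) - x‖) ?_ _ ?_
      · have : Continuous fun x : closure (annulus N R₀ R₁) => C * 1 * ‖(x₀ : EE N) - x‖ := by fun_prop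
        simpa using this.tendsto x₀
      · filter_upwards [Metric.ball_mem_nhds x₀ (half_pos hR₀)] with x hx
        rintro ⟨_, ⟨g, hg, rfl⟩⟩
        have hg1 : ‖g‖ ≤ 1 := by simpa using hg
        have hx : dist x₀ x < R₀ / 2 := by rw [dist_comm]; exact hx
        exact ((H 1 (exX g) (by norm_num) (exX_cont g) (fun y hy => (exX_bd g y hy).trans hg1) x₀ x₀.2).2.2
          x x.2 hx).1
  rcases hT.hasEigenvalue_or_mem_resolventSet (μ := (-1:ℝ)) (by norm_num) with h | h
  · exfalso
    obtain ⟨g, hg⟩ := h.exists_hasEigenvector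
    have hgn := hg.2
    have hge : T g = (-1:ℝ) • g := hg.apply_eq_smul
    have hgx : ∀ x ∈ closure (annulus N R₀ R₁), exX g x = GG N R₀ R₁ (fun y => 0 - exX g y) x := by
      intro x hx
      have h1 := congrArg (fun k => k ⟨x, hx⟩) hge
      simp only [hTa, BoundedContinuousFunction.coe_smul, smul_eq_mul] at h1
      have h2 := GG_lin hN hR₀ hR (exX_cont g) (exX_cont g) (-2) (ne_zero_of_closure hR₀ hR hx)
      have h3 : GG N R₀ R₁ (fun y => exX g y + -2 * exX g y) = GG N R₀ R₁ (fun y => 0 - exX g y) :=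
        hcg fun y hy => by ring
      rw [h3] at h2
      rw [exX_of_mem g hx, h2]
      linarith
    have hws := GG_ws hN hR₀ hR (f := fun _ => 0) continuousOn_const (exX_cont g) hgx
    have h0 : IsWS (annulus N R₀ R₁) (fun _ => 0) (fun _ => 0) := by
      refine ⟨continuousOn_const, contDiffOn_const, fun φ _ _ _ => ?_⟩
      simp [gradient]
    have hz := ws_unique isOpen_annulus bounded_annulus hws h0
      (GG_cont hN hR₀ hR (continuousOn_const.sub (exX_cont g))) continuousOn_const
      (fun x hx => GG_zero hN hR₀ hR (frontier_annulus hR₀ hR hx))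
    apply hgn
    ext x
    rw [← exX_of_mem g x.2, hgx x x.2]
    by_cases hx : (x : EE N) ∈ annulus N R₀ R₁
    · exact hz x hx
    · refine GG_zero hN hR₀ hR (frontier_annulus hR₀ hR ?_)
      rw [isOpen_annulus.frontier_eq]
      exact ⟨x.2, hx⟩
  · rw [spectrum.mem_resolventSet_iff, ContinuousLinearMap.isUnit_iff_bijective] at h
    obtain ⟨g, hg⟩ := h.2 (- reX (GG_cont hN hR₀ hR hf))
    refine ⟨exX g, exX_cont g, fun x hx => ?_⟩
    have h1 := congrArg (fun k => k ⟨x, hx⟩) hg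
    have h1' : -(g ⟨x, hx⟩) - GG N R₀ R₁ (exX g) x = - GG N R₀ R₁ f x := by
      rw [sub_apply, Algebra.algebraMap_eq_smul_one] at h1
      simp only [smul_apply, one_apply_eq_self,
        BoundedContinuousFunction.coe_sub, Pi.sub_apply, BoundedContinuousFunction.coe_smul,
        BoundedContinuousFunction.coe_neg, Pi.neg_apply, hTa, reX_apply, smul_eq_mul] at h1
      linarith
    have h2 := GG_lin hN hR₀ hR hf (exX_cont g) (-1) (ne_zero_of_closure hR₀ hR hx)
    have h3 : GG N R₀ R₁ (fun y => f y + -1 * exX g y) = GG N R₀ R₁ (fun y => f y - exX g y) :=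
      hcg fun y hy => by ring
    rw [h3] at h2
    rw [h2, exX_of_mem g hx]
    linarith

end Green


section Cone
variable {N : ℕ} {R₀ R₁ : ℝ}

/-- `v` is the (canonical) solution of `-Δ v + v = f`, `v = 0` on the boundary. -/
structure IsT (N : ℕ) (R₀ R₁ : ℝ) (f v : EE N → ℝ) : Prop where
  cf : ContinuousOn f (closure (annulus N R₀ R₁))
  c1 : ContDiffOn ℝ 1 v {x | x ≠ 0}
  bd : ∀ x : EE N, (‖x‖ = R₀ ∨ ‖x‖ = R₁) → v x = 0
  ws : IsWS (annulus N R₀ R₁) f v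
  rep : v = GG N R₀ R₁ (fun y => f y - v y)

lemma exists_T (hN : 3 ≤ N) (hR₀ : 0 < R₀) (hR : R₀ < R₁) {f : EE N → ℝ}
    (hf : ContinuousOn f (closure (annulus N R₀ R₁))) : ∃ v, IsT N R₀ R₁ f v := by
  obtain ⟨v0, h1, h2⟩ := exists_sol hN hR₀ hR hf
  refine ⟨GG N R₀ R₁ (fun y => f y - v0 y), hf, GG_contDiffOn hN hR₀ hR (hf.sub h1),
    fun x hx => GG_zero hN hR₀ hR hx, GG_ws hN hR₀ hR hf h1 h2, ?_⟩
  conv_lhs => unfold GG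
  conv_rhs => unfold GG
  congr 2
  refine indicator_congr fun y hy => ?_
  rw [← GG, ← h2 y hy]

lemma IsT.c1' (hR₀ : 0 < R₀) (hR : R₀ < R₁) {f v : EE N → ℝ} (h : IsT N R₀ R₁ f v) :
    ContDiffOn ℝ 1 v (closure (annulus N R₀ R₁)) :=
  h.c1.mono fun _ hx => ne_zero_of_closure hR₀ hR hx

/-- monotonicity formulation of the cone condition -/
def PP (N : ℕ) (R₀ R₁ : ℝ) (u : EE N → ℝ) : Prop :=
  ∀ x ∈ closure (annulus N R₀ R₁), ∀ y ∈ closure (annulus N R₀ R₁), ‖x‖ = ‖y‖ →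
    |lastCoord x| ≤ |lastCoord y| → u y ≤ u x

lemma lastCoord_eq (hN : 3 ≤ N) (x : EE N) : lastCoord x = x ⟨N - 1, by omega⟩ := by
  unfold lastCoord; rw [dif_pos (by omega)]

lemma lastCoord_cont (hN : 3 ≤ N) : Continuous (lastCoord : EE N → ℝ) := by
  have : (lastCoord : EE N → ℝ) = fun x => x ⟨N - 1, by omega⟩ := funext (lastCoord_eq hN)
  rw [this]; fun_prop

lemma lastCoord_le (hN : 3 ≤ N) (x : EE N) : |lastCoord x| ≤ ‖x‖ := by
  rw [lastCoord_eq hN]; exact PiLp.norm_apply_le x _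

/-- meridian point -/
noncomputable def mer (N : ℕ) (hN : 3 ≤ N) (r θ : ℝ) : EE N :=
  (r * Real.cos θ) • EuclideanSpace.single (⟨0, by omega⟩ : Fin N) (1:ℝ) +
    (r * Real.sin θ) • EuclideanSpace.single (⟨N - 1, by omega⟩ : Fin N) (1:ℝ)

lemma mer_last (hN : 3 ≤ N) (r θ : ℝ) : lastCoord (mer N hN r θ) = r * Real.sin θ := by
  rw [lastCoord_eq hN]
  have : (⟨N - 1, by omega⟩ : Fin N) ≠ ⟨0, by omega⟩ := by
    intro h; have := congrArg Fin.val h; simp at this; omega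
  simp [mer, this]

lemma mer_norm (hN : 3 ≤ N) {r : ℝ} (hr : 0 ≤ r) (θ : ℝ) : ‖mer N hN r θ‖ = r := by
  have hne : (⟨N - 1, by omega⟩ : Fin N) ≠ ⟨0, by omega⟩ := by
    intro h; have := congrArg Fin.val h; simp at this; omega
  have : ‖mer N hN r θ‖ ^ 2 = r ^ 2 := by
    unfold mer
    rw [norm_add_sq_real, norm_smul, norm_smul, inner_smul_left, inner_smul_right]
    have h0 : inner ℝ (EuclideanSpace.single (⟨0, by omega⟩ : Fin N) (1:ℝ))
      (EuclideanSpace.single (⟨N - 1, by omega⟩ : Fin N) (1:ℝ)) = 0 := by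
      simp [EuclideanSpace.inner_single_left, hne.symm]
    rw [h0]
    simp only [PiLp.norm_single, norm_one, mul_one, mul_zero, add_zero, Real.norm_eq_abs, sq_abs]
    have := Real.sin_sq_add_cos_sq θ
    linear_combination r ^ 2 * this
  exact (pow_left_inj₀ (norm_nonneg _) hr two_ne_zero).1 this

lemma Khat_iff (hN : 3 ≤ N) (hR₀ : 0 < R₀) (hR : R₀ < R₁) (u : EE N → ℝ) :
    memKhat N R₀ R₁ u ↔ ContDiffOn ℝ 1 u (closure (annulus N R₀ R₁)) ∧
      (∀ x ∈ closure (annulus N R₀ R₁), 0 ≤ u x) ∧ PP N R₀ R₁ u := by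
  have hcl : ∀ y : EE N, y ∈ closure (annulus N R₀ R₁) ↔ R₀ ≤ ‖y‖ ∧ ‖y‖ ≤ R₁ := fun y => by
    rw [closure_annulus hR₀ hR]; rfl
  unfold memKhat
  refine and_congr_right fun h1 => and_congr_right fun h2 => ?_
  constructor
  · rintro ⟨𝔲, hs, he, ha⟩ x hx y hy hxy hl
    have key : ∀ z ∈ closure (annulus N R₀ R₁), u z = 𝔲 ‖z‖ (Real.arcsin (|lastCoord z| / ‖z‖)) := by
      intro z hz
      rw [hs z hz]
      unfold angleOf
      rcases le_total 0 (lastCoord z) with h | h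
      · rw [abs_of_nonneg h]
      · rw [abs_of_nonpos h, neg_div, Real.arcsin_neg]
        exact (he _ ((hcl z).1 hz) _ (Real.arcsin_mem_Icc _)).symm
    have hxp := norm_pos_iff.2 (ne_zero_of_closure hR₀ hR hx)
    rw [key x hx, key y hy, ← hxy]
    refine ha _ ((hcl x).1 hx) ?_ ?_ ?_
    · exact ⟨Real.arcsin_nonneg.2 (by positivity), Real.arcsin_le_pi_div_two _⟩
    · exact ⟨Real.arcsin_nonneg.2 (by positivity), Real.arcsin_le_pi_div_two _⟩
    · exact Real.monotone_arcsin (by gcongr)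
  · intro hP
    have hm : ∀ r ∈ Icc R₀ R₁, ∀ θ, mer N hN r θ ∈ closure (annulus N R₀ R₁) := by
      intro r hr θ
      rw [hcl, mer_norm hN (hR₀.le.trans hr.1)]; exact hr
    refine ⟨fun r θ => u (mer N hN r θ), ?_, ?_, ?_⟩
    · intro x hx
      have hx' := (hcl x).1 hx
      have hxp := norm_pos_iff.2 (ne_zero_of_closure hR₀ hR hx)
      have hn : ‖mer N hN ‖x‖ (angleOf x)‖ = ‖x‖ := mer_norm hN (norm_nonneg _) _
      have hl : lastCoord (mer N hN ‖x‖ (angleOf x)) = lastCoord x := by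
        rw [mer_last]
        unfold angleOf
        have := abs_le.1 (lastCoord_le hN x)
        rw [Real.sin_arcsin]
        · field_simp
        · rw [le_div_iff₀ hxp]; linarith
        · rw [div_le_iff₀ hxp]; linarith
      exact le_antisymm (hP _ (hm _ hx' _) _ hx hn (by rw [hl])) (hP _ hx _ (hm _ hx' _) hn.symm (by rw [hl]))
    · intro r hr θ _
      have hr0 := hR₀.le.trans hr.1
      have e : |lastCoord (mer N hN r (-θ))| = |lastCoord (mer N hN r θ)| := by
        rw [mer_last, mer_last, Real.sin_neg, mul_neg, abs_neg]
      have hn : ‖mer N hN r (-θ)‖ = ‖mer N hN r θ‖ := by rw [mer_norm hN hr0, mer_norm hN hr0]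
      exact le_antisymm (hP _ (hm _ hr _) _ (hm _ hr _) hn.symm e.ge) (hP _ (hm _ hr _) _ (hm _ hr _) hn e.le)
    · intro r hr θ hθ θ' hθ' hle
      have hr0 := hR₀.le.trans hr.1
      refine hP _ (hm _ hr _) _ (hm _ hr _) (by rw [mer_norm hN hr0, mer_norm hN hr0]) ?_
      rw [mer_last, mer_last]
      have h1 : 0 ≤ Real.sin θ := Real.sin_nonneg_of_nonneg_of_le_pi hθ.1 (by linarith [hθ.2, Real.pi_pos])
      have h2 : Real.sin θ ≤ Real.sin θ' := Real.sin_le_sin_of_le_of_le_pi_div_two (by linarith [hθ.1, Real.pi_pos]) hθ'.2 hle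
      rw [abs_of_nonneg (by positivity), abs_of_nonneg (mul_nonneg hr0 (h1.trans h2))]
      gcongr

lemma isom_annulus (σ : EE N ≃ₗᵢ[ℝ] EE N) : σ ⁻¹' (annulus N R₀ R₁) = annulus N R₀ R₁ := by
  ext x; simp [annulus]

lemma isom_closure (hR₀ : 0 < R₀) (hR : R₀ < R₁) (σ : EE N ≃ₗᵢ[ℝ] EE N) {x : EE N}
    (hx : x ∈ closure (annulus N R₀ R₁)) : σ x ∈ closure (annulus N R₀ R₁) := by
  rw [closure_annulus hR₀ hR] at hx ⊢
  simpa using hx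

lemma mem_or_bd (hR₀ : 0 < R₀) (hR : R₀ < R₁) {x : EE N} (hx : x ∈ closure (annulus N R₀ R₁)) :
    x ∈ annulus N R₀ R₁ ∨ (‖x‖ = R₀ ∨ ‖x‖ = R₁) := by
  by_cases h : x ∈ annulus N R₀ R₁
  · exact Or.inl h
  · right
    apply frontier_annulus hR₀ hR
    rw [isOpen_annulus.frontier_eq]; exact ⟨hx, h⟩

lemma T_symm (hR₀ : 0 < R₀) (hR : R₀ < R₁) {f v : EE N → ℝ} (h : IsT N R₀ R₁ f v)
    (hP : PP N R₀ R₁ f) (σ : EE N ≃ₗᵢ[ℝ] EE N) (hσ : ∀ z, |lastCoord (σ z)| = |lastCoord z|)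
    {x : EE N} (hx : x ∈ closure (annulus N R₀ R₁)) : v (σ x) = v x := by
  have hws := h.ws.comp_isom σ
  rw [isom_annulus] at hws
  have hf : ∀ x ∈ annulus N R₀ R₁, f x = f (σ x) := fun x hx =>
    le_antisymm (hP _ (isom_closure hR₀ hR σ (subset_closure hx)) _ (subset_closure hx) (by simp) (hσ x).le)
      (hP _ (subset_closure hx) _ (isom_closure hR₀ hR σ (subset_closure hx)) (by simp) (hσ x).ge)
  have hws2 := hws.congr isOpen_annulus hf (fun x _ => rfl)
  have hc := (h.c1' hR₀ hR).continuousOn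
  have hu := ws_unique isOpen_annulus bounded_annulus hws2 h.ws
    (hc.comp σ.continuous.continuousOn fun x hx => isom_closure hR₀ hR σ hx) hc
    (fun x hx => by
      have := frontier_annulus hR₀ hR hx
      rw [h.bd x this, h.bd (σ x) (by simpa using this)])
  rcases mem_or_bd hR₀ hR hx with h1 | h1
  · exact hu x h1
  · rw [h.bd x h1, h.bd (σ x) (by simpa using h1)]

/-- the reflection exchanging `x` and `y` -/
noncomputable def refl2 (x y : EE N) : EE N ≃ₗᵢ[ℝ] EE N := (ℝ ∙ (x - y))ᗮ.reflection

lemma refl2_apply (x y : EE N) (z : EE N) :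
    ∃ c : ℝ, refl2 x y z = z - c • (x - y) := by
  refine ⟨2 * (inner ℝ (x - y) z / ‖x - y‖ ^ 2), ?_⟩
  unfold refl2
  rw [Submodule.reflection_orthogonal_apply, Submodule.reflection_singleton_apply]
  simp only [RCLike.ofReal_real_eq_id, id_eq]
  rw [neg_sub, two_smul, ← add_smul, two_mul]

lemma refl2_swap {x y : EE N} (h : ‖x‖ = ‖y‖) : refl2 x y x = y := by
  unfold refl2
  exact Submodule.reflection_sub h

lemma lastCoord_sub_smul (hN : 3 ≤ N) (z d : EE N) (c : ℝ) :
    lastCoord (z - c • d) = lastCoord z - c * lastCoord d := by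
  simp [lastCoord_eq hN]

lemma T_PP (hN : 3 ≤ N) (hR₀ : 0 < R₀) (hR : R₀ < R₁) {f v : EE N → ℝ} (h : IsT N R₀ R₁ f v)
    (hP : PP N R₀ R₁ f) : PP N R₀ R₁ v := by
  have s1 : ∀ x ∈ closure (annulus N R₀ R₁), ∀ y, ‖x‖ = ‖y‖ → lastCoord x = lastCoord y → v x = v y := by
    intro x hx y hn hl
    have := T_symm hR₀ hR h hP (refl2 x y) (fun z => by
      obtain ⟨c, hc⟩ := refl2_apply x y z
      have : lastCoord (x - y) = 0 := by
        have := lastCoord_sub_smul hN x y 1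
        rw [one_smul] at this
        rw [this, hl]; ring
      rw [hc, lastCoord_sub_smul hN, this, mul_zero, sub_zero]) hx
    rw [refl2_swap hn] at this
    exact this.symm
  have s2 : ∀ x ∈ closure (annulus N R₀ R₁), ∀ y, ‖x‖ = ‖y‖ → |lastCoord x| = |lastCoord y| → v x = v y := by
    intro x hx y hn hl
    rcases abs_eq_abs.1 hl with h1 | h1
    · exact s1 x hx y hn h1
    · set e : EE N := EuclideanSpace.single (⟨N - 1, by omega⟩ : Fin N) (1:ℝ) with he
      set ρ : EE N ≃ₗᵢ[ℝ] EE N := (ℝ ∙ e)ᗮ.reflection with hρ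
      have hne : ‖e‖ = 1 := by simp [he]
      have hl' : ∀ z, lastCoord (ρ z) = - lastCoord z := by
        intro z
        rw [hρ, Submodule.reflection_orthogonal_apply, Submodule.reflection_singleton_apply, hne]
        simp [lastCoord_eq hN, he, EuclideanSpace.inner_single_left]
        ring
      have h3 := T_symm hR₀ hR h hP ρ (fun z => by rw [hl', abs_neg]) hx
      rw [← h3]
      exact s1 (ρ x) (isom_closure hR₀ hR ρ hx) y (by simpa using hn) (by rw [hl', h1, neg_neg])
  intro x hx y hy hn hl
  rcases hl.eq_or_lt with hl | hl
  · exact (s2 x hx y hn hl).ge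
  rcases mem_or_bd hR₀ hR hx with hxA | hxb
  swap
  · rw [h.bd x hxb, h.bd y (by rw [← hn]; exact hxb)]
  set σ := refl2 x y with hσ
  set Q : Set (EE N) := annulus N R₀ R₁ ∩ {z | |lastCoord z| < |lastCoord (σ z)|} with hQ
  have hlc := lastCoord_cont hN
  have hQo : IsOpen Q := isOpen_annulus.inter (isOpen_lt hlc.abs (hlc.comp σ.continuous).abs)
  have hQA : Q ⊆ annulus N R₀ R₁ := inter_subset_left
  have hQc : closure Q ⊆ closure (annulus N R₀ R₁) := closure_mono hQA
  have hc := (h.c1' hR₀ hR).continuousOn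
  have hws := h.ws.comp_isom σ
  rw [isom_annulus] at hws
  have hw := (h.ws.sub_mul isOpen_annulus hws 1).mono hQA
  have := max_principle hQo (bounded_annulus.subset hQA) ?_ hw ?_ ?_ x ⟨hxA, ?_⟩
  · simp only [one_mul] at this
    rw [hσ, refl2_swap hn] at this
    linarith
  · refine ContinuousOn.mono ?_ hQc
    exact hc.sub (continuousOn_const.mul (hc.comp σ.continuous.continuousOn fun x hx => isom_closure hR₀ hR σ hx))
  · intro z hz
    have := hP z (subset_closure hz.1) (σ z) (isom_closure hR₀ hR σ (subset_closure hz.1)) (by simp) hz.2.le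
    simp only [one_mul]; linarith
  · intro z hz
    rw [hQo.frontier_eq] at hz
    have hzA := hQc hz.1
    rcases mem_or_bd hR₀ hR hzA with h1 | h1
    · have hle : |lastCoord z| ≤ |lastCoord (σ z)| := by
        have : closure Q ⊆ {z | |lastCoord z| ≤ |lastCoord (σ z)|} :=
          closure_minimal (fun z hz => (show |lastCoord z| ≤ |lastCoord (σ z)| from le_of_lt hz.2)) (isClosed_le hlc.abs (hlc.comp σ.continuous).abs)
        exact this hz.1
      have hge : |lastCoord (σ z)| ≤ |lastCoord z| := by
        by_contra hcon
        push Not at hcon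
        exact hz.2 ⟨h1, hcon⟩
      have := s2 z hzA (σ z) (by simp) (le_antisymm hle hge)
      rw [this]; simp
    · rw [h.bd z h1, h.bd (σ z) (by simpa using h1)]; simp
  · show |lastCoord x| < |lastCoord (σ x)|
    rw [hσ, refl2_swap hn]; exact hl

lemma T_nonneg (hR₀ : 0 < R₀) (hR : R₀ < R₁) {f v : EE N → ℝ} (h : IsT N R₀ R₁ f v)
    (hf : ∀ x ∈ closure (annulus N R₀ R₁), 0 ≤ f x) : ∀ x ∈ closure (annulus N R₀ R₁), 0 ≤ v x := by
  intro x hx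
  rcases mem_or_bd hR₀ hR hx with h1 | h1
  · exact max_principle isOpen_annulus bounded_annulus (h.c1' hR₀ hR).continuousOn h.ws
      (fun x hx => hf x (subset_closure hx)) (fun x hx => (h.bd x (frontier_annulus hR₀ hR hx)).ge) x h1
  · exact (h.bd x h1).ge

lemma T_memK (hN : 3 ≤ N) (hR₀ : 0 < R₀) (hR : R₀ < R₁) {f v : EE N → ℝ} (h : IsT N R₀ R₁ f v)
    (hf : ∀ x ∈ closure (annulus N R₀ R₁), 0 ≤ f x) (hP : PP N R₀ R₁ f) : memK N R₀ R₁ v :=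
  ⟨(Khat_iff hN hR₀ hR v).2 ⟨h.c1' hR₀ hR, T_nonneg hR₀ hR h hf, T_PP hN hR₀ hR h hP⟩, h.bd⟩

end Cone


section SMP
variable {N : ℕ} {R₀ R₁ : ℝ}

/-- Gaussian barrier -/
noncomputable def gE (α : ℝ) (x0 z : EE N) : ℝ := Real.exp (-α * ‖z - x0‖ ^ 2)

lemma gE_fderiv (α : ℝ) (x0 z : EE N) :
    HasFDerivAt (gE α x0) ((-2 * α * gE α x0 z) • innerSL ℝ (z - x0)) z := by
  have h1 : HasFDerivAt (fun z : EE N => z - x0) (ContinuousLinearMap.id ℝ (EE N)) z :=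
    (hasFDerivAt_id z).sub_const x0
  have h2 := (h1.norm_sq.const_mul (-α)).exp
  refine h2.congr_fderiv ?_
  ext v
  simp [gE]
  ring

lemma gE_contDiff (α : ℝ) (x0 : EE N) : ContDiff ℝ 1 (gE α x0) := by
  unfold gE
  exact (contDiff_const.mul ((contDiff_id.sub contDiff_const).norm_sq ℝ)).exp

lemma gE_ws (α b : ℝ) (x0 : EE N) :
    IsWS univ (fun z => (2 * α * N - 4 * α ^ 2 * ‖z - x0‖ ^ 2) * gE α x0 z + (gE α x0 z - b))
      (fun z => gE α x0 z - b) := by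
  have hE := gE_contDiff α x0
  refine ⟨?_, (hE.sub contDiff_const).contDiffOn, ?_⟩
  · have := hE.continuous
    exact Continuous.continuousOn (by fun_prop)
  intro φ h1 h2 _
  have hEc := hE.continuous
  have hg : ∀ z, gradient (fun z => gE α x0 z - b) z = (-2 * α * gE α x0 z) • (z - x0) := by
    intro z
    refine ext_inner_right ℝ fun v => ?_
    rw [inner_grad, ((gE_fderiv α x0 z).sub_const b).fderiv, inner_smul_left]
    simp [inner_sub_left]
  have hfc : ∀ i : Fin N, Continuous fun z => fderiv ℝ φ z (EuclideanSpace.single i 1) := fun i =>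
    (h1.continuous_fderiv (by simp)).clm_apply continuous_const
  have hfs : ∀ i : Fin N, HasCompactSupport fun z => fderiv ℝ φ z (EuclideanSpace.single i 1) := fun i =>
    h2.fderiv_apply ℝ _
  have key : ∀ i : Fin N, ∫ z, (-2 * α * gE α x0 z * (z i - x0 i)) * fderiv ℝ φ z (EuclideanSpace.single i 1)
      = ∫ z, ((2 * α - 4 * α ^ 2 * (z i - x0 i) ^ 2) * gE α x0 z) * φ z := by
    intro i
    have hd : ∀ z : EE N, HasFDerivAt (fun z : EE N => -2 * α * gE α x0 z * (z i - x0 i))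
        ((-2 * α * gE α x0 z) • (EuclideanSpace.proj i : EE N →L[ℝ] ℝ) +
          (z i - x0 i) • ((-2 * α) • ((-2 * α * gE α x0 z) • innerSL ℝ (z - x0)))) z := by
      intro z
      have a1 := (gE_fderiv α x0 z).const_mul (-2 * α)
      have a2 : HasFDerivAt (fun z : EE N => z i - x0 i) (EuclideanSpace.proj i : EE N →L[ℝ] ℝ) z :=
        ((EuclideanSpace.proj i : EE N →L[ℝ] ℝ).hasFDerivAt).sub_const (x0 i)
      exact a1.mul a2
    have hd' : ∀ z : EE N, fderiv ℝ (fun z : EE N => -2 * α * gE α x0 z * (z i - x0 i)) z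
        (EuclideanSpace.single i 1) = - ((2 * α - 4 * α ^ 2 * (z i - x0 i) ^ 2) * gE α x0 z) := by
      intro z
      rw [(hd z).fderiv]
      simp [EuclideanSpace.inner_single_right]
      ring
    rw [integral_mul_fderiv_eq_neg_fderiv_mul_of_integrable]
    · simp_rw [hd']
      rw [← integral_neg]
      congr 1; ext z; ring
    · simp_rw [hd']
      refine Continuous.integrable_of_hasCompactSupport ?_ h2.mul_left
      have := h1.continuous
      fun_prop
    · refine Continuous.integrable_of_hasCompactSupport ?_ (hfs i).mul_left
      have := hfc i
      fun_prop
    · refine Continuous.integrable_of_hasCompactSupport ?_ h2.mul_left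
      have := h1.continuous
      fun_prop
    · exact fun z _ => (hd z).differentiableAt
    · exact fun z _ => h1.differentiable (by simp) z
  have e1 : ∀ z, inner ℝ (gradient (fun z => gE α x0 z - b) z) (gradient φ z) =
      ∑ i : Fin N, (-2 * α * gE α x0 z * (z i - x0 i)) * fderiv ℝ φ z (EuclideanSpace.single i 1) := by
    intro z
    rw [hg, real_inner_comm, inner_grad]
    have : (-2 * α * gE α x0 z) • (z - x0) =
        ∑ i : Fin N, (-2 * α * gE α x0 z * (z i - x0 i)) • EuclideanSpace.single i (1:ℝ) := by
      ext j
      simp [Pi.single_apply]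
    rw [this, map_sum]
    simp
  have i1 : ∀ i : Fin N, Integrable fun z : EE N =>
      (-2 * α * gE α x0 z * (z i - x0 i)) * fderiv ℝ φ z (EuclideanSpace.single i 1) := by
    intro i
    refine Continuous.integrable_of_hasCompactSupport ?_ (hfs i).mul_left
    have := hfc i
    fun_prop
  have i2 : ∀ i : Fin N, Integrable fun z : EE N =>
      ((2 * α - 4 * α ^ 2 * (z i - x0 i) ^ 2) * gE α x0 z) * φ z := by
    intro i
    refine Continuous.integrable_of_hasCompactSupport ?_ h2.mul_left
    have := h1.continuous
    fun_prop
  have i3 : Integrable fun z : EE N => (gE α x0 z - b) * φ z := by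
    refine Continuous.integrable_of_hasCompactSupport ?_ h2.mul_left
    have := h1.continuous
    fun_prop
  simp_rw [e1]
  rw [integral_add (integrable_finsetSum _ fun i _ => i1 i) i3, integral_finsetSum _ fun i _ => i1 i]
  simp_rw [key]
  rw [← integral_finsetSum _ fun i _ => i2 i, ← integral_add (integrable_finsetSum _ fun i _ => i2 i) i3]
  congr 1; ext z
  have hs : ‖z - x0‖ ^ 2 = ∑ i : Fin N, (z i - x0 i) ^ 2 := by
    rw [EuclideanSpace.real_norm_sq_eq]; simp
  have hs2 : ∑ i : Fin N, (2 * α - 4 * α ^ 2 * (z i - x0 i) ^ 2) =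
      2 * α * N - 4 * α ^ 2 * ‖z - x0‖ ^ 2 := by
    rw [hs, Finset.mul_sum, Finset.sum_sub_distrib]
    simp
    ring
  rw [← Finset.sum_mul, ← Finset.sum_mul, hs2]
  ring

lemma smp_ball {A : Set (EE N)} (hA : IsOpen A) {f u : EE N → ℝ} (hu : IsWS A f u)
    (hf : ∀ x ∈ A, 0 ≤ f x) (h0 : ∀ x ∈ A, 0 ≤ u x) {x0 : EE N} {ρ : ℝ}
    (hρ : Metric.closedBall x0 ρ ⊆ A) (hx0 : 0 < u x0) : ∀ x ∈ Metric.ball x0 ρ, 0 < u x := by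
  intro x hx
  have hρ0 : 0 < ρ := by
    rw [Metric.mem_ball] at hx; exact dist_nonneg.trans_lt hx
  have hx0A : x0 ∈ A := hρ (Metric.mem_closedBall_self hρ0.le)
  have hcont := hu.cv.continuousOn
  have hca : ContinuousAt u x0 := hcont.continuousAt (hA.mem_nhds hx0A)
  set m := u x0 / 2 with hm
  have hmp : 0 < m := half_pos hx0
  obtain ⟨δ0, hδ0, hδ⟩ := Metric.eventually_nhds_iff.1 (hca.eventually (lt_mem_nhds (show m < u x0 by rw [hm]; linarith)))
  set δ := min (δ0 / 2) (ρ / 2) with hδdef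
  have hδp : 0 < δ := lt_min (by positivity) (by positivity)
  have hδ1 : δ < δ0 := (min_le_left _ _).trans_lt (by linarith)
  have hδρ : δ < ρ := (min_le_right _ _).trans_lt (by linarith)
  by_cases hxδ : dist x x0 ≤ δ
  · exact hmp.trans (hδ (hxδ.trans_lt hδ1))
  push Not at hxδ
  obtain ⟨α, hα0, hα⟩ : ∃ α : ℝ, 0 < α ∧ 2 * α * N - 4 * α ^ 2 * δ ^ 2 + 1 ≤ 0 := by
    refine ⟨((N:ℝ) + 1) / δ ^ 2 + 1, by positivity, ?_⟩
    set α := ((N:ℝ) + 1) / δ ^ 2 + 1 with hαd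
    have h1 : 1 ≤ α := by rw [hαd]; have : 0 ≤ ((N:ℝ) + 1) / δ ^ 2 := by positivity
                          linarith
    have h2 : (N:ℝ) + 1 ≤ α * δ ^ 2 := by
      rw [hαd, add_mul, div_mul_cancel₀ _ (by positivity)]
      have : 0 < δ ^ 2 := by positivity
      linarith
    have hNn : (0:ℝ) ≤ N := by positivity
    nlinarith [mul_le_mul_of_nonneg_left h2 (by linarith : 0 ≤ α)]
  set b := Real.exp (-α * ρ ^ 2) with hb
  set D := Metric.ball x0 ρ ∩ (Metric.closedBall x0 δ)ᶜ with hD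
  have hDo : IsOpen D := Metric.isOpen_ball.inter Metric.isClosed_closedBall.isOpen_compl
  have hDA : D ⊆ A := fun z hz => hρ (Metric.ball_subset_closedBall hz.1)
  have hDc : closure D ⊆ Metric.closedBall x0 ρ :=
    closure_minimal (fun z hz => Metric.ball_subset_closedBall hz.1) Metric.isClosed_closedBall
  have hw := (hu.mono hDA).sub_mul hDo ((gE_ws α b x0).mono (subset_univ D)) m
  have hexp1 : ∀ z, gE α x0 z ≤ 1 := fun z => by
    unfold gE; exact Real.exp_le_one_iff.2 (by nlinarith [mul_nonneg hα0.le (sq_nonneg ‖z - x0‖)])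
  have hexpp : ∀ z, 0 < gE α x0 z := fun z => Real.exp_pos _
  have hbp : 0 < b := Real.exp_pos _
  have := max_principle hDo (Metric.isBounded_ball.subset inter_subset_left) ?_ hw ?_ ?_ x ⟨hx, ?_⟩
  · have hlt : b < gE α x0 x := by
      unfold gE
      rw [hb]
      apply Real.exp_lt_exp.2
      rw [mem_ball_iff_norm] at hx
      have : ‖x - x0‖ ^ 2 < ρ ^ 2 := by gcongr
      nlinarith
    have : 0 < m * (gE α x0 x - b) := mul_pos hmp (by linarith)
    linarith
  · refine ContinuousOn.mono ?_ (hDc.trans hρ)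
    exact hcont.sub (Continuous.continuousOn (by have := (gE_contDiff α x0).continuous; fun_prop))
  · intro z hz
    have h1 : δ ^ 2 ≤ ‖z - x0‖ ^ 2 := by
      have : δ < ‖z - x0‖ := by
        have := hz.2
        rw [mem_compl_iff, Metric.mem_closedBall, dist_eq_norm] at this
        push Not at this; exact this
      gcongr
    have h2 : (2 * α * N - 4 * α ^ 2 * ‖z - x0‖ ^ 2) * gE α x0 z + (gE α x0 z - b) ≤ 0 := by
      have h3 : 2 * α * N - 4 * α ^ 2 * ‖z - x0‖ ^ 2 + 1 ≤ 0 := by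
        have : 4 * α ^ 2 * δ ^ 2 ≤ 4 * α ^ 2 * ‖z - x0‖ ^ 2 := by gcongr
        linarith
      nlinarith [mul_nonpos_of_nonpos_of_nonneg h3 (hexpp z).le]
    have h4 := hf z (hDA hz)
    nlinarith [mul_nonneg hmp.le (neg_nonneg.2 h2)]
  · intro z hz
    rw [hDo.frontier_eq] at hz
    have hzρ := hDc hz.1
    by_cases h1 : dist z x0 ≤ δ
    · have h2 : m < u z := hδ (h1.trans_lt hδ1)
      have h3 : m * (gE α x0 z - b) ≤ m * 1 := by
        gcongr; linarith [hexp1 z]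
      linarith
    · have h3 : ¬ dist z x0 < ρ := fun h => hz.2 ⟨h, h1⟩
      have h4 : ‖z - x0‖ = ρ := by
        rw [← dist_eq_norm]; exact le_antisymm hzρ (not_lt.1 h3)
      have h5 : gE α x0 z = b := by unfold gE; rw [h4]
      rw [h5]
      have := h0 z (hρ hzρ)
      linarith
  · rw [mem_compl_iff, Metric.mem_closedBall]; push Not; exact hxδ

lemma smp {A : Set (EE N)} (hA : IsOpen A) (hc : IsPreconnected A) {f u : EE N → ℝ} (hu : IsWS A f u)
    (hf : ∀ x ∈ A, 0 ≤ f x) (h0 : ∀ x ∈ A, 0 ≤ u x) {x0 : EE N} (hx0A : x0 ∈ A) (hx0 : 0 < u x0) :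
    ∀ x ∈ A, 0 < u x := by
  have hcont := hu.cv.continuousOn
  set U := A ∩ u ⁻¹' (Ioi 0) with hU
  have hUo : IsOpen U := hcont.isOpen_inter_preimage hA isOpen_Ioi
  have : A ⊆ U := by
    refine hc.subset_of_closure_inter_subset hUo ⟨x0, hx0A, hx0A, hx0⟩ ?_
    rintro x ⟨hx, hxA⟩
    refine ⟨hxA, ?_⟩
    obtain ⟨ρ, hρ, hsub⟩ := Metric.isOpen_iff.1 hA x hxA
    obtain ⟨y, hy, hd⟩ := Metric.mem_closure_iff.1 hx (ρ / 3) (by positivity)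
    refine smp_ball hA hu hf h0 (x0 := y) (ρ := ρ / 2) ?_ hy.2 x ?_
    · intro z hz
      apply hsub
      rw [Metric.mem_closedBall] at hz
      rw [Metric.mem_ball]
      have := dist_triangle z y x
      rw [dist_comm y x] at this
      linarith
    · rw [Metric.mem_ball]; linarith
  exact fun x hx => (this hx).2

end SMP


section SupB
variable {N : ℕ} {R₀ R₁ : ℝ}

lemma young_ker (hN : 3 ≤ N) {d f : ℝ} (hd : 0 ≤ d) (hf : 0 ≤ f) :
    d ^ (-((N:ℝ) - 2)) * f ≤ d ^ (-((N:ℝ) - 1)) + f ^ (N - 1) := by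
  have hN' : (3:ℝ) ≤ N := by exact_mod_cast hN
  have h1 : 0 ≤ d ^ (-((N:ℝ) - 1)) := rpow_nonneg hd _
  have h2 : 0 ≤ f ^ (N - 1) := pow_nonneg hf _
  rcases hd.eq_or_lt with rfl | hd
  · rw [zero_rpow (by linarith), zero_mul]; positivity
  by_cases h : f ≤ d⁻¹
  · calc d ^ (-((N:ℝ) - 2)) * f ≤ d ^ (-((N:ℝ) - 2)) * d⁻¹ := by gcongr
      _ = d ^ (-((N:ℝ) - 1)) := by
          rw [← rpow_neg_one, ← rpow_add hd]; congr 1; ring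
      _ ≤ _ := by linarith
  · push Not at h
    calc d ^ (-((N:ℝ) - 2)) * f = (d⁻¹) ^ (N - 2) * f := by
          rw [← rpow_natCast, inv_rpow hd.le, ← rpow_neg hd.le, Nat.cast_sub (by omega)]; norm_num
      _ ≤ f ^ (N - 2) * f := by gcongr
      _ = f ^ (N - 1) := by rw [← pow_succ]; congr 1; omega
      _ ≤ _ := by linarith

lemma ind_bound (hR₀ : 0 < R₀) (hR : R₀ < R₁) {f : EE N → ℝ} {B : ℝ} (hB0 : 0 ≤ B)
    (hB : ∀ y ∈ annulus N R₀ R₁, |f y| ≤ B) (y : EE N) :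
    |(annulus N R₀ R₁).indicator f y| ≤ (R₁ ^ (((N:ℝ) + 2) / 2) * B) * WW N y := by
  by_cases hy : y ∈ annulus N R₀ R₁
  · rw [indicator_of_mem hy]
    refine (hB y hy).trans ?_
    have h0 : 0 < ‖y‖ := hR₀.trans hy.1
    have : 1 ≤ R₁ ^ (((N:ℝ) + 2) / 2) * WW N y := by
      unfold WW
      rw [rpow_neg h0.le, ← div_eq_mul_inv, one_le_div (by positivity)]
      exact rpow_le_rpow h0.le hy.2.le (by positivity)
    nlinarith
  · rw [indicator_of_notMem hy, abs_zero]
    have := R1pow_nonneg (N := N) hR₀ hR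
    have := WW_nonneg y
    positivity

lemma ind_meas {f : EE N → ℝ} (hf : ContinuousOn f (closure (annulus N R₀ R₁))) :
    Measurable ((annulus N R₀ R₁).indicator f) := by
  classical
  rw [← piecewise_eq_indicator]
  exact (hf.mono subset_closure).measurable_piecewise continuousOn_const isOpen_annulus.measurableSet

lemma T_le_pot (hN : 3 ≤ N) (hR₀ : 0 < R₀) (hR : R₀ < R₁) {f v : EE N → ℝ}
    (h : IsT N R₀ R₁ f v) (hf : ∀ x ∈ closure (annulus N R₀ R₁), 0 ≤ f x) :
    ∀ x ∈ annulus N R₀ R₁, v x ≤ Pot N ((annulus N R₀ R₁).indicator f) x := by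
  obtain ⟨B, hB0, hB⟩ := ex_bound h.cf
  set F := (annulus N R₀ R₁).indicator f with hF
  have hA := isOpen_annulus (N := N) (R₀ := R₀) (R₁ := R₁)
  have hB1 : 0 ≤ R₁ ^ (((N:ℝ) + 2) / 2) * B := mul_nonneg (R1pow_nonneg hR₀ hR) hB0
  have hFb := ind_bound hR₀ hR hB0 (fun y hy => hB y (subset_closure hy))
  have hFm := ind_meas h.cf
  have hF0 : ∀ y, 0 ≤ F y := fun y => indicator_nonneg (fun z hz => hf z (subset_closure hz)) y
  have hN' : (3:ℝ) ≤ N := by exact_mod_cast hN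
  have hP0 : ∀ x, 0 ≤ Pot N F x := by
    intro x
    unfold Pot
    have := sig_pos hN
    refine mul_nonneg (by have : (0:ℝ) < N - 2 := by linarith
                          positivity) (integral_nonneg fun y => mul_nonneg (rpow_nonneg (norm_nonneg _) _) (hF0 y))
  have hPc := pot_contDiffOn hN hB1 hFm hFb
  have hsub : closure (annulus N R₀ R₁) ⊆ {x : EE N | x ≠ 0} := fun x hx => ne_zero_of_closure hR₀ hR hx
  have hws : IsWS (annulus N R₀ R₁) (fun x => f x + Pot N F x) (Pot N F) := by
    have hc := hPc.mono (subset_closure.trans hsub)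
    have hfA := h.cf.mono subset_closure
    refine ⟨hfA.add hc.continuousOn, hc, fun φ h1 h2 h3 => ?_⟩
    have i1 := (int_grad hA h1 h2 h3 hc).2
    have i2 := (int_mul hA h1.continuous h2 h3 hc.continuousOn).2
    have i3 := (int_mul hA h1.continuous h2 h3 hfA).2
    have h0 : (0 : EE N) ∉ tsupport φ := fun h0 => by
      have := (h3 h0).1; rw [norm_zero] at this; linarith
    have hw := pot_weak hN hB1 hFm hFb h1 h2 h0
    rw [integral_add i1 i2]
    have e : (∫ x, inner ℝ (gradient (Pot N F) x) (gradient φ x)) = ∫ x, f x * φ x := by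
      rw [show (∫ x, f x * φ x) = ∫ x, F x * φ x from ?_, ← hw]
      · refine integral_congr_ae ?_
        have : Nonempty (Fin N) := ⟨⟨0, by omega⟩⟩
        have : ∀ᵐ x : EE N, x ≠ 0 := by
          rw [ae_iff]; simp
        filter_upwards [this] with x hx
        rw [inner_grad, (pot_hasFDerivAt hN hB1 hFm hFb hx).fderiv]; rfl
      · congr 1; ext x
        by_cases hx : x ∈ annulus N R₀ R₁
        · rw [hF, indicator_of_mem hx]
        · rw [image_eq_zero_of_notMem_tsupport (fun hh => hx (h3 hh))]; simp
    rw [e, ← integral_add i3 i2]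
    congr 1; ext x; ring
  have hd := IsWS.sub_mul hA hws h.ws 1
  have hcl : ContinuousOn v (closure (annulus N R₀ R₁)) := (h.c1.mono hsub).continuousOn
  have := max_principle hA bounded_annulus (w := fun x => Pot N F x - 1 * v x)
    (((hPc.mono hsub).continuousOn).sub (continuousOn_const.mul hcl)) hd
    (fun x hx => by have := hP0 x; linarith)
    (fun x hx => by rw [h.bd x (frontier_annulus hR₀ hR hx)]; have := hP0 x; linarith)
  intro x hx
  have := this x hx
  linarith

lemma sup_bound (hN : 3 ≤ N) (hR₀ : 0 < R₀) (hR : R₀ < R₁) : ∃ C : ℝ, 0 ≤ C ∧ ∀ f v : EE N → ℝ,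
    IsT N R₀ R₁ f v → (∀ x ∈ closure (annulus N R₀ R₁), 0 ≤ f x) →
    ∀ x ∈ closure (annulus N R₀ R₁), v x ≤ C * (1 + ∫ x in annulus N R₀ R₁, f x ^ (N - 1)) := by
  obtain ⟨C, hC0, hC⟩ := pot_bounds hN (ρ0 := R₀) (ρ1 := R₁) hR₀
  have hσ := sig_pos hN
  have hN' : (3:ℝ) ≤ N := by exact_mod_cast hN
  have hs0 : 0 ≤ 1 / (((N:ℝ) - 2) * sig N) := by
    have : (0:ℝ) < N - 2 := by linarith
    positivity
  set s := 1 / (((N:ℝ) - 2) * sig N) with hs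
  have hR1 := R1pow_nonneg (N := N) hR₀ hR
  set E := R₁ ^ (((N:ℝ) + 2) / 2) with hE
  refine ⟨s * (C * E + 1), by positivity, fun f v h hf x hx => ?_⟩
  have hI : 0 ≤ ∫ x in annulus N R₀ R₁, f x ^ (N - 1) :=
    setIntegral_nonneg isOpen_annulus.measurableSet fun x hx => pow_nonneg (hf x (subset_closure hx)) _
  rcases mem_or_bd hR₀ hR hx with hxA | hb
  swap
  · rw [h.bd x hb]; positivity
  refine (T_le_pot hN hR₀ hR h hf x hxA).trans ?_
  obtain ⟨B, hB0, hB⟩ := ex_bound h.cf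
  have hFb := ind_bound hR₀ hR hB0 (fun y hy => hB y (subset_closure hy))
  have hFm := ind_meas h.cf
  have hx0 : x ≠ 0 := ne_zero_of_closure hR₀ hR hx
  have h1b : ∀ y, |(annulus N R₀ R₁).indicator (fun _ => (1:ℝ)) y| ≤ (E * 1) * WW N y :=
    ind_bound hR₀ hR zero_le_one (fun y hy => by simp)
  have h1m : Measurable ((annulus N R₀ R₁).indicator (fun _ => (1:ℝ))) := ind_meas continuousOn_const
  have k1 := (ker_integrable hN hFm hFb hx0 (β := (N:ℝ) - 2) le_rfl (by linarith)).1
  have k2 := (ker_integrable hN h1m h1b hx0 (β := (N:ℝ) - 1) (by linarith) (by linarith)).1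
  have b3 := (hC (E * 1) _ (by positivity) h1m h1b x hxA.1.le hxA.2.le).2.2.1
  have i4 : Integrable ((annulus N R₀ R₁).indicator fun y => f y ^ (N - 1)) :=
    (integrable_indicator_iff isOpen_annulus.measurableSet).2 (intOn_annulus' (h.cf.pow _))
  unfold Pot
  rw [mul_assoc, ← hs]
  refine mul_le_mul_of_nonneg_left ?_ hs0
  have key : ∫ y, ‖x - y‖ ^ (-((N:ℝ) - 2)) * (annulus N R₀ R₁).indicator f y ≤
      ∫ y, (‖x - y‖ ^ (-((N:ℝ) - 1)) * (annulus N R₀ R₁).indicator (fun _ => (1:ℝ)) y +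
        (annulus N R₀ R₁).indicator (fun y => f y ^ (N - 1)) y) := by
    refine integral_mono k1 (k2.add i4) fun y => ?_
    by_cases hy : y ∈ annulus N R₀ R₁
    · simp only [indicator_of_mem hy, mul_one]
      exact young_ker hN (norm_nonneg _) (hf y (subset_closure hy))
    · simp [indicator_of_notMem hy]
  rw [integral_add k2 i4, integral_indicator isOpen_annulus.measurableSet] at key
  refine key.trans ?_
  have : ∫ y, ‖x - y‖ ^ (-((N:ℝ) - 1)) * (annulus N R₀ R₁).indicator (fun _ => (1:ℝ)) y ≤ C * (E * 1) := by
    refine le_trans (le_of_eq ?_) b3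
    congr 1; ext y
    rw [abs_of_nonneg (indicator_nonneg (fun _ _ => zero_le_one) y)]
  nlinarith [mul_nonneg hC0 hR1]
end SupB


section Sob
variable {N : ℕ} {R₀ R₁ : ℝ}

/-- reflection in the line spanned by a meridian direction -/
noncomputable def SSr (N : ℕ) (hN : 3 ≤ N) (s : ℝ) : EE N ≃ₗᵢ[ℝ] EE N :=
  (ℝ ∙ (mer N hN 1 s)).reflection

lemma SSr_apply (hN : 3 ≤ N) (s : ℝ) (x : EE N) :
    SSr N hN s x = (2 * inner ℝ (mer N hN 1 s) x) • mer N hN 1 s - x := by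
  unfold SSr
  rw [Submodule.reflection_singleton_apply, mer_norm hN zero_le_one]
  simp [two_smul, two_mul, add_smul]

lemma mer_deriv (hN : 3 ≤ N) (s : ℝ) : HasDerivAt (mer N hN 1) (mer N hN 1 (s + π / 2)) s := by
  unfold mer
  simp only [one_mul, Real.cos_add_pi_div_two, Real.sin_add_pi_div_two]
  exact ((Real.hasDerivAt_cos s).smul_const _).add ((Real.hasDerivAt_sin s).smul_const _)

lemma SSr_deriv (hN : 3 ≤ N) (s : ℝ) (x : EE N) :
    ∃ v : EE N, HasDerivAt (fun s => SSr N hN s x) v s ∧ ‖v‖ ≤ 4 * ‖x‖ := by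
  simp only [SSr_apply]
  have h1 := mer_deriv hN s
  have h2 : HasDerivAt (fun s => 2 * inner ℝ (mer N hN 1 s) x)
      (2 * inner ℝ (mer N hN 1 (s + π / 2)) x) s := by
    have := (h1.inner ℝ (hasDerivAt_const s x)).const_mul 2
    simpa using this
  refine ⟨_, (h2.smul h1).sub_const x, ?_⟩
  have a1 := abs_real_inner_le_norm (mer N hN 1 s) x
  have a2 := abs_real_inner_le_norm (mer N hN 1 (s + π / 2)) x
  rw [mer_norm hN zero_le_one, one_mul] at a1 a2
  refine (norm_add_le _ _).trans ?_
  rw [norm_smul, norm_smul, mer_norm hN zero_le_one, mer_norm hN zero_le_one, norm_mul, norm_mul]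
  simp only [Real.norm_eq_abs, abs_two]
  linarith

lemma SSr_cont (hN : 3 ≤ N) : Continuous fun q : ℝ × EE N => SSr N hN q.1 q.2 := by
  simp only [SSr_apply, mer]
  fun_prop

lemma SSr_cont1 (hN : 3 ≤ N) (x : EE N) : Continuous fun s : ℝ => SSr N hN s x := by
  simp only [SSr_apply, mer]
  fun_prop

lemma SSr_norm (hN : 3 ≤ N) (s : ℝ) (x : EE N) : ‖SSr N hN s x‖ = ‖x‖ := (SSr N hN s).norm_map x

lemma SSr_mp (hN : 3 ≤ N) (s : ℝ) : MeasurePreserving (fun x : EE N => SSr N hN s x) :=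
  (SSr N hN s).measurePreserving

lemma SSr_meas (hN : 3 ≤ N) : Measurable fun q : EE N × ℝ => SSr N hN q.2 q.1 := by
  have : Continuous fun q : EE N × ℝ => SSr N hN q.2 q.1 := by
    simp only [SSr_apply, mer]
    fun_prop
  exact this.measurable

lemma inner_mer (hN : 3 ≤ N) (s : ℝ) (x : EE N) :
    inner ℝ (mer N hN 1 s) x = Real.cos s * x ⟨0, by omega⟩ + Real.sin s * lastCoord x := by
  unfold mer
  rw [inner_add_left, inner_smul_left, inner_smul_left, lastCoord_eq hN]
  simp [EuclideanSpace.inner_single_left]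

lemma SSr_last (hN : 3 ≤ N) (s : ℝ) (x : EE N) :
    lastCoord (SSr N hN s x) = x ⟨0, by omega⟩ * Real.sin (2 * s) - lastCoord x * Real.cos (2 * s) := by
  rw [SSr_apply]
  have : lastCoord ((2 * inner ℝ (mer N hN 1 s) x) • mer N hN 1 s - x) =
      (2 * inner ℝ (mer N hN 1 s) x) * lastCoord (mer N hN 1 s) - lastCoord x := by
    simp [lastCoord_eq hN]
  rw [this, mer_last, inner_mer, Real.sin_two_mul, Real.cos_two_mul]
  have := Real.sin_sq_add_cos_sq s
  linear_combination (2 * lastCoord x) * this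

lemma SSr_hit (hN : 3 ≤ N) (x : EE N) : ∃ s ∈ Icc (-1:ℝ) 1, lastCoord (SSr N hN s x) = 0 := by
  have hc : Continuous fun s => lastCoord (SSr N hN s x) := by
    simp only [SSr_last]; fun_prop
  have h1 : lastCoord (SSr N hN (π / 4) x) = x ⟨0, by omega⟩ := by
    rw [SSr_last, show 2 * (π / 4) = π / 2 by ring]; simp
  have h2 : lastCoord (SSr N hN (-(π / 4)) x) = - x ⟨0, by omega⟩ := by
    rw [SSr_last, show 2 * (-(π / 4)) = -(π / 2) by ring]; simp
  have := intermediate_value_uIcc (a := -(π / 4)) (b := π / 4) hc.continuousOn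
  have h0 : (0:ℝ) ∈ uIcc (lastCoord (SSr N hN (-(π / 4)) x)) (lastCoord (SSr N hN (π / 4) x)) := by
    rw [h1, h2, mem_uIcc]
    rcases le_total 0 (x ⟨0, by omega⟩) with h | h
    · left; constructor <;> linarith
    · right; constructor <;> linarith
  obtain ⟨s, hs, hs'⟩ := this h0
  refine ⟨s, ?_, hs'⟩
  have hpi := Real.pi_lt_four
  rw [uIcc_of_le (by have := Real.pi_pos; linarith)] at hs
  exact ⟨by linarith [hs.1], by linarith [hs.2]⟩

attribute [irreducible] SSr

/-- the gradient density extended by zero -/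
noncomputable def gden (N : ℕ) (R₀ R₁ : ℝ) (h : EE N → ℝ) : EE N → ℝ :=
  (annulus N R₀ R₁).indicator fun x => ‖gradient h x‖

lemma gden_meas {h : EE N → ℝ} (hh : ContDiffOn ℝ 1 h (closure (annulus N R₀ R₁))) :
    Measurable (gden N R₀ R₁ h) := by
  classical
  unfold gden
  rw [← piecewise_eq_indicator]
  exact (gradCont isOpen_annulus (hh.mono subset_closure)).norm.measurable_piecewise continuousOn_const
    isOpen_annulus.measurableSet

lemma gden_nonneg {h : EE N → ℝ} (x : EE N) : 0 ≤ gden N R₀ R₁ h x :=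
  indicator_nonneg (fun _ _ => norm_nonneg _) x

lemma gden_bdd (hR₀ : 0 < R₀) (hR : R₀ < R₁) {h : EE N → ℝ}
    (hh : ContDiffOn ℝ 1 h (closure (annulus N R₀ R₁))) : ∃ C, 0 ≤ C ∧ ∀ x, gden N R₀ R₁ h x ≤ C := by
  obtain ⟨C, h0, -, h2⟩ := c1_bdd hR₀ hR hh
  refine ⟨C, h0, fun x => ?_⟩
  unfold gden
  by_cases hx : x ∈ annulus N R₀ R₁
  · rw [indicator_of_mem hx]; exact h2 x hx
  · rw [indicator_of_notMem hx]; exact h0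

/-- one-dimensional fundamental theorem estimate along a curve inside the annulus -/
lemma curve_est (hR₀ : 0 < R₀) (hR : R₀ < R₁) {h : EE N → ℝ}
    (hh : ContDiffOn ℝ 1 h (closure (annulus N R₀ R₁))) {a b L : ℝ} (hab : a ≤ b)
    {γ : ℝ → EE N} (hγc : Continuous γ)
    (hγ : ∀ s ∈ Ioo a b, ∃ v, HasDerivAt γ v s ∧ ‖v‖ ≤ L)
    (hA : ∀ s ∈ Ioo a b, γ s ∈ annulus N R₀ R₁) (hcl : ∀ s ∈ Icc a b, γ s ∈ closure (annulus N R₀ R₁)) :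
    |h (γ b) - h (γ a)| ≤ L * ∫ s in Icc a b, gden N R₀ R₁ h (γ s) := by
  have hd : ∀ s ∈ Ioo a b, HasDerivAt (fun s => h (γ s)) (deriv (fun s => h (γ s)) s) s ∧
      |deriv (fun s => h (γ s)) s| ≤ L * gden N R₀ R₁ h (γ s) := by
    intro s hs
    obtain ⟨v, hv, hvL⟩ := hγ s hs
    have hdh : DifferentiableAt ℝ h (γ s) :=
      ((hh.mono subset_closure).contDiffAt (isOpen_annulus.mem_nhds (hA s hs))).differentiableAt (by simp)
    have := hdh.hasFDerivAt.comp_hasDerivAt s hv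
    have hD := this.deriv
    refine ⟨(this.differentiableAt).hasDerivAt, ?_⟩
    rw [show (fun s => h (γ s)) = h ∘ γ from rfl, hD]
    unfold gden
    rw [indicator_of_mem (hA s hs), ← inner_grad]
    refine (abs_real_inner_le_norm _ _).trans ?_
    rw [mul_comm]
    gcongr
  obtain ⟨C, hC0, hC⟩ := gden_bdd hR₀ hR hh
  have hmeas : Measurable fun s => gden N R₀ R₁ h (γ s) := (gden_meas hh).comp hγc.measurable
  have hint : IntegrableOn (fun s => gden N R₀ R₁ h (γ s)) (Icc a b) := by
    refine Integrable.mono' (g := fun _ => C) (integrableOn_const (by simp)) hmeas.aestronglyMeasurable ?_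
    refine Filter.Eventually.of_forall fun s => ?_
    rw [Real.norm_of_nonneg (gden_nonneg _)]; exact hC _
  have hint' : IntegrableOn (fun s => deriv (fun s => h (γ s)) s) (Ioo a b) := by
    refine Integrable.mono' ((hint.mono_set Ioo_subset_Icc_self).const_mul L)
      (measurable_deriv _).aestronglyMeasurable ?_
    exact (ae_restrict_iff' measurableSet_Ioo).2 (Filter.Eventually.of_forall fun s hs => (hd s hs).2)
  have hint2 : IntervalIntegrable (fun s => deriv (fun s => h (γ s)) s) volume a b := by
    rw [intervalIntegrable_iff_integrableOn_Ioo_of_le hab]; exact hint'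
  have e := intervalIntegral.integral_eq_sub_of_hasDerivAt_of_le hab
    (hh.continuousOn.comp hγc.continuousOn hcl) (fun s hs => (hd s hs).1) hint2
  have e' : h (γ b) - h (γ a) = ∫ s in Ioo a b, deriv (fun s => h (γ s)) s := by
    rw [← integral_Ioc_eq_integral_Ioo, ← intervalIntegral.integral_of_le hab]
    exact e.symm
  rw [e', ← integral_const_mul]
  calc |∫ s in Ioo a b, deriv (fun s => h (γ s)) s| ≤ ∫ s in Ioo a b, |deriv (fun s => h (γ s)) s| :=
        abs_integral_le_integral_abs
    _ ≤ ∫ s in Ioo a b, L * gden N R₀ R₁ h (γ s) :=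
        setIntegral_mono_on hint'.abs ((hint.mono_set Ioo_subset_Icc_self).const_mul L) measurableSet_Ioo
          fun s hs => (hd s hs).2
    _ = _ := by rw [integral_Icc_eq_integral_Ioo]

end Sob


section Sob2
variable {N : ℕ} {R₀ R₁ : ℝ}

lemma gden_int_icc (hR₀ : 0 < R₀) (hR : R₀ < R₁) {h : EE N → ℝ}
    (hh : ContDiffOn ℝ 1 h (closure (annulus N R₀ R₁))) {γ : ℝ → EE N} (hγc : Continuous γ) (a b : ℝ) :
    IntegrableOn (fun s => gden N R₀ R₁ h (γ s)) (Icc a b) := by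
  obtain ⟨C, hC0, hC⟩ := gden_bdd hR₀ hR hh
  refine Integrable.mono' (g := fun _ => C) (integrableOn_const (by simp))
    ((gden_meas hh).comp hγc.measurable).aestronglyMeasurable ?_
  refine Filter.Eventually.of_forall fun s => ?_
  rw [Real.norm_of_nonneg (gden_nonneg _)]; exact hC _

lemma M_bound (hN : 3 ≤ N) (hR₀ : 0 < R₀) (hR : R₀ < R₁) {h : EE N → ℝ}
    (hh : ContDiffOn ℝ 1 h (closure (annulus N R₀ R₁))) (hP : PP N R₀ R₁ h) {x : EE N}
    (hx : x ∈ annulus N R₀ R₁) :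
    h (mer N hN ‖x‖ 0) ≤ h x + 4 * R₁ * ∫ s in Icc (-1:ℝ) 1, gden N R₀ R₁ h (SSr N hN s x) := by
  have hcx := subset_closure hx
  have hR1 : 0 < R₁ := hR₀.trans hR
  have hcl := closure_annulus (N := N) hR₀ hR
  have hmA : mer N hN ‖x‖ 0 ∈ closure (annulus N R₀ R₁) := by
    rw [hcl]; show _ ∧ _
    rw [mer_norm hN (norm_nonneg _)]; exact ⟨hx.1.le, hx.2.le⟩
  have hc : Continuous fun s => SSr N hN s x := SSr_cont1 hN x
  obtain ⟨s0, hs0, hz⟩ := SSr_hit hN x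
  have hm : ∀ s, SSr N hN s x ∈ annulus N R₀ R₁ := fun s => by
    show _ ∧ _
    rw [SSr_norm]; exact hx
  have e1 : h (mer N hN ‖x‖ 0) ≤ h (SSr N hN s0 x) := by
    refine hP _ (subset_closure (hm s0)) _ hmA (by rw [mer_norm hN (norm_nonneg _), SSr_norm]) ?_
    rw [hz, mer_last]; simp
  have e0 : h (SSr N hN 0 x) ≤ h x := by
    refine hP _ hcx _ (subset_closure (hm 0)) (SSr_norm hN 0 x).symm ?_
    rw [SSr_last]; simp
  have hL : ∀ s, ∃ v, HasDerivAt (fun s => SSr N hN s x) v s ∧ ‖v‖ ≤ 4 * R₁ := fun s => by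
    obtain ⟨v, h1, h2⟩ := SSr_deriv hN s x
    exact ⟨v, h1, h2.trans (by linarith [hx.2])⟩
  have mono : ∀ a b : ℝ, -1 ≤ a → b ≤ 1 → ∫ s in Icc a b, gden N R₀ R₁ h (SSr N hN s x) ≤
      ∫ s in Icc (-1:ℝ) 1, gden N R₀ R₁ h (SSr N hN s x) := fun a b ha hb =>
    setIntegral_mono_set (gden_int_icc hR₀ hR hh hc _ _)
      (Filter.Eventually.of_forall fun s => gden_nonneg _) (Icc_subset_Icc ha hb).eventuallyLE
  have key : |h (SSr N hN s0 x) - h (SSr N hN 0 x)| ≤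
      4 * R₁ * ∫ s in Icc (-1:ℝ) 1, gden N R₀ R₁ h (SSr N hN s x) := by
    rcases le_total 0 s0 with hs | hs
    · refine (curve_est hR₀ hR hh hs (L := 4 * R₁) hc (fun s _ => hL s) (fun s _ => hm s)
        (fun s _ => subset_closure (hm s))).trans ?_
      have := mono 0 s0 (by norm_num) hs0.2
      gcongr
    · rw [abs_sub_comm]
      refine (curve_est hR₀ hR hh hs (L := 4 * R₁) hc (fun s _ => hL s) (fun s _ => hm s)
        (fun s _ => subset_closure (hm s))).trans ?_
      have := mono s0 0 hs0.1 (by norm_num)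
      gcongr
  have := (abs_le.1 key).2
  linarith

lemma rad_bound (hR₀ : 0 < R₀) (hR : R₀ < R₁) {h : EE N → ℝ}
    (hh : ContDiffOn ℝ 1 h (closure (annulus N R₀ R₁)))
    (h0 : ∀ x : EE N, (‖x‖ = R₀ ∨ ‖x‖ = R₁) → h x = 0) {ω : EE N} (hω : ‖ω‖ = 1) {r : ℝ}
    (hr : r ∈ Ioo R₀ R₁) :
    h (r • ω) ≤ ∫ s in Icc R₀ R₁, gden N R₀ R₁ h (s • ω) := by
  have hc : Continuous fun s : ℝ => s • ω := continuous_id.smul continuous_const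
  have hn : ∀ s : ℝ, 0 ≤ s → ‖s • ω‖ = s := fun s hs => by
    rw [norm_smul, hω, mul_one, Real.norm_of_nonneg hs]
  have hcl := closure_annulus (N := N) hR₀ hR
  have := curve_est hR₀ hR hh hr.1.le (L := 1) hc
    (fun s _ => ⟨ω, by simpa using (hasDerivAt_id s).smul_const ω, hω.le⟩)
    (fun s hs => by
      show _ ∧ _
      rw [hn s (hR₀.trans hs.1).le]; exact ⟨hs.1, hs.2.trans hr.2⟩)
    (fun s hs => by
      rw [hcl]; show _ ∧ _
      rw [hn s (hR₀.le.trans hs.1)]; exact ⟨hs.1, hs.2.trans hr.2.le⟩)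
  have h00 : h (R₀ • ω) = 0 := h0 _ (Or.inl (hn R₀ hR₀.le))
  simp only [h00, sub_zero, one_mul] at this
  refine (le_abs_self _).trans (this.trans ?_)
  exact setIntegral_mono_set (gden_int_icc hR₀ hR hh hc _ _)
      (Filter.Eventually.of_forall fun s => gden_nonneg _) (Icc_subset_Icc le_rfl hr.2.le).eventuallyLE

lemma mer_cont (hN : 3 ≤ N) : Continuous fun r => mer N hN r 0 := by
  unfold mer; fun_prop

/-- equatorial profile -/
noncomputable def Mt (N : ℕ) (hN : 3 ≤ N) (R₀ R₁ : ℝ) (h : EE N → ℝ) (r : ℝ) : ENNReal :=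
  ENNReal.ofReal ((Ioo R₀ R₁).indicator (fun r => h (mer N hN r 0)) r)

lemma Mt_meas (hN : 3 ≤ N) (hR₀ : 0 < R₀) (hR : R₀ < R₁) {h : EE N → ℝ}
    (hh : ContinuousOn h (closure (annulus N R₀ R₁))) : Measurable (Mt N hN R₀ R₁ h) := by
  classical
  unfold Mt
  refine ENNReal.measurable_ofReal.comp ?_
  rw [← piecewise_eq_indicator]
  refine ContinuousOn.measurable_piecewise ?_ continuousOn_const measurableSet_Ioo
  refine hh.comp (mer_cont hN).continuousOn fun r hr => ?_
  rw [closure_annulus hR₀ hR]; show _ ∧ _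
  rw [mer_norm hN (hR₀.trans hr.1).le]; exact ⟨hr.1.le, hr.2.le⟩

lemma Mt_int (hN : 3 ≤ N) (hR₀ : 0 < R₀) (hR : R₀ < R₁) {h : EE N → ℝ}
    (hh : ContDiffOn ℝ 1 h (closure (annulus N R₀ R₁))) (hP : PP N R₀ R₁ h)
    (hpos : ∀ x ∈ closure (annulus N R₀ R₁), 0 ≤ h x) :
    ∫⁻ x : EE N, Mt N hN R₀ R₁ h ‖x‖ ≤ (∫⁻ x, ENNReal.ofReal ((annulus N R₀ R₁).indicator h x)) +
      ENNReal.ofReal (8 * R₁) * ∫⁻ x, ENNReal.ofReal (gden N R₀ R₁ h x) := by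
  have hR1 : 0 < R₁ := hR₀.trans hR
  have hGm : Measurable fun x => ENNReal.ofReal (gden N R₀ R₁ h x) :=
    ENNReal.measurable_ofReal.comp (gden_meas hh)
  have hjm : Measurable fun q : EE N × ℝ => ENNReal.ofReal (gden N R₀ R₁ h (SSr N hN q.2 q.1)) :=
    hGm.comp (SSr_meas hN)
  have pt : ∀ x : EE N, Mt N hN R₀ R₁ h ‖x‖ ≤ ENNReal.ofReal ((annulus N R₀ R₁).indicator h x) +
      ENNReal.ofReal (4 * R₁) * ∫⁻ s in Icc (-1:ℝ) 1, ENNReal.ofReal (gden N R₀ R₁ h (SSr N hN s x)) := by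
    intro x
    by_cases hx : x ∈ annulus N R₀ R₁
    · unfold Mt
      rw [indicator_of_mem (show ‖x‖ ∈ Ioo R₀ R₁ from hx), indicator_of_mem hx]
      have hc : Continuous fun s => SSr N hN s x := SSr_cont1 hN x
      rw [← ofReal_integral_eq_lintegral_ofReal (gden_int_icc hR₀ hR hh hc _ _)
        (Filter.Eventually.of_forall fun s => gden_nonneg _), ← ENNReal.ofReal_mul (by positivity),
        ← ENNReal.ofReal_add (hpos x (subset_closure hx))
          (mul_nonneg (by positivity) (integral_nonneg fun s => gden_nonneg _))]
      exact ENNReal.ofReal_le_ofReal (M_bound hN hR₀ hR hh hP hx)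
    · unfold Mt
      rw [indicator_of_notMem (show ‖x‖ ∉ Ioo R₀ R₁ from hx)]
      simp
  refine (lintegral_mono pt).trans ?_
  have him : Measurable fun x => ENNReal.ofReal ((annulus N R₀ R₁).indicator h x) :=
    ENNReal.measurable_ofReal.comp (ind_meas hh.continuousOn)
  rw [lintegral_add_left him, lintegral_const_mul _ (Measurable.lintegral_prod_right' hjm)]
  rw [lintegral_lintegral_swap hjm.aemeasurable]
  have : ∀ s, ∫⁻ x, ENNReal.ofReal (gden N R₀ R₁ h (SSr N hN s x)) =
      ∫⁻ x, ENNReal.ofReal (gden N R₀ R₁ h x) := fun s =>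
    (SSr_mp hN s).lintegral_comp hGm
  simp_rw [this]
  rw [lintegral_const]
  simp only [MeasurableSet.univ, Measure.restrict_apply, univ_inter, Real.volume_Icc]
  rw [mul_comm (∫⁻ x, ENNReal.ofReal (gden N R₀ R₁ h x)), ← mul_assoc, ← ENNReal.ofReal_mul (by positivity)]
  rw [show 4 * R₁ * (1 - -1) = 8 * R₁ by ring]

lemma sob1_enn (hN : 3 ≤ N) (hR₀ : 0 < R₀) (hR : R₀ < R₁) {h : EE N → ℝ}
    (hh : ContDiffOn ℝ 1 h (closure (annulus N R₀ R₁))) (hP : PP N R₀ R₁ h)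
    (hpos : ∀ x ∈ closure (annulus N R₀ R₁), 0 ≤ h x)
    (h0 : ∀ x : EE N, (‖x‖ = R₀ ∨ ‖x‖ = R₁) → h x = 0) :
    (volume : Measure (EE N)).toSphere univ * ENNReal.ofReal (R₀ ^ (N - 1)) *
      ∫⁻ x, ENNReal.ofReal ((annulus N R₀ R₁).indicator (fun x => h x ^ 2) x) ≤
    (∫⁻ x, ENNReal.ofReal (gden N R₀ R₁ h x)) * ∫⁻ x : EE N, Mt N hN R₀ R₁ h ‖x‖ := by
  have hGm : Measurable fun x => ENNReal.ofReal (gden N R₀ R₁ h x) :=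
    ENNReal.measurable_ofReal.comp (gden_meas hh)
  have hMm := Mt_meas hN hR₀ hR hh.continuousOn
  have hpm : Measurable fun r : ℝ => ENNReal.ofReal (r ^ (N - 1)) := by fun_prop
  set Q := ∫⁻ r in Ioi (0:ℝ), ENNReal.ofReal (r ^ (N - 1)) * Mt N hN R₀ R₁ h r with hQ
  set α : Metric.sphere (0 : EE N) 1 → ENNReal := fun ω =>
    ∫⁻ r in Ioi (0:ℝ), ENNReal.ofReal (gden N R₀ R₁ h (r • (ω : EE N))) with hα
  have hαm : Measurable α := by
    have : Measurable fun q : Metric.sphere (0 : EE N) 1 × ℝ =>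
        ENNReal.ofReal (gden N R₀ R₁ h (q.2 • (q.1 : EE N))) := hGm.comp (by fun_prop)
    exact this.lintegral_prod_right'
  have e1 : ∫⁻ x : EE N, Mt N hN R₀ R₁ h ‖x‖ = (volume : Measure (EE N)).toSphere univ * Q := by
    rw [polar_lintegral (by omega) (fun x => Mt N hN R₀ R₁ h ‖x‖) (hMm.comp measurable_norm)]
    have : ∀ ω : Metric.sphere (0 : EE N) 1, (∫⁻ r in Ioi (0:ℝ), ENNReal.ofReal (r ^ (N - 1)) *
        Mt N hN R₀ R₁ h ‖r • (ω : EE N)‖) = Q := fun ω => by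
      refine setLIntegral_congr_fun measurableSet_Ioi fun r hr => ?_
      beta_reduce
      rw [norm_smul, norm_eq_of_mem_sphere ω, mul_one, Real.norm_of_nonneg (le_of_lt hr)]
    simp_rw [this]
    rw [lintegral_const, mul_comm]
  have e2 : ENNReal.ofReal (R₀ ^ (N - 1)) * ∫⁻ ω, α ω ∂(volume : Measure (EE N)).toSphere ≤
      ∫⁻ x, ENNReal.ofReal (gden N R₀ R₁ h x) := by
    rw [polar_lintegral (by omega) _ hGm, ← lintegral_const_mul _ hαm]
    refine lintegral_mono fun ω => ?_
    rw [hα]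
    beta_reduce
    rw [← lintegral_const_mul _ (by exact hGm.comp (by fun_prop))]
    refine setLIntegral_mono' measurableSet_Ioi fun r hr => ?_
    have hrn : ‖r • (ω : EE N)‖ = r := by
      rw [norm_smul, norm_eq_of_mem_sphere ω, mul_one, Real.norm_of_nonneg (le_of_lt hr)]
    by_cases hm : r • (ω : EE N) ∈ annulus N R₀ R₁
    · have : R₀ ≤ r := by have := hm.1.le; rwa [hrn] at this
      gcongr
    · simp [gden, indicator_of_notMem hm]
  have e3 : ∫⁻ x, ENNReal.ofReal ((annulus N R₀ R₁).indicator (fun x => h x ^ 2) x) ≤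
      (∫⁻ ω, α ω ∂(volume : Measure (EE N)).toSphere) * Q := by
    rw [polar_lintegral (by omega) (fun x => ENNReal.ofReal ((annulus N R₀ R₁).indicator (fun x => h x ^ 2) x))
        (ENNReal.measurable_ofReal.comp (ind_meas (f := fun x => h x ^ 2) (hh.continuousOn.pow 2))),
      ← lintegral_mul_const _ hαm]
    refine lintegral_mono fun ω => ?_
    rw [hQ, ← lintegral_const_mul _ (by exact hpm.mul hMm)]
    refine setLIntegral_mono' measurableSet_Ioi fun r hr => ?_
    have hrn : ‖r • (ω : EE N)‖ = r := by
      rw [norm_smul, norm_eq_of_mem_sphere ω, mul_one, Real.norm_of_nonneg (le_of_lt hr)]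
    rw [mul_left_comm]
    gcongr
    by_cases hm : r • (ω : EE N) ∈ annulus N R₀ R₁
    · have hr' : r ∈ Ioo R₀ R₁ := by
        have := hm; unfold annulus at this; rw [mem_ofPred_eq, hrn] at this; exact this
      rw [indicator_of_mem hm, pow_two, ENNReal.ofReal_mul (hpos _ (subset_closure hm))]
      have hω : ‖(ω : EE N)‖ = 1 := norm_eq_of_mem_sphere ω
      have hc : Continuous fun s : ℝ => s • (ω : EE N) := continuous_id.smul continuous_const
      gcongr
      · refine (ENNReal.ofReal_le_ofReal (rad_bound hR₀ hR hh h0 hω hr')).trans ?_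
        rw [ofReal_integral_eq_lintegral_ofReal (gden_int_icc hR₀ hR hh hc _ _)
          (Filter.Eventually.of_forall fun s => gden_nonneg _)]
        exact lintegral_mono_set fun s hs => hR₀.trans_le hs.1
      · unfold Mt
        rw [indicator_of_mem hr']
        refine ENNReal.ofReal_le_ofReal (hP _ ?_ _ (subset_closure hm) ?_ ?_)
        · rw [closure_annulus hR₀ hR]; show _ ∧ _
          rw [mer_norm hN (le_of_lt hr)]; exact ⟨hr'.1.le, hr'.2.le⟩
        · rw [mer_norm hN (le_of_lt hr), hrn]
        · rw [mer_last]; simp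
    · simp [indicator_of_notMem hm]
  rw [e1]
  calc _ ≤ (volume : Measure (EE N)).toSphere univ * ENNReal.ofReal (R₀ ^ (N - 1)) *
        ((∫⁻ ω, α ω ∂(volume : Measure (EE N)).toSphere) * Q) := by gcongr
    _ = (ENNReal.ofReal (R₀ ^ (N - 1)) * (∫⁻ ω, α ω ∂(volume : Measure (EE N)).toSphere)) *
        ((volume : Measure (EE N)).toSphere univ * Q) := by ring
    _ ≤ _ := by gcongr

lemma sob1 (hN : 3 ≤ N) (hR₀ : 0 < R₀) (hR : R₀ < R₁) : ∃ C : ℝ, 0 ≤ C ∧ ∀ h : EE N → ℝ,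
    ContDiffOn ℝ 1 h (closure (annulus N R₀ R₁)) → PP N R₀ R₁ h →
    (∀ x ∈ closure (annulus N R₀ R₁), 0 ≤ h x) →
    (∀ x : EE N, (‖x‖ = R₀ ∨ ‖x‖ = R₁) → h x = 0) →
    ∫ x in annulus N R₀ R₁, h x ^ 2 ≤ C * (∫ x in annulus N R₀ R₁, (‖gradient h x‖ + h x)) ^ 2 := by
  have hσ := sig_pos hN
  have hR1 : 0 < R₁ := hR₀.trans hR
  refine ⟨(1 + 8 * R₁) / (sig N * R₀ ^ (N - 1)), by positivity, fun h hh hP hpos h0 => ?_⟩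
  have hA := isOpen_annulus (N := N) (R₀ := R₀) (R₁ := R₁) |>.measurableSet
  obtain ⟨C, hC0, -, hC⟩ := c1_bdd hR₀ hR hh
  have ig : IntegrableOn (fun x => ‖gradient h x‖) (annulus N R₀ R₁) :=
    intOn_annulus (gradCont isOpen_annulus (hh.mono subset_closure)).norm (C := C)
      (fun x hx => by rw [abs_norm]; exact hC x hx)
  have ih : IntegrableOn h (annulus N R₀ R₁) := intOn_annulus' hh.continuousOn
  have ih2 : IntegrableOn (fun x => h x ^ 2) (annulus N R₀ R₁) := intOn_annulus' (hh.continuousOn.pow 2)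
  have key := (sob1_enn hN hR₀ hR hh hP hpos h0).trans (mul_le_mul_right (Mt_int hN hR₀ hR hh hP hpos) _)
  have f1 : ∫⁻ x, ENNReal.ofReal (gden N R₀ R₁ h x) =
      ENNReal.ofReal (∫ x in annulus N R₀ R₁, ‖gradient h x‖) := by
    unfold gden
    rw [← ofReal_integral_eq_lintegral_ofReal ((integrable_indicator_iff hA).2 ig)
      (Filter.Eventually.of_forall fun s => gden_nonneg _), integral_indicator hA]
  have f2 : ∫⁻ x, ENNReal.ofReal ((annulus N R₀ R₁).indicator h x) =
      ENNReal.ofReal (∫ x in annulus N R₀ R₁, h x) := by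
    rw [← ofReal_integral_eq_lintegral_ofReal ((integrable_indicator_iff hA).2 ih)
      (Filter.Eventually.of_forall fun s => indicator_nonneg (fun x hx => hpos x (subset_closure hx)) _)]
    rw [integral_indicator hA]
  have f3 : ∫⁻ x, ENNReal.ofReal ((annulus N R₀ R₁).indicator (fun x => h x ^ 2) x) =
      ENNReal.ofReal (∫ x in annulus N R₀ R₁, h x ^ 2) := by
    rw [← ofReal_integral_eq_lintegral_ofReal ((integrable_indicator_iff hA).2 ih2)
      (Filter.Eventually.of_forall fun s => indicator_nonneg (fun x hx => sq_nonneg _) _)]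
    rw [integral_indicator hA]
  have f4 : (volume : Measure (EE N)).toSphere univ = ENNReal.ofReal (sig N) := by
    unfold sig Measure.real; rw [ENNReal.ofReal_toReal (measure_ne_top _ _)]
  set G := ∫ x in annulus N R₀ R₁, ‖gradient h x‖
  set H := ∫ x in annulus N R₀ R₁, h x
  set S := ∫ x in annulus N R₀ R₁, h x ^ 2
  have hG : 0 ≤ G := integral_nonneg fun _ => norm_nonneg _
  have hH : 0 ≤ H := setIntegral_nonneg hA fun x hx => hpos x (subset_closure hx)
  rw [f1, f2, f3, f4, ← ENNReal.ofReal_mul hσ.le, ← ENNReal.ofReal_mul (by positivity),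
    ← ENNReal.ofReal_mul (by positivity), ← ENNReal.ofReal_add hH (by positivity),
    ← ENNReal.ofReal_mul hG, ENNReal.ofReal_le_ofReal_iff (by positivity)] at key
  rw [integral_add ig ih, div_mul_eq_mul_div, le_div_iff₀ (by positivity)]
  show S * _ ≤ (1 + 8 * R₁) * (G + H) ^ 2
  have : G * (H + 8 * R₁ * G) ≤ (1 + 8 * R₁) * (G + H) ^ 2 := by
    nlinarith [mul_nonneg hG hH, mul_nonneg hR1.le (mul_nonneg hG hH), mul_nonneg hR1.le (mul_nonneg hH hH), mul_nonneg hH hH, mul_nonneg hG hG]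
  linarith [mul_comm S (sig N * R₀ ^ (N - 1))]

end Sob2


section Mom
variable {N : ℕ} {R₀ R₁ : ℝ}

/-- bounded continuous on the open annulus -/
def BC (N : ℕ) (R₀ R₁ : ℝ) (f : EE N → ℝ) : Prop :=
  ContinuousOn f (annulus N R₀ R₁) ∧ ∃ C, 0 ≤ C ∧ ∀ x ∈ annulus N R₀ R₁, |f x| ≤ C

lemma BC.int {f : EE N → ℝ} (hf : BC N R₀ R₁ f) : IntegrableOn f (annulus N R₀ R₁) := by
  obtain ⟨h1, C, _, h2⟩ := hf
  exact intOn_annulus h1 h2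

lemma BC.add {f g : EE N → ℝ} (hf : BC N R₀ R₁ f) (hg : BC N R₀ R₁ g) :
    BC N R₀ R₁ (fun x => f x + g x) := by
  obtain ⟨h1, C, h0, h2⟩ := hf
  obtain ⟨h1', C', h0', h2'⟩ := hg
  exact ⟨h1.add h1', C + C', by positivity, fun x hx => (abs_add_le _ _).trans (add_le_add (h2 x hx) (h2' x hx))⟩

lemma BC.mul {f g : EE N → ℝ} (hf : BC N R₀ R₁ f) (hg : BC N R₀ R₁ g) :
    BC N R₀ R₁ (fun x => f x * g x) := by
  obtain ⟨h1, C, h0, h2⟩ := hf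
  obtain ⟨h1', C', h0', h2'⟩ := hg
  refine ⟨h1.mul h1', C * C', by positivity, fun x hx => ?_⟩
  rw [abs_mul]
  exact mul_le_mul (h2 x hx) (h2' x hx) (abs_nonneg _) h0

lemma BC.const (c : ℝ) : BC N R₀ R₁ (fun _ => c) :=
  ⟨continuousOn_const, |c|, abs_nonneg _, fun _ _ => le_rfl⟩

lemma BC.sub {f g : EE N → ℝ} (hf : BC N R₀ R₁ f) (hg : BC N R₀ R₁ g) :
    BC N R₀ R₁ (fun x => f x - g x) := by
  have := hf.add ((BC.const (-1)).mul hg)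
  convert this using 2
  ring

lemma BC.pow {f : EE N → ℝ} (hf : BC N R₀ R₁ f) (k : ℕ) : BC N R₀ R₁ (fun x => f x ^ k) := by
  induction k with
  | zero => simpa using BC.const 1
  | succ k ih => simpa [pow_succ] using ih.mul hf

lemma BC.of_cont {f : EE N → ℝ} (hf : ContinuousOn f (closure (annulus N R₀ R₁))) : BC N R₀ R₁ f := by
  obtain ⟨B, hB0, hB⟩ := ex_bound hf
  exact ⟨hf.mono subset_closure, B, hB0, fun x hx => hB x (subset_closure hx)⟩

lemma BC.grad (hR₀ : 0 < R₀) (hR : R₀ < R₁) {h : EE N → ℝ}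
    (hh : ContDiffOn ℝ 1 h (closure (annulus N R₀ R₁))) : BC N R₀ R₁ (fun x => ‖gradient h x‖) := by
  obtain ⟨C, hC0, -, hC⟩ := c1_bdd hR₀ hR hh
  exact ⟨(gradCont isOpen_annulus (hh.mono subset_closure)).norm, C, hC0,
    fun x hx => by rw [abs_norm]; exact hC x hx⟩

lemma BC.inner (hR₀ : 0 < R₀) (hR : R₀ < R₁) {h g : EE N → ℝ}
    (hh : ContDiffOn ℝ 1 h (closure (annulus N R₀ R₁))) (hg : ContDiffOn ℝ 1 g (closure (annulus N R₀ R₁))) :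
    BC N R₀ R₁ (fun x => inner ℝ (gradient h x) (gradient g x)) := by
  obtain ⟨C, hC0, -, hC⟩ := c1_bdd hR₀ hR hh
  obtain ⟨C', hC0', -, hC'⟩ := c1_bdd hR₀ hR hg
  refine ⟨(gradCont isOpen_annulus (hh.mono subset_closure)).inner (𝕜 := ℝ)
    (gradCont isOpen_annulus (hg.mono subset_closure)), C * C', by positivity, fun x hx => ?_⟩
  exact (abs_real_inner_le_norm _ _).trans (mul_le_mul (hC x hx) (hC' x hx) (norm_nonneg _) hC0)

lemma cs_annulus {f g : EE N → ℝ} (hf : BC N R₀ R₁ f) (hg : BC N R₀ R₁ g) :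
    (∫ x in annulus N R₀ R₁, f x * g x) ^ 2 ≤
      (∫ x in annulus N R₀ R₁, f x ^ 2) * ∫ x in annulus N R₀ R₁, g x ^ 2 := by
  have i1 := (hf.pow 2).int
  have i2 := (hg.pow 2).int
  have i3 := (hf.mul hg).int
  have key : ∀ t : ℝ, 0 ≤ (∫ x in annulus N R₀ R₁, f x ^ 2) * (t * t) +
      (2 * ∫ x in annulus N R₀ R₁, f x * g x) * t + ∫ x in annulus N R₀ R₁, g x ^ 2 := by
    intro t
    have : 0 ≤ ∫ x in annulus N R₀ R₁, (f x * t + g x) ^ 2 := integral_nonneg fun _ => sq_nonneg _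
    have e : ∫ x in annulus N R₀ R₁, (f x * t + g x) ^ 2 =
        ∫ x in annulus N R₀ R₁, ((t * t) * f x ^ 2 + (2 * t) * (f x * g x) + g x ^ 2) := by
      congr 1; ext x; ring
    have j1 : IntegrableOn (fun x => (t * t) * f x ^ 2) (annulus N R₀ R₁) := i1.const_mul _
    have j2 : IntegrableOn (fun x => (2 * t) * (f x * g x)) (annulus N R₀ R₁) := i3.const_mul _
    have j3 : IntegrableOn (fun x => (t * t) * f x ^ 2 + (2 * t) * (f x * g x)) (annulus N R₀ R₁) := j1.add j2
    rw [e, integral_add j3 i2, integral_add j1 j2, integral_const_mul, integral_const_mul] at this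
    linarith
  have := discrim_le_zero key
  unfold discrim at this
  nlinarith

lemma PP.pow {u : EE N → ℝ} (hP : PP N R₀ R₁ u) (h0 : ∀ x ∈ closure (annulus N R₀ R₁), 0 ≤ u x) (k : ℕ) :
    PP N R₀ R₁ (fun x => u x ^ k) := fun x hx y hy h1 h2 =>
  pow_le_pow_left₀ (h0 y hy) (hP x hx y hy h1 h2) k

lemma H1sq_nonneg (u : EE N → ℝ) : 0 ≤ H1sq N R₀ R₁ u := by
  unfold H1sq
  exact integral_nonneg fun _ => by positivity

lemma mom_step (hN : 3 ≤ N) (hR₀ : 0 < R₀) (hR : R₀ < R₁) : ∃ C : ℝ, 0 ≤ C ∧ ∀ u, memK N R₀ R₁ u →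
    ∀ k : ℕ, ∫ x in annulus N R₀ R₁, u x ^ (2 * (k + 1)) ≤
      C * (k + 1) ^ 2 * (∫ x in annulus N R₀ R₁, u x ^ (2 * k)) * H1sq N R₀ R₁ u := by
  obtain ⟨C, hC0, hC⟩ := sob1 hN hR₀ hR
  refine ⟨C * 2, by positivity, fun u hu k => ?_⟩
  obtain ⟨hK, hbd⟩ := hu
  obtain ⟨h1, h2, h3⟩ := (Khat_iff hN hR₀ hR u).1 hK
  have hA := isOpen_annulus (N := N) (R₀ := R₀) (R₁ := R₁) |>.measurableSet
  have hb := BC.of_cont h1.continuousOn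
  have hg := BC.grad hR₀ hR h1
  have s1 := hC (fun x => u x ^ (k + 1)) (h1.pow _) (h3.pow h2 _) (fun x hx => pow_nonneg (h2 x hx) _)
    (fun x hx => by simp [hbd x hx])
  have e1 : ∫ x in annulus N R₀ R₁, u x ^ (2 * (k + 1)) = ∫ x in annulus N R₀ R₁, (u x ^ (k + 1)) ^ 2 := by
    congr 1; ext x; rw [← pow_mul]; congr 1; ring
  have e2 : ∫ x in annulus N R₀ R₁, (‖gradient (fun x => u x ^ (k + 1)) x‖ + u x ^ (k + 1)) =
      ∫ x in annulus N R₀ R₁, u x ^ k * ((k + 1) * ‖gradient u x‖ + u x) := by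
    refine setIntegral_congr_fun hA fun x hx => ?_
    beta_reduce
    have hd : DifferentiableAt ℝ u x :=
      ((h1.mono subset_closure).contDiffAt (isOpen_annulus.mem_nhds hx)).differentiableAt (by simp)
    rw [norm_grad, norm_grad, fderiv_fun_pow _ hd, norm_smul, Real.norm_of_nonneg]
    · simp; ring
    · have := h2 x (subset_closure hx); simp; positivity
  rw [e1]
  refine s1.trans ?_
  rw [e2]
  have hb2 : BC N R₀ R₁ (fun x => ((k:ℝ) + 1) * ‖gradient u x‖ + u x) := ((BC.const _).mul hg).add hb
  have c1 := cs_annulus (hb.pow k) hb2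
  have e3 : ∫ x in annulus N R₀ R₁, (u x ^ k) ^ 2 = ∫ x in annulus N R₀ R₁, u x ^ (2 * k) := by
    congr 1; ext x; rw [← pow_mul]; congr 1; ring
  rw [e3] at c1
  have c2 : ∫ x in annulus N R₀ R₁, (((k:ℝ) + 1) * ‖gradient u x‖ + u x) ^ 2 ≤
      2 * (k + 1) ^ 2 * H1sq N R₀ R₁ u := by
    rw [H1sq_eq, ← integral_const_mul]
    refine setIntegral_mono_on (hb2.pow 2).int (((hg.pow 2).add (hb.pow 2)).int.const_mul _) hA fun x hx => ?_
    have : (1:ℝ) ≤ (k + 1) ^ 2 := by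
      have : (0:ℝ) ≤ k := Nat.cast_nonneg k
      nlinarith
    nlinarith [sq_nonneg (((k:ℝ) + 1) * ‖gradient u x‖ - u x), sq_nonneg (u x)]
  have hm0 : 0 ≤ ∫ x in annulus N R₀ R₁, u x ^ (2 * k) := integral_nonneg fun x => by
    rw [pow_mul]; positivity
  calc _ ≤ C * ((∫ x in annulus N R₀ R₁, u x ^ (2 * k)) * (2 * (k + 1) ^ 2 * H1sq N R₀ R₁ u)) := by
        gcongr
        exact c1.trans (by gcongr)
    _ = _ := by ring

lemma mom (hN : 3 ≤ N) (hR₀ : 0 < R₀) (hR : R₀ < R₁) (k : ℕ) : ∃ C : ℝ, 0 ≤ C ∧ ∀ u, memK N R₀ R₁ u →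
    ∫ x in annulus N R₀ R₁, u x ^ (2 * k) ≤ C * H1sq N R₀ R₁ u ^ k := by
  obtain ⟨C, hC0, hC⟩ := mom_step hN hR₀ hR
  induction k with
  | zero =>
    exact ⟨∫ x in annulus N R₀ R₁, (1:ℝ), integral_nonneg fun _ => zero_le_one, fun u hu => by simp⟩
  | succ k ih =>
    obtain ⟨D, hD0, hD⟩ := ih
    refine ⟨C * (k + 1) ^ 2 * D, by positivity, fun u hu => ?_⟩
    refine (hC u hu k).trans ?_
    have h1 := hD u hu
    have h2 := H1sq_nonneg (R₀ := R₀) (R₁ := R₁) u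
    calc _ ≤ C * (k + 1) ^ 2 * (D * H1sq N R₀ R₁ u ^ k) * H1sq N R₀ R₁ u := by gcongr
      _ = _ := by ring

lemma rpow_le_sum {t p : ℝ} {k : ℕ} (ht : 0 ≤ t) (hp : 2 ≤ p) (hk : p ≤ (2 * k : ℕ)) :
    t ^ p ≤ t ^ 2 + t ^ (2 * k) := by
  rcases le_total t 1 with h | h
  · have : t ^ p ≤ t ^ (2:ℝ) := by
      rcases ht.eq_or_lt with rfl | ht'
      · rw [zero_rpow (by linarith), zero_rpow (by norm_num)]
      · exact rpow_le_rpow_of_exponent_ge ht' h hp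
    rw [rpow_two] at this
    have := pow_nonneg ht (2 * k)
    linarith
  · have : t ^ p ≤ t ^ ((2 * k : ℕ):ℝ) := rpow_le_rpow_of_exponent_le h hk
    rw [rpow_natCast] at this
    have := sq_nonneg t
    linarith

lemma BC.rpow {f : EE N → ℝ} (hf : BC N R₀ R₁ f) {p : ℝ} (hp : 0 ≤ p)
    (h0 : ∀ x ∈ annulus N R₀ R₁, 0 ≤ f x) : BC N R₀ R₁ (fun x => f x ^ p) := by
  obtain ⟨h1, C, hC, h2⟩ := hf
  refine ⟨h1.rpow_const fun x hx => Or.inr hp, C ^ p, by positivity, fun x hx => ?_⟩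
  rw [abs_of_nonneg (rpow_nonneg (h0 x hx) _)]
  exact rpow_le_rpow (h0 x hx) ((le_abs_self _).trans (h2 x hx)) hp

lemma sob_p (hN : 3 ≤ N) (hR₀ : 0 < R₀) (hR : R₀ < R₁) {p : ℝ} (hp : 2 < p) :
    ∃ C : ℝ, 0 ≤ C ∧ ∀ u, memK N R₀ R₁ u → 0 < H1sq N R₀ R₁ u →
    ∫ x in annulus N R₀ R₁, u x ^ p ≤ C * H1sq N R₀ R₁ u ^ (p / 2) := by
  obtain ⟨k, hk⟩ := exists_nat_ge p
  obtain ⟨C1, hC1, h1⟩ := mom hN hR₀ hR 1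
  obtain ⟨C2, hC2, h2⟩ := mom hN hR₀ hR k
  refine ⟨C1 + C2, by positivity, fun u hu hpos => ?_⟩
  obtain ⟨c1, hu0, -⟩ := (Khat_iff hN hR₀ hR u).1 hu.1
  have hA := isOpen_annulus (N := N) (R₀ := R₀) (R₁ := R₁) |>.measurableSet
  set s := √(H1sq N R₀ R₁ u) with hs
  have hs0 : 0 < s := Real.sqrt_pos.2 hpos
  have hss : s ^ 2 = H1sq N R₀ R₁ u := Real.sq_sqrt hpos.le
  have hsp : s ^ p = H1sq N R₀ R₁ u ^ (p / 2) := by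
    rw [hs, Real.sqrt_eq_rpow, ← rpow_mul hpos.le]; congr 1; ring
  have hb := BC.of_cont c1.continuousOn
  have i1 := (hb.pow 2).int
  have i2 := (hb.pow (2 * k)).int
  have m1 := h1 u hu
  have m2 := h2 u hu
  have hk' : p ≤ (2 * k : ℕ) := by push_cast; linarith
  have : ∫ x in annulus N R₀ R₁, u x ^ p ≤
      ∫ x in annulus N R₀ R₁, ((s ^ p / s ^ 2) * u x ^ 2 + (s ^ p / s ^ (2 * k)) * u x ^ (2 * k)) := by
    refine setIntegral_mono_on (hb.rpow (by linarith) fun x hx => hu0 x (subset_closure hx)).int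
      ((i1.const_mul _).add (i2.const_mul _)) hA fun x hx => ?_
    have hx0 := hu0 x (subset_closure hx)
    have := rpow_le_sum (t := u x / s) (by positivity) hp.le hk'
    rw [div_rpow hx0 hs0.le, div_le_iff₀ (by positivity), div_pow, div_pow] at this
    refine this.trans (le_of_eq ?_)
    ring
  refine this.trans ?_
  have j1 : IntegrableOn (fun x => (s ^ p / s ^ 2) * u x ^ 2) (annulus N R₀ R₁) := i1.const_mul _
  have j2 : IntegrableOn (fun x => (s ^ p / s ^ (2 * k)) * u x ^ (2 * k)) (annulus N R₀ R₁) := i2.const_mul _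
  rw [integral_add j1 j2, integral_const_mul, integral_const_mul, ← hsp]
  rw [← hss] at m1 m2
  rw [← pow_mul] at m1 m2
  simp only [mul_one] at m1
  have a1 : 0 < s ^ p := by positivity
  calc _ ≤ s ^ p / s ^ 2 * (C1 * s ^ 2) + s ^ p / s ^ (2 * k) * (C2 * s ^ (2 * k)) := by gcongr
    _ = _ := by field_simp

end Mom


section Neh
variable {N : ℕ} {R₀ R₁ : ℝ}

lemma PP.mul {f g : EE N → ℝ} (hf : PP N R₀ R₁ f) (hg : PP N R₀ R₁ g)
    (f0 : ∀ x ∈ closure (annulus N R₀ R₁), 0 ≤ f x) (g0 : ∀ x ∈ closure (annulus N R₀ R₁), 0 ≤ g x) :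
    PP N R₀ R₁ (fun x => f x * g x) := fun x hx y hy h1 h2 =>
  mul_le_mul (hf x hx y hy h1 h2) (hg x hx y hy h1 h2) (g0 y hy) (f0 x hx)

lemma PP.rpow {u : EE N → ℝ} (hP : PP N R₀ R₁ u) (h0 : ∀ x ∈ closure (annulus N R₀ R₁), 0 ≤ u x)
    {q : ℝ} (hq : 0 ≤ q) : PP N R₀ R₁ (fun x => u x ^ q) := fun x hx y hy h1 h2 =>
  rpow_le_rpow (h0 y hy) (hP x hx y hy h1 h2) hq

lemma H1sq_smul {v : EE N → ℝ} (hv : ContDiffOn ℝ 1 v (closure (annulus N R₀ R₁))) (t : ℝ) :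
    H1sq N R₀ R₁ (fun x => t * v x) = t ^ 2 * H1sq N R₀ R₁ v := by
  rw [H1sq_eq, H1sq_eq, ← integral_const_mul]
  refine setIntegral_congr_fun isOpen_annulus.measurableSet fun x hx => ?_
  beta_reduce
  have hd : DifferentiableAt ℝ v x :=
    ((hv.mono subset_closure).contDiffAt (isOpen_annulus.mem_nhds hx)).differentiableAt (by simp)
  rw [norm_grad, norm_grad, fderiv_const_mul hd, norm_smul, mul_pow, Real.norm_eq_abs, sq_abs]
  ring

lemma memK_smul (hN : 3 ≤ N) (hR₀ : 0 < R₀) (hR : R₀ < R₁) {v : EE N → ℝ} (hv : memK N R₀ R₁ v)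
    {t : ℝ} (ht : 0 ≤ t) : memK N R₀ R₁ (fun x => t * v x) := by
  obtain ⟨h1, h2, h3⟩ := (Khat_iff hN hR₀ hR v).1 hv.1
  refine ⟨(Khat_iff hN hR₀ hR _).2 ⟨contDiffOn_const.mul h1, fun x hx => mul_nonneg ht (h2 x hx),
    fun x hx y hy e1 e2 => mul_le_mul_of_nonneg_left (h3 x hx y hy e1 e2) ht⟩, fun x hx => ?_⟩
  show t * v x = 0
  rw [hv.2 x hx, mul_zero]

lemma eq_zero_of_int {f : EE N → ℝ} (hf : BC N R₀ R₁ f) (h0 : ∀ x ∈ annulus N R₀ R₁, 0 ≤ f x)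
    (hi : ∫ x in annulus N R₀ R₁, f x = 0) : ∀ x ∈ annulus N R₀ R₁, f x = 0 := by
  have hA := isOpen_annulus (N := N) (R₀ := R₀) (R₁ := R₁)
  have h1 := (setIntegral_eq_zero_iff_of_nonneg_ae
    ((ae_restrict_iff' hA.measurableSet).2 (Filter.Eventually.of_forall h0)) hf.int).1 hi
  exact Measure.eqOn_open_of_ae_eq h1 hA hf.1 continuousOn_const

lemma int_pos {f : EE N → ℝ} (hf : BC N R₀ R₁ f) (h0 : ∀ x ∈ annulus N R₀ R₁, 0 ≤ f x)
    (hx : ∃ x ∈ annulus N R₀ R₁, f x ≠ 0) : 0 < ∫ x in annulus N R₀ R₁, f x := by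
  have h1 : 0 ≤ ∫ x in annulus N R₀ R₁, f x := setIntegral_nonneg isOpen_annulus.measurableSet h0
  refine lt_of_le_of_ne h1 fun h => ?_
  obtain ⟨x, hxA, hne⟩ := hx
  exact hne (eq_zero_of_int hf h0 h.symm x hxA)

lemma BC.H1 (hR₀ : 0 < R₀) (hR : R₀ < R₁) {u : EE N → ℝ}
    (hu : ContDiffOn ℝ 1 u (closure (annulus N R₀ R₁))) :
    BC N R₀ R₁ (fun x => ‖gradient u x‖ ^ 2 + u x ^ 2) :=
  ((BC.grad hR₀ hR hu).pow 2).add ((BC.of_cont hu.continuousOn).pow 2)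

lemma H1sq_zero (hR₀ : 0 < R₀) (hR : R₀ < R₁) {u : EE N → ℝ}
    (hu : ContDiffOn ℝ 1 u (closure (annulus N R₀ R₁))) (h : H1sq N R₀ R₁ u = 0) :
    ∀ x ∈ annulus N R₀ R₁, u x = 0 := by
  rw [H1sq_eq] at h
  intro x hx
  have := eq_zero_of_int (BC.H1 hR₀ hR hu) (fun x _ => by positivity) h x hx
  nlinarith [sq_nonneg ‖gradient u x‖, sq_nonneg (u x)]

lemma H1sq_pos (hR₀ : 0 < R₀) (hR : R₀ < R₁) {u : EE N → ℝ}
    (hu : ContDiffOn ℝ 1 u (closure (annulus N R₀ R₁))) (h : ∃ x ∈ annulus N R₀ R₁, u x ≠ 0) :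
    0 < H1sq N R₀ R₁ u := by
  refine lt_of_le_of_ne (H1sq_nonneg u) fun h' => ?_
  obtain ⟨x, hx, hne⟩ := h
  exact hne (H1sq_zero hR₀ hR hu h'.symm x hx)

lemma H1sq_sub (hR₀ : 0 < R₀) (hR : R₀ < R₁) {u v : EE N → ℝ}
    (hu : ContDiffOn ℝ 1 u (closure (annulus N R₀ R₁)))
    (hv : ContDiffOn ℝ 1 v (closure (annulus N R₀ R₁))) :
    H1sq N R₀ R₁ (fun x => u x - 1 * v x) = H1sq N R₀ R₁ u -
      2 * (∫ x in annulus N R₀ R₁, (inner ℝ (gradient v x) (gradient u x) + v x * u x)) + H1sq N R₀ R₁ v := by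
  have hbu := BC.of_cont hu.continuousOn
  have hbv := BC.of_cont hv.continuousOn
  have i1 := (BC.H1 hR₀ hR hu).int
  have i2 := (BC.H1 hR₀ hR hv).int
  have i3 := ((BC.const 2).mul ((BC.inner hR₀ hR hv hu).add (hbv.mul hbu)))
  have i4 := ((BC.H1 hR₀ hR hu).sub i3).int
  rw [H1sq_eq, H1sq_eq, H1sq_eq, ← integral_const_mul, ← integral_sub i1 i3.int, ← integral_add i4 i2]
  refine setIntegral_congr_fun isOpen_annulus.measurableSet fun x hx => ?_
  beta_reduce
  rw [grad_sub_smul isOpen_annulus (hu.mono subset_closure) (hv.mono subset_closure) 1 hx, norm_sub_sq_real, one_smul, real_inner_comm]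
  ring

lemma T_test (hR₀ : 0 < R₀) (hR : R₀ < R₁) {f v φ : EE N → ℝ} (h : IsT N R₀ R₁ f v)
    (hφ : ContDiffOn ℝ 1 φ (closure (annulus N R₀ R₁)))
    (hpos : ∀ x ∈ closure (annulus N R₀ R₁), 0 ≤ φ x)
    (hbd : ∀ x : EE N, (‖x‖ = R₀ ∨ ‖x‖ = R₁) → φ x = 0) :
    ∫ x in annulus N R₀ R₁, (inner ℝ (gradient v x) (gradient φ x) + v x * φ x) =
      ∫ x in annulus N R₀ R₁, f x * φ x := by
  obtain ⟨C1, p1, a1, b1⟩ := c1_bdd hR₀ hR hφ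
  obtain ⟨C2, p2, a2, b2⟩ := c1_bdd hR₀ hR (h.c1' hR₀ hR)
  obtain ⟨C3, p3, a3⟩ := ex_bound h.cf
  refine IsWS.test (C := C1 + C2 + C3) isOpen_annulus bounded_annulus h.ws hφ.continuousOn
    (hφ.mono subset_closure) (fun x hx => hpos x (subset_closure hx))
    (fun x hx => hbd x (frontier_annulus hR₀ hR hx)) ?_ ?_ ?_ ?_ ?_
  · intro x hx; linarith [b1 x hx]
  · intro x hx; linarith [b2 x hx]
  · intro x hx; linarith [a2 x (subset_closure hx)]
  · intro x hx; linarith [a3 x (subset_closure hx)]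
  · intro x hx; linarith [a1 x (subset_closure hx)]

lemma tangent {x y p : ℝ} (hx : 0 ≤ x) (hy : 0 ≤ y) (hp : 1 < p) :
    x ^ p + p * x ^ (p - 1) * (y - x) ≤ y ^ p := by
  rcases hx.eq_or_lt with rfl | hx
  · rw [zero_rpow (by linarith), zero_rpow (by linarith)]
    have := rpow_nonneg hy p
    linarith
  have h := one_add_mul_self_le_rpow_one_add (s := y / x - 1)
    (by have : 0 ≤ y / x := by positivity
        linarith) hp.le
  rw [show 1 + (y / x - 1) = y / x by ring, div_rpow hy hx.le, le_div_iff₀ (by positivity)] at h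
  refine le_trans (le_of_eq ?_) h
  rw [rpow_sub_one hx.ne']
  field_simp

variable {p : ℝ} {a : EE N → ℝ}

lemma abs_pow_eq {u : EE N → ℝ} (hu : ∀ x ∈ closure (annulus N R₀ R₁), 0 ≤ u x) (q : ℝ) :
    ∫ x in annulus N R₀ R₁, a x * |u x| ^ q = ∫ x in annulus N R₀ R₁, a x * u x ^ q :=
  setIntegral_congr_fun isOpen_annulus.measurableSet fun x hx => by
    beta_reduce
    rw [abs_of_nonneg (hu x (subset_closure hx))]

lemma Neh_I (hp : 2 < p) {u : EE N → ℝ} (hu : memNehari N R₀ R₁ a p u) :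
    funcI N R₀ R₁ a p u = (1 / 2 - 1 / p) * H1sq N R₀ R₁ u := by
  unfold funcI
  rw [← hu.2.2]; ring

lemma nehari_low (hN : 3 ≤ N) (hR₀ : 0 < R₀) (hR : R₀ < R₁) (hp : 2 < p)
    (ha : memKhat N R₀ R₁ a) : ∃ c : ℝ, 0 < c ∧ ∀ u, memNehari N R₀ R₁ a p u → c ≤ H1sq N R₀ R₁ u := by
  obtain ⟨C, hC0, hC⟩ := sob_p hN hR₀ hR hp
  obtain ⟨Ca, hCa0, hCa⟩ := ex_bound ha.1.continuousOn
  have hD : 0 < Ca * C + 1 := by positivity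
  set D := Ca * C + 1 with hDdef
  refine ⟨(1 / D) ^ (1 / (p / 2 - 1)), by positivity, fun u hu => ?_⟩
  obtain ⟨h1, h2, h3⟩ := (Khat_iff hN hR₀ hR u).1 hu.1.1
  have hH := H1sq_pos hR₀ hR h1 hu.2.1
  have e := hu.2.2
  rw [abs_pow_eq h2] at e
  have hb := BC.of_cont h1.continuousOn
  have hbp := hb.rpow (p := p) (by linarith) fun x hx => h2 x (subset_closure hx)
  have hba := BC.of_cont ha.1.continuousOn
  set H := H1sq N R₀ R₁ u
  have le1 : H ≤ Ca * (C * H ^ (p / 2)) := by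
    calc H = ∫ x in annulus N R₀ R₁, a x * u x ^ p := e
      _ ≤ ∫ x in annulus N R₀ R₁, Ca * u x ^ p := by
          refine setIntegral_mono_on (hba.mul hbp).int (hbp.int.const_mul _) isOpen_annulus.measurableSet fun x hx => ?_
          have := rpow_nonneg (h2 x (subset_closure hx)) p
          have := (le_abs_self _).trans (hCa x (subset_closure hx))
          gcongr
      _ = Ca * ∫ x in annulus N R₀ R₁, u x ^ p := integral_const_mul _ _
      _ ≤ _ := by gcongr; exact hC u hu.1 hH
  have hsp : H ^ (p / 2) = H * H ^ (p / 2 - 1) := by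
    rw [rpow_sub_one hH.ne']; field_simp
  have hq : 0 < p / 2 - 1 := by linarith
  have le2 : 1 / D ≤ H ^ (p / 2 - 1) := by
    rw [hsp] at le1
    have hpos : 0 < H ^ (p / 2 - 1) := by positivity
    rw [div_le_iff₀ hD]
    have : H * 1 ≤ H * (H ^ (p / 2 - 1) * (Ca * C)) := by linarith
    have := le_of_mul_le_mul_left this hH
    rw [hDdef]; linarith
  calc (1 / D) ^ (1 / (p / 2 - 1)) ≤ (H ^ (p / 2 - 1)) ^ (1 / (p / 2 - 1)) :=
        rpow_le_rpow (by positivity) le2 (by positivity)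
    _ = H := by rw [← rpow_mul hH.le, mul_one_div_cancel hq.ne', rpow_one]

/-- scaling onto the Nehari set -/
lemma Neh_scale (hN : 3 ≤ N) (hR₀ : 0 < R₀) (hR : R₀ < R₁) (hp : 2 < p) {v : EE N → ℝ}
    (hv : memK N R₀ R₁ v) {V D : ℝ} (hV : 0 < V) (hD : 0 < D) (eV : H1sq N R₀ R₁ v = V)
    (eD : ∫ x in annulus N R₀ R₁, a x * v x ^ p = D) :
    memNehari N R₀ R₁ a p (fun x => (V / D) ^ (1 / (p - 2)) * v x) := by
  obtain ⟨h1, h2, h3⟩ := (Khat_iff hN hR₀ hR v).1 hv.1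
  have ht : 0 < (V / D) ^ (1 / (p - 2)) := by positivity
  have hq : 0 < p - 2 := by linarith
  have htp : ((V / D) ^ (1 / (p - 2))) ^ (p - 2) = V / D := by
    rw [← rpow_mul (by positivity), one_div_mul_cancel hq.ne', rpow_one]
  set t := (V / D) ^ (1 / (p - 2))
  have hK := memK_smul hN hR₀ hR hv ht.le
  refine ⟨hK, ?_, ?_⟩
  · by_contra hc
    push Not at hc
    have : H1sq N R₀ R₁ v = 0 := by
      rw [H1sq_eq]
      rw [setIntegral_congr_fun (g := fun _ => (0:ℝ)) isOpen_annulus.measurableSet, integral_zero]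
      intro x hx
      have hz : ∀ y ∈ annulus N R₀ R₁, v y = 0 := fun y hy => by
        have := hc y hy; rcases mul_eq_zero.1 this with h | h
        · exact absurd h ht.ne'
        · exact h
      have hev : v =ᶠ[nhds x] fun _ => 0 :=
        Filter.eventuallyEq_of_mem (isOpen_annulus.mem_nhds hx) hz
      beta_reduce
      rw [norm_grad, hev.fderiv_eq, hz x hx]; simp
    linarith
  · rw [H1sq_smul h1, eV, abs_pow_eq (fun x hx => mul_nonneg ht.le (h2 x hx))]
    have : ∫ x in annulus N R₀ R₁, a x * (t * v x) ^ p = t ^ p * D := by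
      rw [← eD, ← integral_const_mul]
      refine setIntegral_congr_fun isOpen_annulus.measurableSet fun x hx => ?_
      beta_reduce
      rw [mul_rpow ht.le (h2 x (subset_closure hx))]; ring
    rw [this, show p = 2 + (p - 2) by ring, rpow_add ht, htp, rpow_two]
    field_simp

lemma Neh_step (hN : 3 ≤ N) (hR₀ : 0 < R₀) (hR : R₀ < R₁) (hp : 2 < p)
    (ha : memKhat N R₀ R₁ a) {u v : EE N → ℝ} (hu : memNehari N R₀ R₁ a p u)
    (hT : IsT N R₀ R₁ (fun x => a x * u x ^ (p - 1)) v) : memK N R₀ R₁ v ∧ ∃ t : ℝ, 0 < t ∧ t ≤ 1 ∧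
      memNehari N R₀ R₁ a p (fun x => t * v x) ∧
      H1sq N R₀ R₁ (fun x => t * v x) ≤ H1sq N R₀ R₁ u ∧
      (H1sq N R₀ R₁ u ≤ H1sq N R₀ R₁ (fun x => t * v x) → ∀ x ∈ annulus N R₀ R₁, u x = v x) := by
  obtain ⟨h1, h2, h3⟩ := (Khat_iff hN hR₀ hR u).1 hu.1.1
  obtain ⟨a1, a2, a3⟩ := (Khat_iff hN hR₀ hR a).1 ha
  have hA := isOpen_annulus (N := N) (R₀ := R₀) (R₁ := R₁) |>.measurableSet
  have hf0 : ∀ x ∈ closure (annulus N R₀ R₁), 0 ≤ a x * u x ^ (p - 1) := fun x hx =>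
    mul_nonneg (a2 x hx) (rpow_nonneg (h2 x hx) _)
  have hfP : PP N R₀ R₁ (fun x => a x * u x ^ (p - 1)) :=
    a3.mul (h3.rpow h2 (by linarith)) a2 fun x hx => rpow_nonneg (h2 x hx) _
  have hvK := T_memK hN hR₀ hR hT hf0 hfP
  refine ⟨hvK, ?_⟩
  obtain ⟨v1, v2, v3⟩ := (Khat_iff hN hR₀ hR v).1 hvK.1
  have hN0 := H1sq_pos hR₀ hR h1 hu.2.1
  have eN := hu.2.2
  rw [abs_pow_eq h2] at eN
  have hbu := BC.of_cont h1.continuousOn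
  have hbv := BC.of_cont v1.continuousOn
  have hba := BC.of_cont a1.continuousOn
  have hbup := hbu.rpow (p := p) (by linarith) fun x hx => h2 x (subset_closure hx)
  have hbup1 := hbu.rpow (p := p - 1) (by linarith) fun x hx => h2 x (subset_closure hx)
  have hbvp := hbv.rpow (p := p) (by linarith) fun x hx => v2 x (subset_closure hx)
  -- pairing with u
  have pu : ∫ x in annulus N R₀ R₁, (inner ℝ (gradient v x) (gradient u x) + v x * u x) =
      H1sq N R₀ R₁ u := by
    rw [T_test hR₀ hR hT h1 h2 hu.1.2, eN]
    refine setIntegral_congr_fun hA fun x hx => ?_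
    beta_reduce
    have hx0 := h2 x (subset_closure hx)
    rw [mul_assoc]
    congr 1
    rcases hx0.eq_or_lt with h | h
    · rw [← h, zero_rpow (by linarith), zero_rpow (by linarith)]; simp
    · rw [rpow_sub_one h.ne']; field_simp
  have pv : ∫ x in annulus N R₀ R₁, a x * u x ^ (p - 1) * v x = H1sq N R₀ R₁ v := by
    rw [← T_test hR₀ hR hT v1 v2 hvK.2, H1sq_eq]
    congr 1; ext x; rw [real_inner_self_eq_norm_sq]; ring
  have hsub := H1sq_sub hR₀ hR h1 v1
  rw [pu] at hsub
  have hsub0 := H1sq_nonneg (R₀ := R₀) (R₁ := R₁) (fun x => u x - 1 * v x)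
  set M := H1sq N R₀ R₁ u with hM
  set V := H1sq N R₀ R₁ v with hV
  have hMV : M ≤ V := by linarith
  have hV0 : 0 < V := hN0.trans_le hMV
  set θ := V / M with hθ
  have hθ0 : 0 < θ := by positivity
  set D := ∫ x in annulus N R₀ R₁, a x * v x ^ p with hD
  have hDle : θ ^ p * M ≤ D := by
    have hle : ∫ x in annulus N R₀ R₁, ((θ ^ p - p * θ ^ (p - 1) * θ) * (a x * u x ^ p) +
        (p * θ ^ (p - 1)) * (a x * u x ^ (p - 1) * v x)) ≤ D := by
      refine setIntegral_mono_on (((BC.const _).mul (hba.mul hbup)).add ((BC.const _).mul ((hba.mul hbup1).mul hbv))).int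
        (hba.mul hbvp).int hA fun x hx => ?_
      have hx0 := h2 x (subset_closure hx)
      have := tangent (x := θ * u x) (y := v x) (p := p) (by positivity) (v2 x (subset_closure hx)) (by linarith)
      have := mul_le_mul_of_nonneg_left this (a2 x (subset_closure hx))
      refine le_trans (le_of_eq ?_) this
      rw [mul_rpow hθ0.le hx0, mul_rpow hθ0.le hx0]
      have : u x ^ (p - 1) * u x = u x ^ p := by
        rcases hx0.eq_or_lt with h | h
        · rw [← h, zero_rpow (by linarith), zero_rpow (by linarith)]; simp
        · rw [rpow_sub_one h.ne']; field_simp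
      rw [← this]; ring
    rw [integral_add ((BC.const _).mul (hba.mul hbup)).int ((BC.const _).mul ((hba.mul hbup1).mul hbv)).int,
      integral_const_mul, integral_const_mul, ← eN, pv] at hle
    refine le_trans (le_of_eq ?_) hle
    rw [hθ]; field_simp; ring
  have hθ1 : 1 ≤ θ := (one_le_div hN0).2 hMV
  have hD0 : 0 < D := lt_of_lt_of_le (by positivity) hDle
  have hq : 0 < p - 2 := by linarith
  set t := (V / D) ^ (1 / (p - 2)) with ht
  have ht0 : 0 < t := by positivity
  have htθ : t ≤ θ⁻¹ := by
    have : V / D ≤ (θ⁻¹) ^ (p - 2) := by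
      rw [div_le_iff₀ hD0]
      refine le_trans ?_ (mul_le_mul_of_nonneg_left hDle (by positivity))
      have e1 : θ ^ p = θ ^ (p - 2) * θ ^ 2 := by
        rw [← rpow_two, ← rpow_add hθ0]; congr 1; ring
      rw [inv_rpow hθ0.le, e1]
      have hV' : V = θ * M := by rw [hθ]; field_simp
      have e2 : (θ ^ (p - 2))⁻¹ * (θ ^ (p - 2) * θ ^ 2 * M) = θ * (θ * M) := by
        field_simp
      rw [e2, ← hV']; nlinarith
    calc t ≤ ((θ⁻¹) ^ (p - 2)) ^ (1 / (p - 2)) := rpow_le_rpow (by positivity) this (by positivity)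
      _ = θ⁻¹ := by rw [← rpow_mul (by positivity), mul_one_div_cancel hq.ne', rpow_one]
  have hes : H1sq N R₀ R₁ (fun x => t * v x) = t ^ 2 * V := H1sq_smul v1 t
  have hbound : t ^ 2 * V ≤ θ⁻¹ * M := by
    have e : (θ⁻¹) ^ 2 * V = θ⁻¹ * M := by rw [hθ]; field_simp
    rw [← e]; gcongr
  have hinv : θ⁻¹ ≤ 1 := inv_le_one_of_one_le₀ hθ1
  refine ⟨t, ht0, htθ.trans hinv, Neh_scale hN hR₀ hR hp hvK hV0 hD0 rfl rfl, ?_, ?_⟩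
  · rw [hes]; nlinarith
  · intro hle
    rw [hes] at hle
    have h1' : M ≤ θ⁻¹ * M := hle.trans hbound
    have : θ⁻¹ * M = M / θ := by field_simp
    rw [this, le_div_iff₀ hθ0] at h1'
    have : θ * M = V := by rw [hθ]; field_simp
    have hVM : V ≤ M := by nlinarith
    have hz : H1sq N R₀ R₁ (fun x => u x - 1 * v x) = 0 := by linarith
    intro x hx
    have := H1sq_zero hR₀ hR (h1.sub (contDiffOn_const.mul v1)) hz x hx
    linarith

end Neh


section Exist
variable {N : ℕ} {R₀ R₁ : ℝ}

lemma ws_const {D : Set (EE N)} (F : ℝ) : IsWS D (fun _ => F) (fun _ => F) := by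
  refine ⟨continuousOn_const, contDiffOn_const, fun φ _ _ _ => ?_⟩
  refine integral_congr_ae (Filter.Eventually.of_forall fun x => ?_)
  beta_reduce
  rw [inner_grad]
  simp

lemma ws_le (hR₀ : 0 < R₀) (hR : R₀ < R₁) {f v : EE N → ℝ} {F : ℝ} (hF : 0 ≤ F)
    (hc : ContinuousOn v (closure (annulus N R₀ R₁))) (hw : IsWS (annulus N R₀ R₁) f v)
    (hf : ∀ x ∈ closure (annulus N R₀ R₁), f x ≤ F)
    (hbd : ∀ x : EE N, (‖x‖ = R₀ ∨ ‖x‖ = R₁) → v x = 0) :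
    ∀ x ∈ closure (annulus N R₀ R₁), v x ≤ F := by
  intro x hx
  rcases mem_or_bd hR₀ hR hx with h1 | h1
  · have := max_principle (w := fun x => F - 1 * v x) isOpen_annulus bounded_annulus (continuousOn_const.sub (hc.const_mul 1))
      (IsWS.sub_mul isOpen_annulus (ws_const F) hw 1)
      (fun x hx => by have := hf x (subset_closure hx); linarith)
      (fun x hx => by have := hbd x (frontier_annulus hR₀ hR hx); linarith) x h1
    linarith
  · rw [hbd x h1]; exact hF

lemma T_le (hR₀ : 0 < R₀) (hR : R₀ < R₁) {f v : EE N → ℝ} {F : ℝ} (hF : 0 ≤ F)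
    (h : IsT N R₀ R₁ f v) (hf : ∀ x ∈ closure (annulus N R₀ R₁), f x ≤ F) :
    ∀ x ∈ closure (annulus N R₀ R₁), v x ≤ F :=
  ws_le hR₀ hR hF (h.c1' hR₀ hR).continuousOn h.ws hf h.bd

lemma T_comp (hR₀ : 0 < R₀) (hR : R₀ < R₁) {f g v w : EE N → ℝ} {F : ℝ} (hF : 0 ≤ F)
    (h : IsT N R₀ R₁ f v) (h' : IsT N R₀ R₁ g w)
    (hf : ∀ x ∈ closure (annulus N R₀ R₁), |f x - g x| ≤ F) :
    ∀ x ∈ closure (annulus N R₀ R₁), |v x - w x| ≤ F := by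
  have key : ∀ {f g v w : EE N → ℝ}, IsT N R₀ R₁ f v → IsT N R₀ R₁ g w →
      (∀ x ∈ closure (annulus N R₀ R₁), |f x - g x| ≤ F) →
      ∀ x ∈ closure (annulus N R₀ R₁), v x - w x ≤ F := by
    intro f g v w h h' hf x hx
    have := ws_le (v := fun x => v x - 1 * w x) hR₀ hR hF ((h.c1' hR₀ hR).continuousOn.sub ((h'.c1' hR₀ hR).continuousOn.const_mul 1))
      (IsWS.sub_mul isOpen_annulus h.ws h'.ws 1)
      (fun x hx => by have := (abs_le.1 (hf x hx)).2; linarith)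
      (fun x hx => by have := h.bd x hx; have := h'.bd x hx; linarith) x hx
    linarith
  intro x hx
  rw [abs_le]
  have h1 := key h h' hf x hx
  have h2 := key h' h (fun x hx => by rw [abs_sub_comm]; exact hf x hx) x hx
  constructor <;> linarith

variable {p : ℝ} {a : EE N → ℝ}

lemma src_cont (hp : 2 < p) {u : EE N → ℝ} (ha : ContinuousOn a (closure (annulus N R₀ R₁)))
    (hu : ContinuousOn u (closure (annulus N R₀ R₁))) :
    ContinuousOn (fun x => a x * u x ^ (p - 1)) (closure (annulus N R₀ R₁)) :=
  ha.mul (hu.rpow_const fun x _ => Or.inr (by linarith))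

/-- first regularisation : sup bound from the energy bound -/
lemma reg1 (hN : 3 ≤ N) (hR₀ : 0 < R₀) (hR : R₀ < R₁) (hp : 2 < p) (ha : memKhat N R₀ R₁ a) (M : ℝ) :
    ∃ B : ℝ, 0 ≤ B ∧ ∀ u, memNehari N R₀ R₁ a p u → H1sq N R₀ R₁ u ≤ M →
      ∃ u', memNehari N R₀ R₁ a p u' ∧ H1sq N R₀ R₁ u' ≤ H1sq N R₀ R₁ u ∧
        ∀ x ∈ closure (annulus N R₀ R₁), u' x ≤ B := by
  obtain ⟨C, hC0, hC⟩ := sup_bound (N := N) hN hR₀ hR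
  obtain ⟨Ca, hCa0, hCa⟩ := ex_bound ha.1.continuousOn
  obtain ⟨k, hk⟩ := exists_nat_ge ((p - 1) * (N - 1 : ℕ))
  obtain ⟨C1, hC1, h1⟩ := mom (N := N) hN hR₀ hR 1
  obtain ⟨C2, hC2, h2⟩ := mom (N := N) hN hR₀ hR k
  set B := C * (1 + Ca ^ (N - 1) * (C1 * |M| ^ 1 + C2 * |M| ^ k)) with hB
  refine ⟨B, by positivity, fun u hu hM => ?_⟩
  obtain ⟨u1, u2, u3⟩ := (Khat_iff hN hR₀ hR u).1 hu.1.1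
  obtain ⟨a1, a2, a3⟩ := (Khat_iff hN hR₀ hR a).1 ha
  obtain ⟨v, hv⟩ := exists_T hN hR₀ hR (src_cont hp a1.continuousOn u1.continuousOn)
  obtain ⟨hvK, t, t0, t1, tn, th, -⟩ := Neh_step hN hR₀ hR hp ha hu hv
  refine ⟨_, tn, th, fun x hx => ?_⟩
  have hv0 := T_nonneg hR₀ hR hv (fun x hx => mul_nonneg (a2 x hx) (rpow_nonneg (u2 x hx) _)) x hx
  have hle := hC _ _ hv (fun x hx => mul_nonneg (a2 x hx) (rpow_nonneg (u2 x hx) _)) x hx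
  have hH0 := H1sq_nonneg (R₀ := R₀) (R₁ := R₁) u
  have hHM : H1sq N R₀ R₁ u ≤ |M| := hM.trans (le_abs_self M)
  have hb := BC.of_cont u1.continuousOn
  have hA := isOpen_annulus (N := N) (R₀ := R₀) (R₁ := R₁) |>.measurableSet
  have hbf := BC.of_cont (src_cont hp a1.continuousOn u1.continuousOn)
  have i1 := (hb.pow (2 * 1)).int
  have i2 := (hb.pow (2 * k)).int
  have hN2 : (2:ℝ) ≤ (N - 1 : ℕ) := by exact_mod_cast (by omega : 2 ≤ N - 1)
  have hint : ∫ x in annulus N R₀ R₁, (a x * u x ^ (p - 1)) ^ (N - 1) ≤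
      Ca ^ (N - 1) * (C1 * |M| ^ 1 + C2 * |M| ^ k) := by
    calc _ ≤ ∫ x in annulus N R₀ R₁, Ca ^ (N - 1) * (u x ^ (2 * 1) + u x ^ (2 * k)) := by
          refine setIntegral_mono_on (hbf.pow _).int ((i1.add i2).const_mul _) hA fun x hx => ?_
          have hx' := subset_closure hx
          have h0 := u2 x hx'
          have e : (a x * u x ^ (p - 1)) ^ (N - 1) = a x ^ (N - 1) * u x ^ ((p - 1) * (N - 1 : ℕ)) := by
            rw [mul_pow, rpow_mul h0, rpow_natCast]
          rw [e]
          have := rpow_le_sum (k := k) h0 (p := (p - 1) * (N - 1 : ℕ)) (by nlinarith)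
            (by refine hk.trans ?_; exact_mod_cast (by omega : k ≤ 2 * k))
          have h5 := a2 x hx'
          have h6 := (le_abs_self _).trans (hCa x hx')
          have h7 := rpow_nonneg h0 ((p - 1) * (N - 1 : ℕ))
          rw [mul_one]
          exact mul_le_mul (pow_le_pow_left₀ h5 h6 _) this h7 (by positivity)
      _ = Ca ^ (N - 1) * ((∫ x in annulus N R₀ R₁, u x ^ (2 * 1)) + ∫ x in annulus N R₀ R₁, u x ^ (2 * k)) := by
          rw [integral_const_mul, integral_add i1 i2]
      _ ≤ _ := by
          have := h1 u hu.1
          have := h2 u hu.1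
          gcongr
          · exact (h1 u hu.1).trans (by gcongr)
          · exact (h2 u hu.1).trans (by gcongr)
  calc t * v x ≤ 1 * v x := by gcongr
    _ = v x := one_mul _
    _ ≤ _ := hle.trans (by rw [hB]; gcongr)

/-- second regularisation : Lipschitz bound from the sup bound -/
lemma reg2 (hN : 3 ≤ N) (hR₀ : 0 < R₀) (hR : R₀ < R₁) (hp : 2 < p) (ha : memKhat N R₀ R₁ a) {B : ℝ}
    (hB : 0 ≤ B) :
    ∃ L : ℝ, 0 ≤ L ∧ ∀ u, memNehari N R₀ R₁ a p u → (∀ x ∈ closure (annulus N R₀ R₁), u x ≤ B) →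
      ∃ u', memNehari N R₀ R₁ a p u' ∧ H1sq N R₀ R₁ u' ≤ H1sq N R₀ R₁ u ∧
        (∀ x ∈ closure (annulus N R₀ R₁), u' x ≤ L) ∧
        ∀ x ∈ closure (annulus N R₀ R₁), ∀ y ∈ closure (annulus N R₀ R₁), ‖x - y‖ < R₀ / 2 →
          |u' x - u' y| ≤ L * ‖x - y‖ := by
  obtain ⟨Ca, hCa0, hCa⟩ := ex_bound ha.1.continuousOn
  obtain ⟨C, hC0, hC⟩ := GG_bounds (N := N) hN hR₀ hR
  set F := Ca * B ^ (p - 1) with hF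
  have hF0 : 0 ≤ F := by positivity
  refine ⟨F + C * (F + F), by positivity, fun u hu huB => ?_⟩
  obtain ⟨u1, u2, u3⟩ := (Khat_iff hN hR₀ hR u).1 hu.1.1
  obtain ⟨a1, a2, a3⟩ := (Khat_iff hN hR₀ hR a).1 ha
  obtain ⟨v, hv⟩ := exists_T hN hR₀ hR (src_cont hp a1.continuousOn u1.continuousOn)
  obtain ⟨hvK, t, t0, t1, tn, th, -⟩ := Neh_step hN hR₀ hR hp ha hu hv
  have hf0 : ∀ x ∈ closure (annulus N R₀ R₁), 0 ≤ a x * u x ^ (p - 1) :=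
    fun x hx => mul_nonneg (a2 x hx) (rpow_nonneg (u2 x hx) _)
  have hfF : ∀ x ∈ closure (annulus N R₀ R₁), a x * u x ^ (p - 1) ≤ F := fun x hx =>
    mul_le_mul ((le_abs_self _).trans (hCa x hx)) (rpow_le_rpow (u2 x hx) (huB x hx) (by linarith))
      (rpow_nonneg (u2 x hx) _) hCa0
  have hv0 := T_nonneg hR₀ hR hv hf0
  have hvF := T_le hR₀ hR hF0 hv hfF
  refine ⟨_, tn, th, fun x hx => ?_, fun x hx y hy hxy => ?_⟩
  · have := hvF x hx
    have := hv0 x hx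
    have : 0 ≤ C * (F + F) := by positivity
    nlinarith
  · have h1 := ((hC (F + F) (fun y => a y * u y ^ (p - 1) - v y) (by positivity)
      (hv.cf.sub (hv.c1' hR₀ hR).continuousOn) (fun y hy => by
        rw [abs_le]
        have := hvF y hy
        have := hv0 y hy
        have := hfF y hy
        have := hf0 y hy
        constructor <;> linarith) x hx).2.2 y hy hxy).1
    rw [← hv.rep] at h1
    rw [← mul_sub, abs_mul, abs_of_pos t0]
    calc t * |v x - v y| ≤ 1 * |v x - v y| := by gcongr
      _ = |v x - v y| := one_mul _
      _ ≤ _ := h1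
      _ ≤ _ := by gcongr; linarith

/-- compactness -/
lemma ascoli (hR₀ : 0 < R₀) {L : ℝ} (hL : 0 ≤ L) (w : ℕ → EE N → ℝ)
    (hc : ∀ n, ContinuousOn (w n) (closure (annulus N R₀ R₁)))
    (h0 : ∀ n, ∀ x ∈ closure (annulus N R₀ R₁), |w n x| ≤ L)
    (h1 : ∀ n, ∀ x ∈ closure (annulus N R₀ R₁), ∀ y ∈ closure (annulus N R₀ R₁), ‖x - y‖ < R₀ / 2 →
          |w n x - w n y| ≤ L * ‖x - y‖) :
    ∃ W : EE N → ℝ, ContinuousOn W (closure (annulus N R₀ R₁)) ∧ ∃ φ : ℕ → ℕ, StrictMono φ ∧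
      ∀ ε > 0, ∃ n0, ∀ n ≥ n0, ∀ x ∈ closure (annulus N R₀ R₁), |w (φ n) x - W x| ≤ ε := by
  have : CompactSpace (closure (annulus N R₀ R₁)) := isCompact_iff_compactSpace.1 compact_closure_annulus
  let g : ℕ → BoundedContinuousFunction (closure (annulus N R₀ R₁)) ℝ := fun n => reX (hc n)
  have hcomp : IsCompact (closure (range g)) := by
    refine BoundedContinuousFunction.arzela_ascoli (Icc (-L) L) isCompact_Icc _ ?_ ?_
    · rintro f x ⟨n, rfl⟩
      exact abs_le.1 (h0 n x x.2)
    · intro x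
      rw [Metric.equicontinuousAt_iff]
      intro ε hε
      refine ⟨min (R₀ / 2) (ε / (L + 1)), by positivity, fun y hy f => ?_⟩
      obtain ⟨_, n, rfl⟩ := f
      have hd : ‖(x:EE N) - y‖ < min (R₀ / 2) (ε / (L + 1)) := by
        rw [← dist_eq_norm, dist_comm]; exact hy
      have h2 := h1 n x x.2 y y.2 (hd.trans_le (min_le_left _ _))
      have h3 := hd.trans_le (min_le_right _ _)
      rw [lt_div_iff₀ (by positivity)] at h3
      show dist (w n x) (w n y) < ε
      rw [Real.dist_eq]
      nlinarith [norm_nonneg ((x:EE N) - y)]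
  obtain ⟨G, -, φ, hφ, hlim⟩ := hcomp.tendsto_subseq (fun n => subset_closure (mem_range_self n) : ∀ n, g n ∈ _)
  refine ⟨exX G, exX_cont G, φ, hφ, fun ε hε => ?_⟩
  obtain ⟨n0, hn0⟩ := (Metric.tendsto_atTop.1 hlim) ε hε
  refine ⟨n0, fun n hn x hx => ?_⟩
  rw [exX_of_mem G hx]
  exact (BoundedContinuousFunction.dist_coe_le_dist (f := g (φ n)) (g := G) ⟨x, hx⟩).trans (hn0 n hn).le

end Exist


section Exist2
variable {N : ℕ} {R₀ R₁ : ℝ}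

lemma lim_int {g : ℕ → EE N → ℝ} {G : EE N → ℝ} {C : ℝ} (hc : ∀ n, ContinuousOn (g n) (annulus N R₀ R₁))
    (hb : ∀ n, ∀ x ∈ annulus N R₀ R₁, |g n x| ≤ C)
    (hl : ∀ x ∈ annulus N R₀ R₁, Filter.Tendsto (fun n => g n x) Filter.atTop (nhds (G x))) :
    Filter.Tendsto (fun n => ∫ x in annulus N R₀ R₁, g n x) Filter.atTop
      (nhds (∫ x in annulus N R₀ R₁, G x)) := by
  have hA := isOpen_annulus (N := N) (R₀ := R₀) (R₁ := R₁) |>.measurableSet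
  refine tendsto_integral_of_dominated_convergence (fun _ => C) (fun n => (hc n).aestronglyMeasurable hA)
    (integrableOn_const annulus_vol_lt_top.ne) (fun n => ?_) ?_
  · exact (ae_restrict_iff' hA).2 (Filter.Eventually.of_forall (hb n))
  · exact (ae_restrict_iff' hA).2 (Filter.Eventually.of_forall hl)

variable {p : ℝ} {a : EE N → ℝ}

lemma H1sq_T (hR₀ : 0 < R₀) (hR : R₀ < R₁) {f v : EE N → ℝ} (h : IsT N R₀ R₁ f v)
    (hf : ∀ x ∈ closure (annulus N R₀ R₁), 0 ≤ f x) :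
    H1sq N R₀ R₁ v = ∫ x in annulus N R₀ R₁, f x * v x := by
  rw [← T_test hR₀ hR h (h.c1' hR₀ hR) (T_nonneg hR₀ hR h hf) h.bd, H1sq_eq]
  congr 1
  ext x
  rw [real_inner_self_eq_norm_sq]
  ring

lemma limit (hN : 3 ≤ N) (hR₀ : 0 < R₀) (hR : R₀ < R₁) (hp : 2 < p) (ha : memKhat N R₀ R₁ a)
    {m L : ℝ} (hm : 0 < m) (hmin : ∀ u, memNehari N R₀ R₁ a p u → m ≤ H1sq N R₀ R₁ u) (w : ℕ → EE N → ℝ)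
    (hw : ∀ n, memNehari N R₀ R₁ a p (w n)) (hwL : ∀ n, ∀ x ∈ closure (annulus N R₀ R₁), w n x ≤ L)
    (hL0 : 0 ≤ L)
    (hlim : Filter.Tendsto (fun n => H1sq N R₀ R₁ (w n)) Filter.atTop (nhds m)) {W : EE N → ℝ}
    (hWc : ContinuousOn W (closure (annulus N R₀ R₁)))
    (hW : ∀ ε > 0, ∃ n0, ∀ n ≥ n0, ∀ x ∈ closure (annulus N R₀ R₁), |w n x - W x| ≤ ε) :
    ∃ u, memNehari N R₀ R₁ a p u ∧ H1sq N R₀ R₁ u = m := by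
  obtain ⟨a1, a2, a3⟩ := (Khat_iff hN hR₀ hR a).1 ha
  obtain ⟨Ca, hCa0, hCa⟩ := ex_bound a1.continuousOn
  have hwK := fun n => (Khat_iff hN hR₀ hR (w n)).1 (hw n).1.1
  have hpt : ∀ x ∈ closure (annulus N R₀ R₁), Filter.Tendsto (fun n => w n x) Filter.atTop (nhds (W x)) := by
    intro x hx
    rw [Metric.tendsto_atTop]
    intro ε hε
    obtain ⟨n0, h⟩ := hW (ε / 2) (by positivity)
    refine ⟨n0, fun n hn => ?_⟩
    rw [Real.dist_eq]
    linarith [h n hn x hx]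
  have hW0 : ∀ x ∈ closure (annulus N R₀ R₁), 0 ≤ W x := fun x hx =>
    ge_of_tendsto' (hpt x hx) fun n => (hwK n).2.1 x hx
  have hWL : ∀ x ∈ closure (annulus N R₀ R₁), W x ≤ L := fun x hx =>
    le_of_tendsto' (hpt x hx) fun n => hwL n x hx
  have hWP : PP N R₀ R₁ W := fun x hx y hy e1 e2 =>
    le_of_tendsto_of_tendsto' (hpt y hy) (hpt x hx) fun n => (hwK n).2.2 x hx y hy e1 e2
  have hfc : ∀ n, ContinuousOn (fun x => a x * w n x ^ (p - 1)) (closure (annulus N R₀ R₁)) := fun n =>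
    src_cont hp a1.continuousOn (hwK n).1.continuousOn
  choose z hz using fun n => exists_T hN hR₀ hR (hfc n)
  choose hzK t t0 t1 tn th _ using fun n => Neh_step hN hR₀ hR hp ha (hw n) (hz n)
  obtain ⟨Z, hZ⟩ := exists_T hN hR₀ hR (src_cont hp a1.continuousOn hWc)
  have hf0 : ∀ x ∈ closure (annulus N R₀ R₁), 0 ≤ a x * W x ^ (p - 1) :=
    fun x hx => mul_nonneg (a2 x hx) (rpow_nonneg (hW0 x hx) _)
  have hfP : PP N R₀ R₁ (fun x => a x * W x ^ (p - 1)) :=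
    a3.mul (hWP.rpow hW0 (by linarith)) a2 fun x hx => rpow_nonneg (hW0 x hx) _
  have hZK := T_memK hN hR₀ hR hZ hf0 hfP
  have hf0n : ∀ n, ∀ x ∈ closure (annulus N R₀ R₁), 0 ≤ a x * w n x ^ (p - 1) :=
    fun n x hx => mul_nonneg (a2 x hx) (rpow_nonneg ((hwK n).2.1 x hx) _)
  set F := Ca * L ^ (p - 1) with hF
  have hF0 : 0 ≤ F := by positivity
  have hfFn : ∀ n, ∀ x ∈ closure (annulus N R₀ R₁), a x * w n x ^ (p - 1) ≤ F := fun n x hx =>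
    mul_le_mul ((le_abs_self _).trans (hCa x hx)) (rpow_le_rpow ((hwK n).2.1 x hx) (hwL n x hx) (by linarith))
      (rpow_nonneg ((hwK n).2.1 x hx) _) hCa0
  have hz0 := fun n => T_nonneg hR₀ hR (hz n) (hf0n n)
  have hzF := fun n => T_le hR₀ hR hF0 (hz n) (hfFn n)
  have hZ0 := T_nonneg hR₀ hR hZ hf0
  have hfpt : ∀ x ∈ closure (annulus N R₀ R₁), Filter.Tendsto (fun n => a x * w n x ^ (p - 1)) Filter.atTop
      (nhds (a x * W x ^ (p - 1))) := fun x hx =>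
    ((hpt x hx).rpow_const (Or.inr (by linarith))).const_mul _
  have hzpt : ∀ x ∈ closure (annulus N R₀ R₁), Filter.Tendsto (fun n => z n x) Filter.atTop (nhds (Z x)) := by
    intro x hx
    rw [Metric.tendsto_atTop]
    intro ε hε
    have huc := (isCompact_Icc (a := (0:ℝ)) (b := L)).uniformContinuousOn_of_continuous
      (f := fun s => s ^ (p - 1)) (continuousOn_id.rpow_const fun x _ => Or.inr (by linarith))
    rw [Metric.uniformContinuousOn_iff] at huc
    obtain ⟨δ, hδ, hd⟩ := huc (ε / 2 / (Ca + 1)) (by positivity)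
    obtain ⟨n0, h⟩ := hW (δ / 2) (by positivity)
    refine ⟨n0, fun n hn => ?_⟩
    rw [Real.dist_eq]
    refine lt_of_le_of_lt (T_comp hR₀ hR (F := ε / 2) (by positivity) (hz n) hZ (fun y hy => ?_) x hx) (by linarith)
    rw [← mul_sub, abs_mul]
    have h1 := hd (w n y) ⟨(hwK n).2.1 y hy, hwL n y hy⟩ (W y) ⟨hW0 y hy, hWL y hy⟩
      (by rw [Real.dist_eq]; linarith [h n hn y hy])
    rw [Real.dist_eq, lt_div_iff₀ (by positivity)] at h1
    have h2 := hCa y hy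
    have h3 := abs_nonneg (w n y ^ (p - 1) - W y ^ (p - 1))
    nlinarith
  obtain ⟨τ, hτ, φ, hφ, hφl⟩ := (isCompact_Icc (a := (0:ℝ)) (b := 1)).tendsto_subseq
    (fun n => ⟨(t0 n).le, t1 n⟩ : ∀ n, t n ∈ Icc (0:ℝ) 1)
  have hφt := hφ.tendsto_atTop
  have hzc := fun n => ((hz n).c1' hR₀ hR).continuousOn
  have l1 : Filter.Tendsto (fun n => H1sq N R₀ R₁ (z n)) Filter.atTop (nhds (H1sq N R₀ R₁ Z)) := by
    rw [H1sq_T hR₀ hR hZ hf0]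
    simp_rw [fun n => H1sq_T hR₀ hR (hz n) (hf0n n)]
    refine lim_int (C := F * F) (fun n => ((hfc n).mul (hzc n)).mono subset_closure) (fun n x hx => ?_)
      fun x hx => (hfpt x (subset_closure hx)).mul (hzpt x (subset_closure hx))
    have hx' := subset_closure hx
    rw [abs_of_nonneg (mul_nonneg (hf0n n x hx') (hz0 n x hx'))]
    exact mul_le_mul (hfFn n x hx') (hzF n x hx') (hz0 n x hx') hF0
  have l2 : Filter.Tendsto (fun n => H1sq N R₀ R₁ (fun x => t (φ n) * z (φ n) x)) Filter.atTop (nhds m) :=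
    tendsto_of_tendsto_of_tendsto_of_le_of_le tendsto_const_nhds (hlim.comp hφt)
      (fun n => hmin _ (tn (φ n))) (fun n => th (φ n))
  have l3 : Filter.Tendsto (fun n => H1sq N R₀ R₁ (fun x => t (φ n) * z (φ n) x)) Filter.atTop
      (nhds (H1sq N R₀ R₁ (fun x => τ * Z x))) := by
    rw [H1sq_smul (hZ.c1' hR₀ hR)]
    simp_rw [fun n => H1sq_smul ((hz n).c1' hR₀ hR)]
    exact (hφl.pow 2).mul (l1.comp hφt)
  have l4 : Filter.Tendsto (fun n => H1sq N R₀ R₁ (fun x => t (φ n) * z (φ n) x)) Filter.atTop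
      (nhds (∫ x in annulus N R₀ R₁, a x * |τ * Z x| ^ p)) := by
    simp_rw [fun n => (tn n).2.2]
    refine lim_int (C := Ca * F ^ p) (fun n => ((a1.continuousOn.mul
      (((continuousOn_const.mul (hzc _)).abs).rpow_const fun x _ => Or.inr (by linarith)))).mono subset_closure)
      (fun n x hx => ?_) fun x hx => ?_
    · have hx' := subset_closure hx
      have hnn : 0 ≤ |t (φ n) * z (φ n) x| := abs_nonneg _
      rw [abs_mul, abs_of_nonneg (rpow_nonneg hnn p)]
      refine mul_le_mul (hCa x hx') (rpow_le_rpow hnn ?_ (by linarith)) (rpow_nonneg hnn p) hCa0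
      rw [abs_of_nonneg (mul_nonneg (t0 _).le (hz0 _ x hx'))]
      have := hz0 (φ n) x hx'
      have := hzF (φ n) x hx'
      have := t1 (φ n)
      nlinarith
    · have h1 := hφl.mul ((hzpt x (subset_closure hx)).comp hφt)
      exact (h1.abs.rpow_const (Or.inr (by linarith))).const_mul _
  have e1 := tendsto_nhds_unique l3 l2
  have e2 := tendsto_nhds_unique l4 l2
  refine ⟨_, ⟨memK_smul hN hR₀ hR hZK hτ.1, ?_, e1.trans e2.symm⟩, e1⟩
  by_contra hcon
  push Not at hcon
  have : ∫ x in annulus N R₀ R₁, a x * |τ * Z x| ^ p = 0 := by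
    rw [setIntegral_congr_fun (g := fun _ => (0:ℝ)) isOpen_annulus.measurableSet fun x hx => ?_]
    · simp
    · beta_reduce
      rw [hcon x hx, abs_zero, zero_rpow (by linarith), mul_zero]
  linarith

lemma Neh_nonempty (hN : 3 ≤ N) (hR₀ : 0 < R₀) (hR : R₀ < R₁) (hp : 2 < p) (ha : memKhat N R₀ R₁ a)
    (hapos : ∀ x ∈ closure (annulus N R₀ R₁), 0 < a x) : ∃ u, memNehari N R₀ R₁ a p u := by
  set u : EE N → ℝ := fun x => (‖x‖ ^ 2 - R₀ ^ 2) * (R₁ ^ 2 - ‖x‖ ^ 2) with hu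
  have hn : ContDiff ℝ 1 fun x : EE N => ‖x‖ ^ 2 := contDiff_norm_sq ℝ
  have h1 : ContDiffOn ℝ 1 u (closure (annulus N R₀ R₁)) :=
    ((hn.sub contDiff_const).mul (contDiff_const.sub hn)).contDiffOn
  have hpos : ∀ x ∈ annulus N R₀ R₁, 0 < u x := by
    intro x hx
    have h1 : R₀ < ‖x‖ := hx.1
    have h2 : ‖x‖ < R₁ := hx.2
    refine mul_pos ?_ ?_ <;> nlinarith
  have hbd : ∀ x : EE N, (‖x‖ = R₀ ∨ ‖x‖ = R₁) → u x = 0 := by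
    intro x hx
    simp only [hu]
    rcases hx with h | h <;> rw [h] <;> ring
  have hnn : ∀ x ∈ closure (annulus N R₀ R₁), 0 ≤ u x := fun x hx => by
    rcases mem_or_bd hR₀ hR hx with h | h
    · exact (hpos x h).le
    · exact (hbd x h).ge
  have hK : memK N R₀ R₁ u := ⟨(Khat_iff hN hR₀ hR u).2 ⟨h1, hnn, fun x _ y _ e _ => by
    simp only [hu]; rw [e]⟩, hbd⟩
  have hex : ∃ x : EE N, x ∈ annulus N R₀ R₁ := by
    have : Nontrivial (EE N) := by
      haveI : Nonempty (Fin N) := ⟨⟨0, by omega⟩⟩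
      infer_instance
    obtain ⟨x, hx⟩ := exists_norm_eq (EE N) (c := (R₀ + R₁) / 2) (by linarith)
    refine ⟨x, ?_⟩
    show _ ∧ _
    rw [hx]
    constructor <;> linarith
  obtain ⟨x0, hx0⟩ := hex
  have hD : 0 < ∫ x in annulus N R₀ R₁, a x * u x ^ p := by
    refine int_pos ((BC.of_cont ha.1.continuousOn).mul ((BC.of_cont h1.continuousOn).rpow (by linarith)
      fun x hx => (hpos x hx).le)) (fun x hx => ?_) ⟨x0, hx0, ?_⟩
    · exact mul_nonneg (hapos x (subset_closure hx)).le (rpow_nonneg (hpos x hx).le _)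
    · exact (mul_pos (hapos x0 (subset_closure hx0)) (rpow_pos_of_pos (hpos x0 hx0) _)).ne'
  exact ⟨_, Neh_scale hN hR₀ hR hp hK (H1sq_pos hR₀ hR h1 ⟨x0, hx0, (hpos x0 hx0).ne'⟩) hD rfl rfl⟩

lemma exists_min (hN : 3 ≤ N) (hR₀ : 0 < R₀) (hR : R₀ < R₁) (hp : 2 < p) (ha : memKhat N R₀ R₁ a)
    (hapos : ∀ x ∈ closure (annulus N R₀ R₁), 0 < a x) :
    ∃ u, memNehari N R₀ R₁ a p u ∧ 0 < H1sq N R₀ R₁ u ∧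
      ∀ v, memNehari N R₀ R₁ a p v → H1sq N R₀ R₁ u ≤ H1sq N R₀ R₁ v := by
  obtain ⟨c, hc, hlow⟩ := nehari_low hN hR₀ hR hp ha
  obtain ⟨u0, hu0⟩ := Neh_nonempty hN hR₀ hR hp ha hapos
  set S : Set ℝ := {s | ∃ u, memNehari N R₀ R₁ a p u ∧ H1sq N R₀ R₁ u = s} with hS
  have hne : S.Nonempty := ⟨_, u0, hu0, rfl⟩
  have hbdd : BddBelow S := ⟨c, by rintro _ ⟨u, hu, rfl⟩; exact hlow u hu⟩
  set m := sInf S with hm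
  have hm0 : 0 < m := hc.trans_le (le_csInf hne (by rintro _ ⟨u, hu, rfl⟩; exact hlow u hu))
  have hmin : ∀ u, memNehari N R₀ R₁ a p u → m ≤ H1sq N R₀ R₁ u := fun u hu => csInf_le hbdd ⟨u, hu, rfl⟩
  obtain ⟨s, hanti, hslim, hsS⟩ := exists_seq_tendsto_sInf hne hbdd
  choose u hu hus using hsS
  obtain ⟨B, hB0, hB⟩ := reg1 hN hR₀ hR hp ha (s 0)
  choose u' hu' hle' huB' using fun n => hB (u n) (hu n) (by rw [hus]; exact hanti (Nat.zero_le n))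
  obtain ⟨L, hL0, hL⟩ := reg2 hN hR₀ hR hp ha hB0
  choose w hw hlew hwL hwlip using fun n => hL (u' n) (hu' n) (huB' n)
  have hwK := fun n => (Khat_iff hN hR₀ hR (w n)).1 (hw n).1.1
  obtain ⟨W, hWc, φ, hφ, hconv⟩ := ascoli hR₀ hL0 w (fun n => (hwK n).1.continuousOn)
    (fun n x hx => by rw [abs_of_nonneg ((hwK n).2.1 x hx)]; exact hwL n x hx) hwlip
  have hlim : Filter.Tendsto (fun n => H1sq N R₀ R₁ (w n)) Filter.atTop (nhds m) :=
    tendsto_of_tendsto_of_tendsto_of_le_of_le tendsto_const_nhds hslim (fun n => hmin _ (hw n))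
      (fun n => by rw [← hus]; exact (hlew n).trans (hle' n))
  obtain ⟨v, hv, hvm⟩ := limit hN hR₀ hR hp ha hm0 hmin (fun n => w (φ n)) (fun n => hw _) (fun n => hwL _)
    hL0 (hlim.comp hφ.tendsto_atTop) hWc hconv
  exact ⟨v, hv, hvm ▸ hm0, fun y hy => hvm ▸ hmin y hy⟩

end Exist2


section Final
variable {N : ℕ} {R₀ R₁ p : ℝ} {a : EE N → ℝ}

lemma min_sol (hN : 3 ≤ N) (hR₀ : 0 < R₀) (hR : R₀ < R₁) (hp : 2 < p) (ha : memKhat N R₀ R₁ a)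
    {u : EE N → ℝ} (hu : memNehari N R₀ R₁ a p u)
    (hmin : ∀ v, memNehari N R₀ R₁ a p v → H1sq N R₀ R₁ u ≤ H1sq N R₀ R₁ v) :
    (∀ x ∈ annulus N R₀ R₁, 0 < u x) ∧ IsWeakSolution N R₀ R₁ a p u := by
  obtain ⟨u1, u2, u3⟩ := (Khat_iff hN hR₀ hR u).1 hu.1.1
  obtain ⟨a1, a2, a3⟩ := (Khat_iff hN hR₀ hR a).1 ha
  obtain ⟨v, hv⟩ := exists_T hN hR₀ hR (src_cont hp a1.continuousOn u1.continuousOn)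
  obtain ⟨hvK, t, t0, t1, tn, th, heq⟩ := Neh_step hN hR₀ hR hp ha hu hv
  have huv := heq (hmin _ tn)
  have hws : IsWS (annulus N R₀ R₁) (fun x => a x * u x ^ (p - 1)) u :=
    IsWS.congr isOpen_annulus hv.ws (fun x _ => rfl) huv
  constructor
  · obtain ⟨x0, hx0, hne⟩ := hu.2.1
    exact smp isOpen_annulus (preconn_annulus hN hR₀) hws
      (fun x hx => mul_nonneg (a2 x (subset_closure hx)) (rpow_nonneg (u2 x (subset_closure hx)) _))
      (fun x hx => u2 x (subset_closure hx)) hx0 (lt_of_le_of_ne (u2 x0 (subset_closure hx0)) hne.symm)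
  · refine ⟨⟨u1, hu.1.2⟩, fun φ hφ => ?_⟩
    have hA := isOpen_annulus (N := N) (R₀ := R₀) (R₁ := R₁) |>.measurableSet
    have h := hws.eq φ (hφ.1.of_le (by exact_mod_cast le_top)) hφ.2.1 hφ.2.2
    have hz : ∀ x, x ∉ annulus N R₀ R₁ → φ x = 0 ∧ gradient φ x = 0 := fun x hx =>
      have hx' : x ∉ tsupport φ := fun h => hx (hφ.2.2 h)
      ⟨image_eq_zero_of_notMem_tsupport hx', grad_zero_of_notMem hx'⟩
    have e1 := setIntegral_eq_integral_of_forall_compl_eq_zero (μ := volume) (s := annulus N R₀ R₁)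
      (f := fun x => inner ℝ (gradient u x) (gradient φ x) + u x * φ x) (fun x hx => by
        rw [(hz x hx).1, (hz x hx).2]; simp)
    have e2 := setIntegral_eq_integral_of_forall_compl_eq_zero (μ := volume) (s := annulus N R₀ R₁)
      (f := fun x => a x * u x ^ (p - 1) * φ x) (fun x hx => by rw [(hz x hx).1, mul_zero])
    calc _ = ∫ x in annulus N R₀ R₁, (inner ℝ (gradient u x) (gradient φ x) + u x * φ x) := by
          refine setIntegral_congr_fun hA fun x hx => ?_
          beta_reduce
          rw [fderivWithin_annulus u hx, inner_grad]
      _ = ∫ x in annulus N R₀ R₁, a x * u x ^ (p - 1) * φ x := e1.trans (h.trans e2.symm)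
      _ = _ := by
          refine setIntegral_congr_fun hA fun x hx => ?_
          beta_reduce
          have h0 := u2 x (subset_closure hx)
          have e : u x ^ (p - 1) = u x ^ (p - 2) * u x := by
            rcases h0.eq_or_lt with h0 | h0
            · rw [← h0, zero_rpow (by linarith), mul_zero]
            · rw [show p - 1 = (p - 2) + 1 by ring, rpow_add_one h0.ne']
          rw [abs_of_nonneg h0, e]
          ring

end Final



/-- existence of a `K`-ground state solution. -/
theorem statement0 (N : ℕ) (hN : 3 ≤ N) (R₀ R₁ : ℝ) (hR₀ : 0 < R₀) (hR : R₀ < R₁)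
    (p : ℝ) (hp : 2 < p) (a : EuclideanSpace ℝ (Fin N) → ℝ)
    (ha : memKhat N R₀ R₁ a) (hapos : ∀ x ∈ closure (annulus N R₀ R₁), 0 < a x) :
    0 < cI N R₀ R₁ a p ∧
    (∃ u, memNehari N R₀ R₁ a p u ∧ funcI N R₀ R₁ a p u = cI N R₀ R₁ a p) ∧
    (∀ u, memNehari N R₀ R₁ a p u → funcI N R₀ R₁ a p u = cI N R₀ R₁ a p →
      memK N R₀ R₁ u ∧ (∃ x ∈ annulus N R₀ R₁, u x ≠ 0) ∧
      (∀ x ∈ annulus N R₀ R₁, 0 < u x) ∧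
      IsWeakSolution N R₀ R₁ a p u) := by
  have hq : 0 < 1 / 2 - 1 / p := by
    rw [sub_pos]
    exact one_div_lt_one_div_of_lt (by norm_num) hp
  obtain ⟨u0, hu0, hpos, hmin⟩ := exists_min hN hR₀ hR hp ha hapos
  have hcI : cI N R₀ R₁ a p = funcI N R₀ R₁ a p u0 := by
    refine IsLeast.csInf_eq ⟨⟨u0, hu0, rfl⟩, ?_⟩
    rintro _ ⟨v, hv, rfl⟩
    rw [Neh_I hp hu0, Neh_I hp hv]
    exact mul_le_mul_of_nonneg_left (hmin v hv) hq.le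
  refine ⟨?_, ⟨u0, hu0, hcI.symm⟩, fun u hu hI => ?_⟩
  · rw [hcI, Neh_I hp hu0]
    exact mul_pos hq hpos
  · rw [hcI, Neh_I hp hu0, Neh_I hp hu] at hI
    have hH := mul_left_cancel₀ hq.ne' hI
    exact ⟨hu.1, hu.2.1, min_sol hN hR₀ hR hp ha hu fun v hv => hH ▸ hmin v hv⟩
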